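/- Let T be any recursively enumerable extension of PA(K) having Bⁿ⁺¹-DP. Then for any L_□-sentences φ₁, …, φₙ and any Σ₁ sentence σ, if T ⊢ □φ₁ ∨ ⋯ ∨ □φₙ ∨ σ, then T ⊢ □φᵢ for some i (1 ≤ i ≤ n) or T ⊢ σ. -/

import Mathlib

namespace ModalArith

/-- Terms of the language of arithmetic L_A = {0, S, +, ×, ≤, =}. -/
inductive Term : Type
  | var : ℕ → Term
  | zero : Term
  | succ : Term → Term
  | add : Term → Term → Term
  | mul : Term → Term → Term
  deriving DecidableEq

namespace Term

/-- Free variables of a term. -/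
def fv : Term → Finset ℕ
  | var x => {x}
  | zero => ∅
  | succ t => fv t
  | add t u => fv t ∪ fv u
  | mul t u => fv t ∪ fv u

/-- Simultaneous substitution of terms for variables. -/
def substAll : Term → (ℕ → Term) → Term
  | var x, v => v x
  | zero, _ => zero
  | succ t, v => succ (substAll t v)
  | add t u, v => add (substAll t v) (substAll u v)
  | mul t u, v => mul (substAll t v) (substAll u v)

/-- Substitution of the term `s` for the variable `x`. -/
def subst (x : ℕ) (s : Term) (t : Term) : Term :=
  substAll t (Function.update Term.var x s)

/-- The numeral `n̄`. -/
def numeral : ℕ → Term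
  | 0 => zero
  | n + 1 => succ (numeral n)

/-- Value of a term in the standard model under a valuation. -/
def val : Term → (ℕ → ℕ) → ℕ
  | var x, v => v x
  | zero, _ => 0
  | succ t, v => val t v + 1
  | add t u, v => val t v + val u v
  | mul t u, v => val t v * val u v

/-- A Gödel numbering of terms. -/
def code : Term → ℕ
  | var x => Nat.pair 0 x
  | zero => Nat.pair 1 0
  | succ t => Nat.pair 2 (code t)
  | add t u => Nat.pair 3 (Nat.pair (code t) (code u))
  | mul t u => Nat.pair 4 (Nat.pair (code t) (code u))

end Term

/-- Formulas of the language L_□ of modal arithmetic. -/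
inductive Formula : Type
  | falsum : Formula
  | eq : Term → Term → Formula
  | le : Term → Term → Formula
  | and : Formula → Formula → Formula
  | or : Formula → Formula → Formula
  | imp : Formula → Formula → Formula
  | neg : Formula → Formula
  | all : ℕ → Formula → Formula
  | ex : ℕ → Formula → Formula
  | box : Formula → Formula
  deriving DecidableEq

namespace Formula

/-- Free variables of a formula. -/
def fv : Formula → Finset ℕ
  | falsum => ∅
  | eq t u => t.fv ∪ u.fv
  | le t u => t.fv ∪ u.fv
  | and φ ψ => fv φ ∪ fv ψ
  | or φ ψ => fv φ ∪ fv ψ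
  | imp φ ψ => fv φ ∪ fv ψ
  | neg φ => fv φ
  | all x φ => (fv φ).erase x
  | ex x φ => (fv φ).erase x
  | box φ => fv φ

/-- Simultaneous substitution of terms for the free variables of a formula. -/
def substAll : Formula → (ℕ → Term) → Formula
  | falsum, _ => falsum
  | eq t u, v => eq (t.substAll v) (u.substAll v)
  | le t u, v => le (t.substAll v) (u.substAll v)
  | and φ ψ, v => and (substAll φ v) (substAll ψ v)
  | or φ ψ, v => or (substAll φ v) (substAll ψ v)
  | imp φ ψ, v => imp (substAll φ v) (substAll ψ v)
  | neg φ, v => neg (substAll φ v)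
  | all x φ, v => all x (substAll φ (Function.update v x (Term.var x)))
  | ex x φ, v => ex x (substAll φ (Function.update v x (Term.var x)))
  | box φ, v => box (substAll φ v)

/-- Substitution of the term `s` for the free occurrences of the variable `x`. -/
def subst (x : ℕ) (s : Term) (φ : Formula) : Formula :=
  substAll φ (Function.update Term.var x s)

/-- The term `s` is substitutable (free) for the variable `x` in the formula. -/
def freeFor (s : Term) (x : ℕ) : Formula → Prop
  | falsum => True
  | eq _ _ => True
  | le _ _ => True
  | and φ ψ => freeFor s x φ ∧ freeFor s x ψ
  | or φ ψ => freeFor s x φ ∧ freeFor s x ψ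
  | imp φ ψ => freeFor s x φ ∧ freeFor s x ψ
  | neg φ => freeFor s x φ
  | all y φ => x = y ∨ x ∉ fv φ ∨ (y ∉ s.fv ∧ freeFor s x φ)
  | ex y φ => x = y ∨ x ∉ fv φ ∨ (y ∉ s.fv ∧ freeFor s x φ)
  | box φ => freeFor s x φ

/-- The formula is an L_A-formula (contains no □). -/
def noBox : Formula → Prop
  | falsum => True
  | eq _ _ => True
  | le _ _ => True
  | and φ ψ => noBox φ ∧ noBox ψ
  | or φ ψ => noBox φ ∧ noBox ψ
  | imp φ ψ => noBox φ ∧ noBox ψ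
  | neg φ => noBox φ
  | all _ φ => noBox φ
  | ex _ φ => noBox φ
  | box _ => False

/-- Truth in the standard model ℕ under a valuation (meaningful for L_A-formulas;
boxed formulas are given the dummy value `False`). -/
def val : Formula → (ℕ → ℕ) → Prop
  | falsum, _ => False
  | eq t u, v => t.val v = u.val v
  | le t u, v => t.val v ≤ u.val v
  | and φ ψ, v => val φ v ∧ val ψ v
  | or φ ψ, v => val φ v ∨ val ψ v
  | imp φ ψ, v => val φ v → val ψ v
  | neg φ, v => ¬ val φ v
  | all x φ, v => ∀ n : ℕ, val φ (Function.update v x n)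
  | ex x φ, v => ∃ n : ℕ, val φ (Function.update v x n)
  | box _, _ => False

/-- Biconditional, as an abbreviation. -/
def iff (φ ψ : Formula) : Formula := (φ.imp ψ).and (ψ.imp φ)

/-- `t < u` abbreviates `S t ≤ u`. -/
def lt (t u : Term) : Formula := le (Term.succ t) u

/-- Bounded universal quantification `∀ x < t, φ`. -/
def ball (x : ℕ) (t : Term) (φ : Formula) : Formula :=
  all x ((lt (Term.var x) t).imp φ)

/-- Bounded existential quantification `∃ x < t, φ`. -/
def bex (x : ℕ) (t : Term) (φ : Formula) : Formula :=
  ex x ((lt (Term.var x) t).and φ)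

/-- A Gödel numbering of formulas. -/
def code : Formula → ℕ
  | falsum => Nat.pair 0 0
  | eq t u => Nat.pair 1 (Nat.pair t.code u.code)
  | le t u => Nat.pair 2 (Nat.pair t.code u.code)
  | and φ ψ => Nat.pair 3 (Nat.pair (code φ) (code ψ))
  | or φ ψ => Nat.pair 4 (Nat.pair (code φ) (code ψ))
  | imp φ ψ => Nat.pair 5 (Nat.pair (code φ) (code ψ))
  | neg φ => Nat.pair 6 (code φ)
  | all x φ => Nat.pair 7 (Nat.pair x (code φ))
  | ex x φ => Nat.pair 8 (Nat.pair x (code φ))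
  | box φ => Nat.pair 9 (code φ)

end Formula

/-- A sentence is a formula with no free variables. -/
def Sentence (φ : Formula) : Prop := φ.fv = ∅

/-- Truth in the standard model ℕ (for sentences; any fixed valuation will do). -/
def StdTrue (φ : Formula) : Prop := φ.val fun _ => 0

/-- The logical axioms of classical first-order logic with equality for L_□,
with the identity axioms only for atomic formulas. -/
inductive LogicalAxiom : Formula → Prop
  | imp1 (φ ψ : Formula) : LogicalAxiom (φ.imp (ψ.imp φ))
  | imp2 (φ ψ χ : Formula) :
      LogicalAxiom ((φ.imp (ψ.imp χ)).imp ((φ.imp ψ).imp (φ.imp χ)))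
  | dne (φ : Formula) : LogicalAxiom (φ.neg.neg.imp φ)
  | negI (φ ψ : Formula) : LogicalAxiom ((φ.imp ψ).imp ((φ.imp ψ.neg).imp φ.neg))
  | negE (φ ψ : Formula) : LogicalAxiom (φ.neg.imp (φ.imp ψ))
  | falsumE (φ : Formula) : LogicalAxiom (Formula.falsum.imp φ)
  | negIntro (φ : Formula) : LogicalAxiom ((φ.imp Formula.falsum).imp φ.neg)
  | negElimFalsum (φ : Formula) : LogicalAxiom (φ.neg.imp (φ.imp Formula.falsum))
  | andI (φ ψ : Formula) : LogicalAxiom (φ.imp (ψ.imp (φ.and ψ)))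
  | andE1 (φ ψ : Formula) : LogicalAxiom ((φ.and ψ).imp φ)
  | andE2 (φ ψ : Formula) : LogicalAxiom ((φ.and ψ).imp ψ)
  | orI1 (φ ψ : Formula) : LogicalAxiom (φ.imp (φ.or ψ))
  | orI2 (φ ψ : Formula) : LogicalAxiom (ψ.imp (φ.or ψ))
  | orE (φ ψ χ : Formula) :
      LogicalAxiom ((φ.imp χ).imp ((ψ.imp χ).imp ((φ.or ψ).imp χ)))
  | allE (x : ℕ) (t : Term) (φ : Formula) :
      φ.freeFor t x → LogicalAxiom ((Formula.all x φ).imp (φ.subst x t))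
  | allImp (x : ℕ) (φ ψ : Formula) :
      x ∉ φ.fv → LogicalAxiom ((Formula.all x (φ.imp ψ)).imp (φ.imp (Formula.all x ψ)))
  | exI (x : ℕ) (t : Term) (φ : Formula) :
      φ.freeFor t x → LogicalAxiom ((φ.subst x t).imp (Formula.ex x φ))
  | exE (x : ℕ) (φ ψ : Formula) :
      x ∉ ψ.fv → LogicalAxiom ((Formula.all x (φ.imp ψ)).imp ((Formula.ex x φ).imp ψ))
  | eqRefl (t : Term) : LogicalAxiom (Formula.eq t t)
  | eqSymm (t u : Term) : LogicalAxiom ((Formula.eq t u).imp (Formula.eq u t))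
  | eqTrans (t u w : Term) :
      LogicalAxiom ((Formula.eq t u).imp ((Formula.eq u w).imp (Formula.eq t w)))
  | eqSucc (t u : Term) :
      LogicalAxiom ((Formula.eq t u).imp (Formula.eq t.succ u.succ))
  | eqAdd (t₁ t₂ u₁ u₂ : Term) :
      LogicalAxiom ((Formula.eq t₁ t₂).imp ((Formula.eq u₁ u₂).imp
        (Formula.eq (t₁.add u₁) (t₂.add u₂))))
  | eqMul (t₁ t₂ u₁ u₂ : Term) :
      LogicalAxiom ((Formula.eq t₁ t₂).imp ((Formula.eq u₁ u₂).imp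
        (Formula.eq (t₁.mul u₁) (t₂.mul u₂))))
  | eqLe (t₁ t₂ u₁ u₂ : Term) :
      LogicalAxiom ((Formula.eq t₁ t₂).imp ((Formula.eq u₁ u₂).imp
        ((Formula.le t₁ u₁).imp (Formula.le t₂ u₂))))

/-- Provability in an L_□-theory: logical axioms, the axioms of the theory, and the
rules modus ponens, generalization, and necessitation. -/
inductive Provable (T : Set Formula) : Formula → Prop
  | ax {φ : Formula} : φ ∈ T → Provable T φ
  | logic {φ : Formula} : LogicalAxiom φ → Provable T φ
  | mp {φ ψ : Formula} : Provable T (φ.imp ψ) → Provable T φ → Provable T ψ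
  | gen {φ : Formula} (x : ℕ) : Provable T φ → Provable T (Formula.all x φ)
  | nec {φ : Formula} : Provable T φ → Provable T (Formula.box φ)

/-- First-order provability (no necessitation rule); used for the non-modal theory PA. -/
inductive FOProvable (T : Set Formula) : Formula → Prop
  | ax {φ : Formula} : φ ∈ T → FOProvable T φ
  | logic {φ : Formula} : LogicalAxiom φ → FOProvable T φ
  | mp {φ ψ : Formula} : FOProvable T (φ.imp ψ) → FOProvable T φ → FOProvable T ψ
  | gen {φ : Formula} (x : ℕ) : FOProvable T φ → FOProvable T (Formula.all x φ)

/-- Basic (Robinson-style) axioms of arithmetic. -/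
def succNeZero : Formula := (Formula.eq (Term.succ (Term.var 0)) Term.zero).neg
def succInj : Formula :=
  (Formula.eq (Term.succ (Term.var 0)) (Term.succ (Term.var 1))).imp
    (Formula.eq (Term.var 0) (Term.var 1))
def addZero : Formula := Formula.eq (Term.add (Term.var 0) Term.zero) (Term.var 0)
def addSucc : Formula :=
  Formula.eq (Term.add (Term.var 0) (Term.succ (Term.var 1)))
    (Term.succ (Term.add (Term.var 0) (Term.var 1)))
def mulZero : Formula := Formula.eq (Term.mul (Term.var 0) Term.zero) Term.zero
def mulSucc : Formula :=
  Formula.eq (Term.mul (Term.var 0) (Term.succ (Term.var 1)))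
    (Term.add (Term.mul (Term.var 0) (Term.var 1)) (Term.var 0))
def leDef : Formula :=
  (Formula.le (Term.var 0) (Term.var 1)).iff
    (Formula.ex 2 (Formula.eq (Term.add (Term.var 0) (Term.var 2)) (Term.var 1)))

def baseAxioms : Set Formula :=
  {succNeZero, succInj, addZero, addSucc, mulZero, mulSucc, leDef}

/-- The induction axiom for the formula `φ` and the variable `x`. -/
def inductionAx (x : ℕ) (φ : Formula) : Formula :=
  ((φ.subst x Term.zero).and
    (Formula.all x (φ.imp (φ.subst x (Term.succ (Term.var x)))))).imp
      (Formula.all x φ)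

/-- Peano arithmetic PA: basic axioms plus induction for L_A-formulas. -/
def PA : Set Formula :=
  baseAxioms ∪ {χ | ∃ (x : ℕ) (φ : Formula), φ.noBox ∧ χ = inductionAx x φ}

/-- PA_□ : basic axioms plus induction for all L_□-formulas. -/
def PABox : Set Formula :=
  baseAxioms ∪ {χ | ∃ (x : ℕ) (φ : Formula), χ = inductionAx x φ}

/-- The distribution axiom K. -/
def axK (φ ψ : Formula) : Formula :=
  (Formula.box (φ.imp ψ)).imp ((Formula.box φ).imp (Formula.box ψ))

/-- PA(K). -/
def PAK : Set Formula := PABox ∪ {χ | ∃ φ ψ : Formula, χ = axK φ ψ}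

/-- The axiom 4. -/
def ax4 (φ : Formula) : Formula := (Formula.box φ).imp (Formula.box (Formula.box φ))

/-- PA(K4). -/
def PAK4 : Set Formula := PAK ∪ {χ | ∃ φ : Formula, χ = ax4 φ}

/-- The axiom of Triv. -/
def axTriv (φ : Formula) : Formula := (Formula.box φ).iff φ

/-- PA(Triv). -/
def PATriv : Set Formula := PAK ∪ {χ | ∃ φ : Formula, χ = axTriv φ}

/-- PA(Ver). -/
def PAVer : Set Formula := PAK ∪ {Formula.box Formula.falsum}

/-- `T` extends `U`: every axiom of `U` is provable in `T`. -/
def Extends (T U : Set Formula) : Prop := ∀ φ ∈ U, Provable T φ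

/-- Consistency. -/
def Consistent (T : Set Formula) : Prop := ¬ Provable T Formula.falsum

/-- The class Δ₀ of bounded L_A-formulas. -/
inductive IsDelta0 : Formula → Prop
  | falsum : IsDelta0 Formula.falsum
  | eq (t u : Term) : IsDelta0 (Formula.eq t u)
  | le (t u : Term) : IsDelta0 (Formula.le t u)
  | and {φ ψ : Formula} : IsDelta0 φ → IsDelta0 ψ → IsDelta0 (φ.and ψ)
  | or {φ ψ : Formula} : IsDelta0 φ → IsDelta0 ψ → IsDelta0 (φ.or ψ)
  | imp {φ ψ : Formula} : IsDelta0 φ → IsDelta0 ψ → IsDelta0 (φ.imp ψ)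
  | neg {φ : Formula} : IsDelta0 φ → IsDelta0 φ.neg
  | ball {x : ℕ} {t : Term} {φ : Formula} :
      x ∉ t.fv → IsDelta0 φ → IsDelta0 (Formula.ball x t φ)
  | bex {x : ℕ} {t : Term} {φ : Formula} :
      x ∉ t.fv → IsDelta0 φ → IsDelta0 (Formula.bex x t φ)

/-- The class Σ₁ of L_A-formulas. -/
inductive IsSigma1 : Formula → Prop
  | delta0 {φ : Formula} : IsDelta0 φ → IsSigma1 φ
  | and {φ ψ : Formula} : IsSigma1 φ → IsSigma1 ψ → IsSigma1 (φ.and ψ)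
  | or {φ ψ : Formula} : IsSigma1 φ → IsSigma1 ψ → IsSigma1 (φ.or ψ)
  | ex {x : ℕ} {φ : Formula} : IsSigma1 φ → IsSigma1 (Formula.ex x φ)
  | ball {x : ℕ} {t : Term} {φ : Formula} :
      x ∉ t.fv → IsSigma1 φ → IsSigma1 (Formula.ball x t φ)

/-- The class B of boxed formulas. -/
def IsB (φ : Formula) : Prop := ∃ ψ : Formula, φ = Formula.box ψ

/-- The class ΔB. -/
inductive IsDeltaB : Formula → Prop
  | delta0 {φ : Formula} : IsDelta0 φ → IsDeltaB φ
  | b (ψ : Formula) : IsDeltaB (Formula.box ψ)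
  | and {φ ψ : Formula} : IsDeltaB φ → IsDeltaB ψ → IsDeltaB (φ.and ψ)
  | or {φ ψ : Formula} : IsDeltaB φ → IsDeltaB ψ → IsDeltaB (φ.or ψ)
  | ball {x : ℕ} {t : Term} {φ : Formula} :
      x ∉ t.fv → IsDeltaB φ → IsDeltaB (Formula.ball x t φ)
  | bex {x : ℕ} {t : Term} {φ : Formula} :
      x ∉ t.fv → IsDeltaB φ → IsDeltaB (Formula.bex x t φ)

/-- The class ΣB. -/
inductive IsSigmaB : Formula → Prop
  | sigma1 {φ : Formula} : IsSigma1 φ → IsSigmaB φ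
  | b (ψ : Formula) : IsSigmaB (Formula.box ψ)
  | and {φ ψ : Formula} : IsSigmaB φ → IsSigmaB ψ → IsSigmaB (φ.and ψ)
  | or {φ ψ : Formula} : IsSigmaB φ → IsSigmaB ψ → IsSigmaB (φ.or ψ)
  | ex {x : ℕ} {φ : Formula} : IsSigmaB φ → IsSigmaB (Formula.ex x φ)
  | ball {x : ℕ} {t : Term} {φ : Formula} :
      x ∉ t.fv → IsSigmaB φ → IsSigmaB (Formula.ball x t φ)

/-- Iterated disjunction (the empty disjunction is ⊥). -/
def disj : List Formula → Formula
  | [] => Formula.falsum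
  | [φ] => φ
  | φ :: ψ :: l => φ.or (disj (ψ :: l))

/-- Iterated conjunction (the empty conjunction is ⊤). -/
def conj : List Formula → Formula
  | [] => Formula.falsum.neg
  | [φ] => φ
  | φ :: ψ :: l => φ.and (conj (ψ :: l))

/-- Γ-disjunction property. -/
def HasDP (T : Set Formula) (Γ : Formula → Prop) : Prop :=
  ∀ φ ψ : Formula, Γ φ → Γ ψ → Sentence φ → Sentence ψ →
    Provable T (φ.or ψ) → Provable T φ ∨ Provable T ψ

/-- (Γ, Θ)-disjunction property. -/
def HasDP2 (T : Set Formula) (Γ Θ : Formula → Prop) : Prop :=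
  ∀ φ ψ : Formula, Γ φ → Θ ψ → Sentence φ → Sentence ψ →
    Provable T (φ.or ψ) → Provable T φ ∨ Provable T ψ

/-- Γ-existence property. -/
def HasEP (T : Set Formula) (Γ : Formula → Prop) : Prop :=
  ∀ (x : ℕ) (φ : Formula), Γ φ → φ.fv ⊆ {x} →
    Provable T (Formula.ex x φ) → ∃ n : ℕ, Provable T (φ.subst x (Term.numeral n))

/-- Modal disjunction property. -/
def HasMDP (T : Set Formula) : Prop :=
  ∀ φ ψ : Formula, Sentence φ → Sentence ψ →
    Provable T ((Formula.box φ).or (Formula.box ψ)) → Provable T φ ∨ Provable T ψ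

/-- Modal existence property. -/
def HasMEP (T : Set Formula) : Prop :=
  ∀ (x : ℕ) (φ : Formula), φ.fv ⊆ {x} →
    Provable T (Formula.ex x (Formula.box φ)) →
      ∃ n : ℕ, Provable T (φ.subst x (Term.numeral n))

/-- n-fold B-disjunction property. -/
def HasBnDP (T : Set Formula) (n : ℕ) : Prop :=
  ∀ φ : Fin n → Formula, (∀ i, Sentence (φ i)) →
    Provable T (disj (List.ofFn fun i => Formula.box (φ i))) →
    ∃ i, Provable T (Formula.box (φ i))

/-- Σ₁-soundness. -/
def Sigma1Sound (T : Set Formula) : Prop :=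
  ∀ φ : Formula, IsSigma1 φ → Sentence φ → Provable T φ → StdTrue φ

/-- L_A-soundness. -/
def LASound (T : Set Formula) : Prop :=
  ∀ φ : Formula, φ.noBox → Sentence φ → Provable T φ → StdTrue φ

/-- `T` is recursively enumerable (via the Gödel numbering of formulas). -/
def RE (T : Set Formula) : Prop :=
  Nat.Partrec fun n => Part.assert (∃ φ ∈ T, Formula.code φ = n) fun _ => Part.some 0

/-- A fixed natural Σ₁ provability predicate `Pr_T(x)` for the theory `T`:
a Σ₁ L_A-formula with only the free variable `0` which numerates provability in `T`
in the standard model and satisfies the standard derivability conditions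
(provably in PA). -/
structure ProvPred (T : Set Formula) where
  pr : Formula
  noBox : pr.noBox
  sigma1 : IsSigma1 pr
  fvSub : pr.fv ⊆ {0}
  numerates : ∀ φ : Formula,
    StdTrue (pr.subst 0 (Term.numeral φ.code)) ↔ Provable T φ
  d1 : ∀ φ : Formula, Provable T φ → FOProvable PA (pr.subst 0 (Term.numeral φ.code))
  d2 : ∀ φ ψ : Formula,
    FOProvable PA ((pr.subst 0 (Term.numeral (φ.imp ψ).code)).imp
      ((pr.subst 0 (Term.numeral φ.code)).imp (pr.subst 0 (Term.numeral ψ.code))))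
  necClosed : ∀ φ : Formula,
    FOProvable PA ((pr.subst 0 (Term.numeral φ.code)).imp
      (pr.subst 0 (Term.numeral (Formula.box φ).code)))

/-- `Pr_T(⌜φ⌝)`. -/
def ProvPred.app {T : Set Formula} (P : ProvPred T) (φ : Formula) : Formula :=
  P.pr.subst 0 (Term.numeral φ.code)

/-- Γ-disjunctive correctness (Γ-DC). -/
def DC (T : Set Formula) (P : ProvPred T) (Γ : Formula → Prop) : Prop :=
  ∀ φ : Formula, Γ φ → Sentence φ → Provable T (φ.or (P.app φ)) → Provable T φ

/-- The substitution replacing each variable by the numeral of its value. -/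
def numeralSubst (v : ℕ → ℕ) : ℕ → Term := fun x => Term.numeral (v x)

/-- Standard-model satisfaction of the ρ_T-translation: `ρ_T` is the identity on
L_A-formulas, commutes with connectives and quantifiers, and sends `□φ(x⃗)` to
`Pr_T(⌜□φ(ẋ⃗)⌝)`, whose truth in ℕ (for a natural provability predicate) amounts to
provability in `T` of `□φ(n̄⃗)`. -/
def RhoSat (T : Set Formula) : Formula → (ℕ → ℕ) → Prop
  | .falsum, _ => False
  | .eq t u, v => t.val v = u.val v
  | .le t u, v => t.val v ≤ u.val v
  | .and φ ψ, v => RhoSat T φ v ∧ RhoSat T ψ v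
  | .or φ ψ, v => RhoSat T φ v ∨ RhoSat T ψ v
  | .imp φ ψ, v => RhoSat T φ v → RhoSat T ψ v
  | .neg φ, v => ¬ RhoSat T φ v
  | .all x φ, v => ∀ n : ℕ, RhoSat T φ (Function.update v x n)
  | .ex x φ, v => ∃ n : ℕ, RhoSat T φ (Function.update v x n)
  | .box φ, v => Provable T (Formula.box (φ.substAll (numeralSubst v)))

/-- Standard-model satisfaction of the π_T-translation: `π_T` is the identity on
L_A-formulas, commutes with connectives and quantifiers, and sends `□φ(x⃗)` to
`Pr_T(⌜φ(ẋ⃗)⌝)`, whose truth in ℕ (for a natural provability predicate) amounts to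
provability in `T` of `φ(n̄⃗)`. -/
def PiSat (T : Set Formula) : Formula → (ℕ → ℕ) → Prop
  | .falsum, _ => False
  | .eq t u, v => t.val v = u.val v
  | .le t u, v => t.val v ≤ u.val v
  | .and φ ψ, v => PiSat T φ v ∧ PiSat T ψ v
  | .or φ ψ, v => PiSat T φ v ∨ PiSat T ψ v
  | .imp φ ψ, v => PiSat T φ v → PiSat T ψ v
  | .neg φ, v => ¬ PiSat T φ v
  | .all x φ, v => ∀ n : ℕ, PiSat T φ (Function.update v x n)
  | .ex x φ, v => ∃ n : ℕ, PiSat T φ (Function.update v x n)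
  | .box φ, v => Provable T (φ.substAll (numeralSubst v))

/-- Weak ΣB-soundness: every provable ΣB sentence is true in ℕ under ρ_T. -/
def WeaklySigmaBSound (T : Set Formula) : Prop :=
  ∀ φ : Formula, IsSigmaB φ → Sentence φ → Provable T φ → RhoSat T φ fun _ => 0

/-- ΣB-soundness: every provable ΣB sentence is true in ℕ under π_T. -/
def SigmaBSound (T : Set Formula) : Prop :=
  ∀ φ : Formula, IsSigmaB φ → Sentence φ → Provable T φ → PiSat T φ fun _ => 0

end ModalArith

namespace ModalArith

/-! ## Worlds: maximal consistent sets -/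

/-- Derivability from a set of hypotheses with modus ponens only. -/
inductive Ent (T : Set Formula) (Γ : Set Formula) : Formula → Prop
  | hyp {φ} : φ ∈ Γ → Ent T Γ φ
  | thm {φ} : Provable T φ → Ent T Γ φ
  | mp {φ ψ} : Ent T Γ (φ.imp ψ) → Ent T Γ φ → Ent T Γ ψ

variable {T : Set Formula}

theorem Ent.lax {Γ : Set Formula} {φ} (h : LogicalAxiom φ) : Ent T Γ φ := .thm (.logic h)

theorem Ent.mono {Γ Δ : Set Formula} (hs : Γ ⊆ Δ) {φ} (h : Ent T Γ φ) : Ent T Δ φ := by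
  induction h with
  | hyp h => exact .hyp (hs h)
  | thm h => exact .thm h
  | mp _ _ ih1 ih2 => exact .mp ih1 ih2

theorem Ent.refl_imp {Γ : Set Formula} (φ : Formula) : Ent T Γ (φ.imp φ) :=
  .mp (.mp (.lax (.imp2 φ (φ.imp φ) φ)) (.lax (.imp1 _ _))) (.lax (.imp1 _ _))

theorem Ent.ded {Γ : Set Formula} {φ ψ : Formula} (h : Ent T (insert φ Γ) ψ) : Ent T Γ (φ.imp ψ) := by
  induction h with
  | hyp h =>
    rcases h with rfl | h
    · exact .refl_imp _
    · exact .mp (.lax (.imp1 _ _)) (.hyp h)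
  | thm h => exact .mp (.lax (.imp1 _ _)) (.thm h)
  | mp _ _ ih1 ih2 => exact .mp (.mp (.lax (.imp2 _ _ _)) ih1) ih2

theorem Ent.hyp' {Γ : Set Formula} {φ} : Ent T (insert φ Γ) φ := .hyp (Set.mem_insert _ _)

theorem Ent.weak {Γ : Set Formula} {φ ψ} (h : Ent T Γ ψ) : Ent T (insert φ Γ) ψ :=
  h.mono (Set.subset_insert _ _)

theorem Ent.cases {Γ : Set Formula} {φ ψ : Formula} (h1 : Ent T Γ (ψ.imp φ)) (h2 : Ent T Γ (ψ.neg.imp φ)) :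
    Ent T Γ φ := by
  have h3 : Ent T Γ (φ.neg.imp φ) := by
    apply Ent.ded
    refine .mp h2.weak ?_
    refine .mp (.mp (.lax (.negI ψ φ)) h1.weak) ?_
    exact .mp (.lax (.imp1 _ _)) .hyp'
  exact .mp (.lax (.dne φ)) (.mp (.mp (.lax (.negI _ _)) h3) (.refl_imp _))

/-- A world: a maximal consistent set of formulas containing all theorems of `T`. -/
structure World (T : Set Formula) where
  holds : Formula → Prop
  thm : ∀ {φ}, Provable T φ → holds φ
  falsum : ¬ holds .falsum
  imp : ∀ {a b}, holds (a.imp b) ↔ (holds a → holds b)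
  and : ∀ {a b}, holds (a.and b) ↔ (holds a ∧ holds b)
  or : ∀ {a b}, holds (a.or b) ↔ (holds a ∨ holds b)
  neg : ∀ {a}, holds (a.neg) ↔ ¬ holds a

instance : CoeFun (World T) (fun _ => Formula → Prop) := ⟨World.holds⟩

theorem exists_world {Γ : Set Formula} {φ : Formula} (h : ¬ Ent T Γ φ) :
    ∃ w : World T, (∀ ψ ∈ Γ, w ψ) ∧ ¬ w φ := by
  have hz := zorn_subset_nonempty {Δ : Set Formula | ¬ Ent T Δ φ} (by
    intro c hc hchain hne
    refine ⟨⋃₀ c, ?_, fun s hs => Set.subset_sUnion_of_mem hs⟩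
    intro hent
    have key : ∀ ψ, Ent T (⋃₀ c) ψ → ∃ s ∈ c, Ent T s ψ := by
      intro ψ hψ
      induction hψ with
      | hyp h =>
        obtain ⟨s, hs, hm⟩ := h
        exact ⟨s, hs, .hyp hm⟩
      | thm h =>
        obtain ⟨s, hs⟩ := hne
        exact ⟨s, hs, .thm h⟩
      | mp _ _ ih1 ih2 =>
        obtain ⟨s1, hs1, e1⟩ := ih1
        obtain ⟨s2, hs2, e2⟩ := ih2
        rcases hchain.total hs1 hs2 with h12 | h12
        · exact ⟨s2, hs2, .mp (e1.mono h12) e2⟩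
        · exact ⟨s1, hs1, .mp e1 (e2.mono h12)⟩
    obtain ⟨s, hs, hse⟩ := key _ hent
    exact hc hs hse) Γ h
  obtain ⟨M, hΓM, hM⟩ := hz
  have hMc : ¬ Ent T M φ := hM.prop
  have hmem : ∀ {ψ}, Ent T M ψ → ψ ∈ M := by
    intro ψ hψ
    by_contra hn
    have h2 : Ent T (insert ψ M) φ := by
      by_contra h3
      have := hM.le_of_ge (y := insert ψ M) h3 (Set.subset_insert _ _)
      exact hn (this (Set.mem_insert _ _))
    exact hMc (.mp h2.ded hψ)
  have hnot : ∀ {ψ}, ψ ∉ M → ψ.neg ∈ M := by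
    intro ψ hn
    by_contra hn2
    have hx : ∀ {ψ}, ψ ∉ M → Ent T (insert ψ M) φ := by
      intro ψ hn
      by_contra h3
      have := hM.le_of_ge (y := insert ψ M) h3 (Set.subset_insert _ _)
      exact hn (this (Set.mem_insert _ _))
    exact hMc (.cases (hx hn).ded (hx hn2).ded)
  have hfal : Formula.falsum ∉ M := fun hf => hMc (.mp (.lax (.falsumE _)) (.hyp hf))
  have hcon : ∀ {ψ}, ψ ∈ M → ψ.neg ∈ M → False := fun h1 h2 =>
    hMc (.mp (.mp (.lax (.negE _ _)) (.hyp h2)) (.hyp h1))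
  refine ⟨⟨fun ψ => ψ ∈ M, fun h => hmem (.thm h), hfal, ?_, ?_, ?_, ?_⟩, fun ψ hψ => hΓM hψ,
    fun h => hMc (.hyp h)⟩
  · intro a b
    refine ⟨fun h1 h2 => hmem (.mp (.hyp h1) (.hyp h2)), fun h => ?_⟩
    by_cases ha : a ∈ M
    · exact hmem (.mp (.lax (.imp1 _ _)) (.hyp (h ha)))
    · exact hmem (.mp (.lax (.negE _ _)) (.hyp (hnot ha)))
  · intro a b
    exact ⟨fun h => ⟨hmem (.mp (.lax (.andE1 _ _)) (.hyp h)), hmem (.mp (.lax (.andE2 _ _)) (.hyp h))⟩,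
      fun h => hmem (.mp (.mp (.lax (.andI _ _)) (.hyp h.1)) (.hyp h.2))⟩
  · intro a b
    constructor
    · intro h
      by_contra hn
      push Not at hn
      have e1 : Ent T M (a.imp .falsum) := .mp (.lax (.negElimFalsum _)) (.hyp (hnot hn.1))
      have e2 : Ent T M (b.imp .falsum) := .mp (.lax (.negElimFalsum _)) (.hyp (hnot hn.2))
      exact hfal (hmem (.mp (.mp (.mp (.lax (.orE _ _ _)) e1) e2) (.hyp h)))
    · rintro (h | h)
      · exact hmem (.mp (.lax (.orI1 _ _)) (.hyp h))
      · exact hmem (.mp (.lax (.orI2 _ _)) (.hyp h))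
  · intro a
    exact ⟨fun h1 h2 => hcon h2 h1, hnot⟩

theorem Ent.toProvable {φ} (h : Ent T ∅ φ) : Provable T φ := by
  induction h with
  | hyp h => exact absurd h (Set.notMem_empty _)
  | thm h => exact h
  | mp _ _ ih1 ih2 => exact .mp ih1 ih2

theorem prov_of_worlds {φ} (h : ∀ w : World T, w φ) : Provable T φ := by
  by_contra hn
  obtain ⟨w, -, hw⟩ := exists_world (T := T) (Γ := ∅) (φ := φ) fun e => hn e.toProvable
  exact hw (h w)

theorem World.mpT (w : World T) {φ ψ} (h : Provable T (φ.imp ψ)) : w φ → w ψ :=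
  w.imp.1 (w.thm h)

theorem World.lax (w : World T) {φ} (h : LogicalAxiom φ) : w φ := w.thm (.logic h)

theorem World.iff (w : World T) {a b} : w (a.iff b) ↔ (w a ↔ w b) := by
  simp only [Formula.iff, w.and, w.imp]; tauto

/-- `w'` agrees with `w` on all formulas in which `x` is not free. -/
def Var (x : ℕ) (w w' : World T) : Prop := ∀ χ : Formula, x ∉ χ.fv → (w' χ ↔ w χ)

theorem Var.symm {x : ℕ} {w w' : World T} (h : Var x w w') : Var x w' w :=
  fun χ hx => (h χ hx).symm

/-! ### substitution basics -/

theorem Term.substAll_var (t : Term) : t.substAll Term.var = t := by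
  induction t <;> simp_all [Term.substAll]

theorem Formula.substAll_var (φ : Formula) : φ.substAll Term.var = φ := by
  induction φ <;> simp_all [Formula.substAll, Term.substAll_var]

theorem Term.substAll_congr (t : Term) {v v' : ℕ → Term} (h : ∀ x ∈ t.fv, v x = v' x) :
    t.substAll v = t.substAll v' := by
  induction t <;> simp_all [Term.substAll, Term.fv]

theorem Formula.substAll_congr (φ : Formula) {v v' : ℕ → Term} (h : ∀ x ∈ φ.fv, v x = v' x) :
    φ.substAll v = φ.substAll v' := by
  induction φ generalizing v v' with
  | eq t u | le t u =>
    simp only [Formula.fv, Finset.mem_union] at h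
    simp only [Formula.substAll]
    rw [t.substAll_congr fun x hx => h x (.inl hx), u.substAll_congr fun x hx => h x (.inr hx)]
  | falsum => rfl
  | and a b iha ihb | or a b iha ihb | imp a b iha ihb =>
    simp only [Formula.fv, Finset.mem_union] at h
    simp only [Formula.substAll]
    rw [iha fun x hx => h x (.inl hx), ihb fun x hx => h x (.inr hx)]
  | neg a ih | box a ih => simp only [Formula.substAll]; rw [ih h]
  | all y a ih | ex y a ih =>
    simp only [Formula.substAll]
    rw [ih]
    intro x hx
    by_cases hxy : x = y
    · subst hxy; simp
    · simp [Function.update_of_ne hxy, h x (by simp [Formula.fv, hxy, hx])]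

theorem Term.subst_fresh {t : Term} {x : ℕ} (s : Term) (h : x ∉ t.fv) : Term.subst x s t = t := by
  unfold Term.subst
  conv_rhs => rw [← t.substAll_var]
  apply Term.substAll_congr
  intro y hy
  rw [Function.update_of_ne]; rintro rfl; exact h hy

theorem Formula.subst_fresh {φ : Formula} {x : ℕ} (s : Term) (h : x ∉ φ.fv) : φ.subst x s = φ := by
  unfold Formula.subst
  conv_rhs => rw [← φ.substAll_var]
  apply Formula.substAll_congr
  intro y hy
  rw [Function.update_of_ne]; rintro rfl; exact h hy

theorem Formula.subst_self (φ : Formula) (x : ℕ) : φ.subst x (Term.var x) = φ := by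
  unfold Formula.subst
  rw [Function.update_eq_self, Formula.substAll_var]

theorem Formula.freeFor_self (φ : Formula) (x : ℕ) : φ.freeFor (Term.var x) x := by
  induction φ with
  | all y a ih | ex y a ih =>
    simp only [Formula.freeFor, Term.fv, Finset.mem_singleton]
    by_cases h : x = y
    · exact .inl h
    · exact .inr (.inr ⟨fun e => h e.symm, ih⟩)
  | _ => simp_all [Formula.freeFor]

theorem Formula.freeFor_of_notMem {φ : Formula} {x : ℕ} (s : Term) (h : x ∉ φ.fv) :
    φ.freeFor s x := by
  induction φ with
  | all y a ih | ex y a ih =>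
    simp only [Formula.freeFor]
    simp only [Formula.fv, Finset.mem_erase, not_and] at h
    by_cases hxy : x = y
    · exact .inl hxy
    · exact .inr (.inl (h hxy))
  | _ => simp_all [Formula.freeFor, Formula.fv]

theorem Formula.freeFor_closed {φ : Formula} {x : ℕ} {s : Term} (h : s.fv = ∅) :
    φ.freeFor s x := by
  induction φ with
  | all y a ih | ex y a ih => simp [Formula.freeFor, h, ih]
  | _ => simp_all [Formula.freeFor]

@[simp] theorem subst_falsum (x s) : Formula.falsum.subst x s = .falsum := rfl
@[simp] theorem subst_eq (x s t u) : (Formula.eq t u).subst x s = .eq (Term.subst x s t) (Term.subst x s u) := rfl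
@[simp] theorem subst_le (x s t u) : (Formula.le t u).subst x s = .le (Term.subst x s t) (Term.subst x s u) := rfl
@[simp] theorem subst_and (x s a b) : (Formula.and a b).subst x s = .and (a.subst x s) (b.subst x s) := rfl
@[simp] theorem subst_or (x s a b) : (Formula.or a b).subst x s = .or (a.subst x s) (b.subst x s) := rfl
@[simp] theorem subst_imp (x s a b) : (Formula.imp a b).subst x s = .imp (a.subst x s) (b.subst x s) := rfl
@[simp] theorem subst_neg (x s a) : (Formula.neg a).subst x s = .neg (a.subst x s) := rfl
@[simp] theorem subst_box (x s a) : (Formula.box a).subst x s = .box (a.subst x s) := rfl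
@[simp] theorem subst_all_same (x s a) : (Formula.all x a).subst x s = .all x a := by
  simp [Formula.subst, Formula.substAll, Formula.substAll_var]
@[simp] theorem subst_ex_same (x s a) : (Formula.ex x a).subst x s = .ex x a := by
  simp [Formula.subst, Formula.substAll, Formula.substAll_var]
theorem subst_all_ne {x y : ℕ} (h : x ≠ y) (s a) :
    (Formula.all y a).subst x s = .all y (a.subst x s) := by
  simp only [Formula.subst, Formula.substAll]
  rw [Function.update_comm h, Function.update_eq_self]
theorem subst_ex_ne {x y : ℕ} (h : x ≠ y) (s a) :
    (Formula.ex y a).subst x s = .ex y (a.subst x s) := by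
  simp only [Formula.subst, Formula.substAll]
  rw [Function.update_comm h, Function.update_eq_self]
@[simp] theorem tsubst_zero (x s) : Term.subst x s Term.zero = .zero := rfl
@[simp] theorem tsubst_succ (x s t) : Term.subst x s (Term.succ t) = .succ (Term.subst x s t) := rfl
@[simp] theorem tsubst_add (x s t u) : Term.subst x s (Term.add t u) = .add (Term.subst x s t) (Term.subst x s u) := rfl
@[simp] theorem tsubst_mul (x s t u) : Term.subst x s (Term.mul t u) = .mul (Term.subst x s t) (Term.subst x s u) := rfl
@[simp] theorem tsubst_var (x s) : Term.subst x s (Term.var x) = s := by simp [Term.subst, Term.substAll]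
theorem tsubst_var_ne {x y} (h : x ≠ y) (s) : Term.subst x s (Term.var y) = .var y := by
  simp [Term.subst, Term.substAll, h.symm]

/-! ### quantifiers and worlds -/

theorem World.all_inst (w : World T) {x φ} {t : Term} (h : w (.all x φ)) (hf : φ.freeFor t x) :
    w (φ.subst x t) := w.imp.1 (w.lax (.allE x t φ hf)) h

theorem World.all_self (w : World T) {x φ} (h : w (.all x φ)) : w φ := by
  have := w.all_inst h (φ.freeFor_self x)
  rwa [φ.subst_self] at this

theorem World.ex_intro (w : World T) {x φ} {t : Term} (hf : φ.freeFor t x) (h : w (φ.subst x t)) :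
    w (.ex x φ) := w.imp.1 (w.lax (.exI x t φ hf)) h

theorem World.ex_self (w : World T) {x φ} (h : w φ) : w (.ex x φ) := by
  apply w.ex_intro (φ.freeFor_self x)
  rwa [φ.subst_self]

theorem prov_inst {x φ} {t : Term} (h : Provable T φ) (hf : φ.freeFor t x) :
    Provable T (φ.subst x t) := .mp (.logic (.allE x t φ hf)) (.gen x h)

theorem World.exists_var (w : World T) {x : ℕ} {φ : Formula} (h : ¬ w (.all x φ)) :
    ∃ w', Var x w w' ∧ ¬ w' φ := by
  have hne : ¬ Ent T {χ | x ∉ χ.fv ∧ w χ} φ := by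
    intro hent
    have key : ∀ ψ, Ent T {χ | x ∉ χ.fv ∧ w χ} ψ → ∃ χ : Formula, x ∉ χ.fv ∧ w χ ∧ Provable T (χ.imp ψ) := by
      intro ψ hψ
      induction hψ with
      | @hyp φ h => exact ⟨φ, h.1, h.2, prov_of_worlds fun w => w.imp.2 id⟩
      | thm h =>
        refine ⟨Formula.falsum.imp .falsum, by simp [Formula.fv], w.imp.2 id,
          prov_of_worlds fun w => w.imp.2 fun _ => w.thm h⟩
      | mp _ _ ih1 ih2 =>
        obtain ⟨c1, f1, h1, p1⟩ := ih1
        obtain ⟨c2, f2, h2, p2⟩ := ih2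
        refine ⟨c1.and c2, by simp [Formula.fv, f1, f2], w.and.2 ⟨h1, h2⟩, prov_of_worlds fun u => ?_⟩
        have q1 := u.mpT p1
        have q2 := u.mpT p2
        simp only [u.imp, u.and] at *
        tauto
    obtain ⟨χ, hx, hw, hp⟩ := key _ hent
    exact h (w.imp.1 (w.mpT (.logic (.allImp x χ φ hx)) (w.thm (.gen x hp))) hw)
  obtain ⟨w', h1, h2⟩ := exists_world hne
  refine ⟨w', fun χ hx => ⟨fun hc => ?_, fun hc => h1 _ ⟨hx, hc⟩⟩, h2⟩
  by_contra hn
  exact w'.neg.1 (h1 _ ⟨by simpa [Formula.fv] using hx, w.neg.2 hn⟩) hc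

theorem World.all (w : World T) {x φ} : w (.all x φ) ↔ ∀ w', Var x w w' → w' φ := by
  constructor
  · intro h w' hv
    exact w'.all_self ((hv _ (by simp [Formula.fv])).2 h)
  · intro h
    by_contra hn
    obtain ⟨w', hv, hn'⟩ := w.exists_var hn
    exact hn' (h w' hv)

theorem World.ex (w : World T) {x φ} : w (.ex x φ) ↔ ∃ w', Var x w w' ∧ w' φ := by
  constructor
  · intro h
    by_contra hn
    push Not at hn
    have : w (.all x (φ.imp .falsum)) := by
      rw [w.all]
      intro w' hv
      exact w'.imp.2 fun hp => absurd hp (hn w' hv)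
    exact w.falsum (w.imp.1 (w.mpT (.logic (.exE x φ .falsum (by simp [Formula.fv]))) this) h)
  · rintro ⟨w', hv, hp⟩
    exact (hv _ (by simp [Formula.fv])).1 (w'.ex_self hp)

theorem World.set_var (w : World T) (x : ℕ) {t : Term} (hx : x ∉ t.fv) :
    ∃ w', Var x w w' ∧ w' (.eq (.var x) t) := by
  apply w.ex.1
  refine w.ex_intro (t := t) (by simp [Formula.freeFor]) ?_
  simp only [subst_eq, tsubst_var, Term.subst_fresh t hx]
  exact w.lax (.eqRefl _)

/-! ### box and worlds -/

/-- Accessibility. -/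
def Acc (w w' : World T) : Prop := ∀ χ : Formula, w (.box χ) → w' χ

theorem World.box (hT : Extends T PAK) (w : World T) {φ} :
    w (.box φ) ↔ ∀ w', Acc w w' → w' φ := by
  constructor
  · intro h w' ha
    exact ha _ h
  · intro h
    by_contra hn
    have hne : ¬ Ent T {χ | w (.box χ)} φ := by
      intro hent
      apply hn
      clear h hn
      induction hent with
      | hyp h => exact h
      | thm h => exact w.thm (.nec h)
      | @mp a b _ _ ih1 ih2 =>
        have hk : Provable T (axK a b) := hT _ (.inr ⟨a, b, rfl⟩)
        exact w.imp.1 (w.mpT hk ih1) ih2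
    obtain ⟨w', h1, h2⟩ := exists_world hne
    exact h2 (h w' fun χ hχ => h1 χ hχ)

end ModalArith

namespace ModalArith
variable {T : Set Formula}

/-! ## Arithmetic in worlds -/

theorem fresh (F : Finset ℕ) : ∃ z, z ∉ F := Infinite.exists_notMem_finset F

theorem World.eq_refl (w : World T) (t) : w (.eq t t) := w.lax (.eqRefl t)
theorem World.eq_symm (w : World T) {t u} (h : w (.eq t u)) : w (.eq u t) :=
  w.imp.1 (w.lax (.eqSymm t u)) h
theorem World.eq_trans (w : World T) {t u r} (h : w (.eq t u)) (h' : w (.eq u r)) : w (.eq t r) :=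
  w.imp.1 (w.imp.1 (w.lax (.eqTrans t u r)) h) h'

/-- Equality of terms in a world. -/
def World.setoid (w : World T) : Setoid Term where
  r t u := w (.eq t u)
  iseqv := ⟨w.eq_refl, w.eq_symm, w.eq_trans⟩

/-- The term model of a world. -/
def World.Q (w : World T) : Type := Quotient w.setoid

/-- The class of a term. -/
def World.q (w : World T) (t : Term) : w.Q := Quotient.mk w.setoid t

theorem World.eq (w : World T) {t u} : w (.eq t u) ↔ w.q t = w.q u :=
  ⟨fun h => Quotient.sound h, fun h => Quotient.exact h⟩

theorem World.q_surj (w : World T) (a : w.Q) : ∃ t, w.q t = a := Quotient.exists_rep a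

/-- successor in the term model -/
def World.S (w : World T) : w.Q → w.Q := Quotient.map Term.succ
  (fun t u (h : w (.eq t u)) => w.imp.1 (w.lax (.eqSucc t u)) h)
/-- addition in the term model -/
def World.A (w : World T) : w.Q → w.Q → w.Q := Quotient.map₂ Term.add
  (fun t u (h : w (.eq t u)) t' u' (h' : w (.eq t' u')) =>
    w.imp.1 (w.imp.1 (w.lax (.eqAdd t u t' u')) h) h')
/-- multiplication in the term model -/
def World.M (w : World T) : w.Q → w.Q → w.Q := Quotient.map₂ Term.mul
  (fun t u (h : w (.eq t u)) t' u' (h' : w (.eq t' u')) =>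
    w.imp.1 (w.imp.1 (w.lax (.eqMul t u t' u')) h) h')

@[simp] theorem World.q_succ (w : World T) (t) : w.q (.succ t) = w.S (w.q t) := rfl
@[simp] theorem World.q_add (w : World T) (t u) : w.q (.add t u) = w.A (w.q t) (w.q u) := rfl
@[simp] theorem World.q_mul (w : World T) (t u) : w.q (.mul t u) = w.M (w.q t) (w.q u) := rfl

theorem World.le_congr (w : World T) {t u t' u'} (h : w.q t = w.q t') (h' : w.q u = w.q u')
    (hl : w (.le t u)) : w (.le t' u') :=
  w.imp.1 (w.imp.1 (w.imp.1 (w.lax (.eqLe t t' u u')) (w.eq.2 h)) (w.eq.2 h')) hl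

/-- No quantifiers. -/
def Formula.qf : Formula → Prop
  | falsum => True
  | eq _ _ => True
  | le _ _ => True
  | and φ ψ => qf φ ∧ qf ψ
  | or φ ψ => qf φ ∧ qf ψ
  | imp φ ψ => qf φ ∧ qf ψ
  | neg φ => qf φ
  | all _ _ => False
  | ex _ _ => False
  | box φ => qf φ

theorem Formula.qf.freeFor {φ : Formula} (h : φ.qf) (s : Term) (x : ℕ) : φ.freeFor s x := by
  induction φ <;> simp_all [Formula.qf, Formula.freeFor]

theorem Formula.qf.substAll {φ : Formula} (h : φ.qf) (v) : (φ.substAll v).qf := by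
  induction φ generalizing v <;> simp_all [Formula.qf, Formula.substAll]

theorem Formula.qf.subst {φ : Formula} (h : φ.qf) (x t) : (φ.subst x t).qf := h.substAll _

theorem Term.fv_subst_var {t : Term} {x y z : ℕ} (h : z ∉ t.fv) (hz : z ≠ y) :
    z ∉ (Term.subst x (.var y) t).fv := by
  induction t with
  | var n =>
    by_cases hn : x = n
    · subst hn; simp [Term.fv, hz]
    · rw [tsubst_var_ne hn]; exact h
  | _ => simp_all [Term.fv]

theorem prov_inst_qf {φ} (x) (t : Term) (hq : φ.qf) (h : Provable T φ) :
    Provable T (φ.subst x t) := prov_inst h (hq.freeFor _ _)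

/-- Simultaneous instantiation of variables 0 and 1 in a quantifier-free theorem. -/
theorem prov_inst2 {φ} (t u : Term) (hq : φ.qf) (h : Provable T φ) :
    ∃ a, a ∉ u.fv ∧ a ≠ 0 ∧ a ≠ 1 ∧ Provable T (((φ.subst 0 (.var a)).subst 1 u).subst a t) := by
  obtain ⟨a, ha⟩ := fresh (u.fv ∪ {0, 1})
  simp only [Finset.mem_union, Finset.mem_insert, Finset.mem_singleton, not_or] at ha
  exact ⟨a, ha.1, ha.2.1, ha.2.2, prov_inst_qf _ _ ((hq.subst _ _).subst _ _)
    (prov_inst_qf _ _ (hq.subst _ _) (prov_inst_qf _ _ hq h))⟩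


theorem base_ax (hT : Extends T PAK) {φ} (h : φ ∈ baseAxioms) : Provable T φ := hT _ (.inl (.inl h))

theorem World.S_ne (hT : Extends T PAK) (w : World T) (a : w.Q) : w.S a ≠ w.q .zero := by
  obtain ⟨t, rfl⟩ := w.q_surj a
  have h : Provable T succNeZero := base_ax hT (by simp [baseAxioms])
  have h1 := w.thm (prov_inst_qf 0 t (by simp [succNeZero, Formula.qf]) h)
  simpa [succNeZero, w.neg, w.eq] using h1

theorem World.S_inj (hT : Extends T PAK) (w : World T) {a b : w.Q} (hab : w.S a = w.S b) : a = b := by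
  obtain ⟨t, rfl⟩ := w.q_surj a
  obtain ⟨u, rfl⟩ := w.q_surj b
  have h : Provable T succInj := base_ax hT (by simp [baseAxioms])
  obtain ⟨a, h1, h2, h3, h4⟩ := prov_inst2 t u (by simp [succInj, Formula.qf]) h
  have h5 := w.thm h4
  simp [succInj, w.imp, w.eq, tsubst_var_ne, h3.symm, h1, Term.subst_fresh] at h5
  exact h5 hab

theorem World.A_zero (hT : Extends T PAK) (w : World T) (a : w.Q) : w.A a (w.q .zero) = a := by
  obtain ⟨t, rfl⟩ := w.q_surj a
  have h : Provable T addZero := base_ax hT (by simp [baseAxioms])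
  have h1 := w.thm (prov_inst_qf 0 t (by simp [addZero, Formula.qf]) h)
  simpa [addZero, w.eq] using h1

theorem World.A_succ (hT : Extends T PAK) (w : World T) (a b : w.Q) : w.A a (w.S b) = w.S (w.A a b) := by
  obtain ⟨t, rfl⟩ := w.q_surj a
  obtain ⟨u, rfl⟩ := w.q_surj b
  have h : Provable T addSucc := base_ax hT (by simp [baseAxioms])
  obtain ⟨a, h1, h2, h3, h4⟩ := prov_inst2 t u (by simp [addSucc, Formula.qf]) h
  have h5 := w.thm h4
  simp [addSucc, w.eq, tsubst_var_ne, h3.symm, h1, Term.subst_fresh] at h5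
  exact h5

theorem World.M_zero (hT : Extends T PAK) (w : World T) (a : w.Q) : w.M a (w.q .zero) = w.q .zero := by
  obtain ⟨t, rfl⟩ := w.q_surj a
  have h : Provable T mulZero := base_ax hT (by simp [baseAxioms])
  have h1 := w.thm (prov_inst_qf 0 t (by simp [mulZero, Formula.qf]) h)
  simpa [mulZero, w.eq] using h1

theorem World.M_succ (hT : Extends T PAK) (w : World T) (a b : w.Q) : w.M a (w.S b) = w.A (w.M a b) a := by
  obtain ⟨t, rfl⟩ := w.q_surj a
  obtain ⟨u, rfl⟩ := w.q_surj b
  have h : Provable T mulSucc := base_ax hT (by simp [baseAxioms])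
  obtain ⟨a, h1, h2, h3, h4⟩ := prov_inst2 t u (by simp [mulSucc, Formula.qf]) h
  have h5 := w.thm h4
  simp [mulSucc, w.eq, tsubst_var_ne, h3.symm, h1, Term.subst_fresh] at h5
  exact h5

/-- Induction rule in terms of worlds. -/
theorem ind_rule (hT : Extends T PAK) (x : ℕ) (φ : Formula) (h0 : ∀ w : World T, w (φ.subst x .zero))
    (hs : ∀ w : World T, w φ → w (φ.subst x (.succ (.var x)))) (w : World T) : w φ := by
  have hax : Provable T (inductionAx x φ) := hT _ (.inl (.inr ⟨x, φ, rfl⟩))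
  have h1 := w.thm hax
  simp only [inductionAx, w.imp, w.and] at h1
  exact w.all_self (h1 ⟨h0 w, w.all.2 fun w' _ => w'.imp.2 (hs w')⟩)

theorem inst_rule {x φ} (h : ∀ w : World T, w φ) {t : Term} (hf : φ.freeFor t x) (w : World T) :
    w (φ.subst x t) := w.thm (prov_inst (prov_of_worlds h) hf)

theorem World.zero_A (hT : Extends T PAK) (w : World T) (a : w.Q) : w.A (w.q .zero) a = a := by
  obtain ⟨t, rfl⟩ := w.q_surj a
  have := inst_rule (x := 0) (ind_rule hT 0 (.eq (.add .zero (.var 0)) (.var 0)) (fun w => by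
    simp [w.eq, w.A_zero hT]) (fun w h => by
    simp [w.eq, w.A_succ hT] at h ⊢; rw [h])) (t := t) (by simp [Formula.freeFor]) w
  simpa [w.eq] using this

theorem World.succ_A (hT : Extends T PAK) (w : World T) (a b : w.Q) : w.A (w.S a) b = w.S (w.A a b) := by
  obtain ⟨t, rfl⟩ := w.q_surj a
  obtain ⟨u, rfl⟩ := w.q_surj b
  obtain ⟨x, hx⟩ := fresh t.fv
  have := inst_rule (x := x) (ind_rule hT x (.eq (.add (.succ t) (.var x)) (.succ (.add t (.var x)))) (fun w => by
    simp [w.eq, w.A_zero hT, Term.subst_fresh, hx]) (fun w h => by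
    simp [w.eq, w.A_succ hT, Term.subst_fresh, hx] at h ⊢; rw [h])) (t := u) (by simp [Formula.freeFor]) w
  simpa [w.eq, Term.subst_fresh, hx] using this

theorem World.A_assoc (hT : Extends T PAK) (w : World T) (a b c : w.Q) : w.A (w.A a b) c = w.A a (w.A b c) := by
  obtain ⟨t, rfl⟩ := w.q_surj a
  obtain ⟨u, rfl⟩ := w.q_surj b
  obtain ⟨r, rfl⟩ := w.q_surj c
  obtain ⟨x, hx⟩ := fresh (t.fv ∪ u.fv)
  simp only [Finset.mem_union, not_or] at hx
  have := inst_rule (x := x) (ind_rule hT x (.eq (.add (.add t u) (.var x)) (.add t (.add u (.var x)))) (fun w => by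
    simp [w.eq, w.A_zero hT, Term.subst_fresh, hx]) (fun w h => by
    simp [w.eq, w.A_succ hT, Term.subst_fresh, hx] at h ⊢; rw [h])) (t := r) (by simp [Formula.freeFor]) w
  simpa [w.eq, Term.subst_fresh, hx] using this

theorem World.A_comm (hT : Extends T PAK) (w : World T) (a b : w.Q) : w.A a b = w.A b a := by
  obtain ⟨t, rfl⟩ := w.q_surj a
  obtain ⟨u, rfl⟩ := w.q_surj b
  obtain ⟨x, hx⟩ := fresh t.fv
  have := inst_rule (x := x) (ind_rule hT x (.eq (.add t (.var x)) (.add (.var x) t)) (fun w => by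
    simp [w.eq, w.A_zero hT, w.zero_A hT, Term.subst_fresh, hx]) (fun w h => by
    simp [w.eq, w.A_succ hT, w.succ_A hT, Term.subst_fresh, hx] at h ⊢; rw [h])) (t := u)
    (by simp [Formula.freeFor]) w
  simpa [w.eq, Term.subst_fresh, hx] using this

/-- Case distinction: zero or successor of the value of a fresh variable. -/
theorem World.cases (hT : Extends T PAK) (w : World T) (t : Term) {z : ℕ} (hz : z ∉ t.fv) :
    w (.eq t .zero) ∨ ∃ w', Var z w w' ∧ w' (.eq t (.succ (.var z))) := by
  obtain ⟨x, hx⟩ := fresh (t.fv ∪ {z})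
  simp only [Finset.mem_union, not_or, Finset.mem_singleton] at hx
  have := inst_rule (x := x) (ind_rule hT x (.or (.eq (.var x) .zero) (.ex z (.eq (.var x) (.succ (.var z))))) (fun w => by
    simp [w.eq, w.or]) (fun w _ => by
    simp only [subst_or, w.or]
    right
    rw [subst_ex_ne hx.2]
    refine w.ex_intro (t := .var x) (by simp [Formula.freeFor]) ?_
    simp [w.eq, tsubst_var_ne hx.2, tsubst_var_ne (Ne.symm hx.2)])) (t := t)
    (by simp [Formula.freeFor, hz]) w
  simpa [w.or, subst_ex_ne hx.2, tsubst_var_ne hx.2, w.ex] using this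

theorem World.le_intro (hT : Extends T PAK) (w : World T) {t s u : Term} (h : w.A (w.q t) (w.q s) = w.q u) :
    w (.le t u) := by
  have hax : Provable T leDef := base_ax hT (by simp [baseAxioms])
  obtain ⟨a, ha⟩ := fresh (t.fv ∪ s.fv ∪ u.fv ∪ {0, 1, 2})
  obtain ⟨b, hb⟩ := fresh (t.fv ∪ s.fv ∪ u.fv ∪ {0, 1, 2, a})
  simp only [Finset.mem_union, not_or, Finset.mem_singleton, Finset.mem_insert] at ha hb
  have h0 : Provable T ((Formula.eq (.add (.var 0) (.var 2)) (.var 1)).imp (.le (.var 0) (.var 1))) := by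
    refine prov_of_worlds fun w => w.imp.2 fun h => ?_
    have := w.thm hax
    simp only [leDef, w.iff] at this
    exact this.2 (w.ex_self h)
  have h1 := prov_inst_qf 2 s (by simp [Formula.qf]) (prov_inst_qf 0 (.var a) (by simp [Formula.qf])
    (prov_inst_qf 1 (.var b) (by simp [Formula.qf]) h0))
  have hb1 : (2 : ℕ) ≠ b := Ne.symm hb.2.2.2.1
  have hb0 : (0 : ℕ) ≠ b := Ne.symm hb.2.1
  have ha1 : (2 : ℕ) ≠ a := Ne.symm ha.2.2.2
  simp [tsubst_var_ne, hb0, ha1, hb1] at h1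
  have h2 := w.thm (prov_inst_qf b u (by simp [Formula.qf]) (prov_inst_qf a t (by simp [Formula.qf]) h1))
  have hab : a ≠ b := Ne.symm hb.2.2.2.2
  simp [tsubst_var_ne, hab, Term.subst_fresh, ha, hb, w.imp, w.eq] at h2
  exact h2 h

theorem World.le_elim (hT : Extends T PAK) (w : World T) {t u : Term} (h : w (.le t u)) {z : ℕ} (hz : z ∉ t.fv)
    (hz' : z ∉ u.fv) : ∃ w', Var z w w' ∧ w'.A (w'.q t) (w'.q (.var z)) = w'.q u := by
  have hax : Provable T leDef := base_ax hT (by simp [baseAxioms])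
  obtain ⟨a, ha⟩ := fresh (t.fv ∪ u.fv ∪ {0, 1, 2, z})
  obtain ⟨b, hb⟩ := fresh (t.fv ∪ u.fv ∪ {0, 1, 2, z, a})
  simp only [Finset.mem_union, not_or, Finset.mem_singleton, Finset.mem_insert] at ha hb
  have hb2 : (2 : ℕ) ≠ b := Ne.symm hb.2.2.2.1
  have hb0 : (0 : ℕ) ≠ b := Ne.symm hb.2.1
  have ha2 : (2 : ℕ) ≠ a := Ne.symm ha.2.2.2.1
  have hab : a ≠ b := Ne.symm hb.2.2.2.2.2
  have haz : a ≠ z := ha.2.2.2.2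
  have hbz : b ≠ z := hb.2.2.2.2.1
  have h1 := prov_inst (x := 0) (t := .var a) (prov_inst (x := 1) (t := .var b) hax
    (by simp [leDef, Formula.iff, Formula.freeFor, Term.fv, hb2]))
    (by simp [leDef, Formula.iff, Formula.freeFor, Term.fv, hb2, ha2, subst_ex_ne])
  have h2 : Provable T ((Formula.le (.var a) (.var b)).imp
      (.ex z (.eq (.add (.var a) (.var z)) (.var b)))) := by
    refine prov_of_worlds fun w => w.imp.2 fun h => ?_
    have := w.thm h1
    simp [leDef, Formula.iff, w.and, w.imp, subst_ex_ne, tsubst_var_ne, hb0] at this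
    obtain ⟨w', hv, hw⟩ := w.ex.1 (this.1 h)
    refine (hv _ (by simp [Formula.fv, Term.fv, ha2, hb2])).1 ?_
    refine w'.ex_intro (t := .var 2) (by simp [Formula.freeFor]) ?_
    simpa [tsubst_var_ne, Ne.symm haz, Ne.symm hbz] using hw
  have h3 := prov_inst (x := b) (t := u) (prov_inst (x := a) (t := t) h2
    (by simp [Formula.freeFor, hz])) (by simp [subst_ex_ne, haz, Formula.freeFor, hz'])
  have h4 := w.thm h3
  simp [subst_ex_ne, haz, hbz, tsubst_var_ne, hab, Term.subst_fresh, hb, w.imp, w.ex] at h4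
  obtain ⟨w', hv, hw⟩ := h4 h
  exact ⟨w', hv, by simpa [w'.eq] using hw⟩

end ModalArith

namespace ModalArith
variable {T : Set Formula}

theorem Var.le {z : ℕ} {w w' : World T} (h : Var z w w') {t u : Term} (ht : z ∉ t.fv) (hu : z ∉ u.fv) :
    w' (.le t u) ↔ w (.le t u) := h _ (by simp [Formula.fv, ht, hu])
theorem Var.eq {z : ℕ} {w w' : World T} (h : Var z w w') {t u : Term} (ht : z ∉ t.fv) (hu : z ∉ u.fv) :
    w' (.eq t u) ↔ w (.eq t u) := h _ (by simp [Formula.fv, ht, hu])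

theorem fresh2 (t u : Term) : ∃ z, z ∉ t.fv ∧ z ∉ u.fv := by
  obtain ⟨z, hz⟩ := fresh (t.fv ∪ u.fv)
  exact ⟨z, by simpa using hz⟩

theorem World.not_lt_zero (hT : Extends T PAK) (w : World T) (t : Term) : ¬ w (.le (.succ t) .zero) := by
  intro h
  obtain ⟨z, hz, _⟩ := fresh2 t t
  obtain ⟨w', hv, hw⟩ := w.le_elim hT h (z := z) (by simpa [Term.fv] using hz) (by simp [Term.fv])
  rw [w'.q_succ, w'.succ_A hT] at hw
  exact w'.S_ne hT _ hw

theorem World.zero_le (hT : Extends T PAK) (w : World T) (t : Term) : w (.le .zero t) :=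
  w.le_intro hT (s := t) (w.zero_A hT _)

theorem World.le_refl (hT : Extends T PAK) (w : World T) (t : Term) : w (.le t t) :=
  w.le_intro hT (s := .zero) (w.A_zero hT _)

theorem World.le_add_right (hT : Extends T PAK) (w : World T) (t u : Term) : w (.le t (.add t u)) :=
  w.le_intro hT (s := u) rfl

theorem World.le_add_left (hT : Extends T PAK) (w : World T) (t u : Term) : w (.le t (.add u t)) :=
  w.le_intro hT (s := u) (w.A_comm hT _ _)

theorem World.le_trans (hT : Extends T PAK) (w : World T) {t u r : Term} (h1 : w (.le t u))
    (h2 : w (.le u r)) : w (.le t r) := by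
  obtain ⟨z, hz⟩ := fresh (t.fv ∪ u.fv ∪ r.fv)
  obtain ⟨y, hy⟩ := fresh (t.fv ∪ u.fv ∪ r.fv ∪ {z})
  simp only [Finset.mem_union, not_or, Finset.mem_singleton] at hz hy
  obtain ⟨w1, hv, hw⟩ := w.le_elim hT h1 hz.1.1 hz.1.2
  have h2' := (hv.le hz.1.2 hz.2).2 h2
  obtain ⟨w2, hv2, hw2⟩ := w1.le_elim hT h2' hy.1.1.2 hy.1.2
  have h3 : w1 (.eq (.add t (.var z)) u) := w1.eq.2 hw
  have h4 := w2.eq.1 ((hv2.eq (by simp [Term.fv, hy]) hy.1.1.2).2 h3)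
  refine (hv.le hz.1.1 hz.2).1 ((hv2.le hy.1.1.1 hy.1.2).1 ?_)
  refine w2.le_intro hT (s := .add (.var z) (.var y)) ?_
  rw [w2.q_add, ← w2.A_assoc hT, ← w2.q_add, h4, hw2]

theorem World.succ_le_succ (hT : Extends T PAK) (w : World T) {t u : Term} :
    w (.le (.succ t) (.succ u)) ↔ w (.le t u) := by
  obtain ⟨z, hz, hz'⟩ := fresh2 t u
  constructor
  · intro h
    obtain ⟨w', hv, hw⟩ := w.le_elim hT h (z := z) (by simpa [Term.fv] using hz) (by simpa [Term.fv] using hz')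
    refine (hv.le hz hz').1 (w'.le_intro hT (s := .var z) ?_)
    rw [w'.q_succ, w'.succ_A hT] at hw
    exact w'.S_inj hT hw
  · intro h
    obtain ⟨w', hv, hw⟩ := w.le_elim hT h hz hz'
    refine (hv.le (by simpa [Term.fv] using hz) (by simpa [Term.fv] using hz')).1
      (w'.le_intro hT (s := .var z) ?_)
    rw [w'.q_succ, w'.succ_A hT, hw, w'.q_succ]

theorem World.le_succ (hT : Extends T PAK) (w : World T) (t : Term) : w (.le t (.succ t)) := by
  refine w.le_intro hT (s := .succ .zero) ?_
  rw [w.q_succ, w.A_succ hT, w.A_zero hT, w.q_succ]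

theorem World.le_cases (hT : Extends T PAK) (w : World T) {t u : Term} (h : w (.le t u)) :
    w (.eq t u) ∨ w (.le (.succ t) u) := by
  obtain ⟨z, hz⟩ := fresh (t.fv ∪ u.fv)
  obtain ⟨y, hy⟩ := fresh (t.fv ∪ u.fv ∪ {z})
  simp only [Finset.mem_union, not_or, Finset.mem_singleton] at hz hy
  obtain ⟨w1, hv, hw⟩ := w.le_elim hT h hz.1 hz.2
  rcases w1.cases hT (.var z) (z := y) (by simp [Term.fv, hy]) with h0 | ⟨w2, hv2, h2⟩
  · left
    refine (hv.eq hz.1 hz.2).1 (w1.eq.2 ?_)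
    rw [← hw, w1.eq.1 h0, w1.A_zero hT]
  · right
    have h4 := w2.eq.1 ((hv2.eq (by simp [Term.fv, hy]) hy.1.2).2 (w1.eq (t := .add t (.var z)).2 hw))
    refine (hv.le (by simp [Term.fv, hz]) hz.2).1 ((hv2.le (by simp [Term.fv, hy]) hy.1.2).1 ?_)
    refine w2.le_intro hT (s := .var y) ?_
    rw [← h4, w2.q_add, w2.eq.1 h2, w2.q_succ, w2.q_succ, w2.succ_A hT, w2.A_succ hT]

theorem World.lt_succ (hT : Extends T PAK) (w : World T) {t u : Term}  :
    w (.le (.succ t) (.succ u)) ↔ w (.le (.succ t) u) ∨ w (.eq t u) := by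
  rw [w.succ_le_succ hT]
  constructor
  · intro h; exact (w.le_cases hT h).symm
  · rintro (h | h)
    · exact w.le_trans hT (w.le_succ hT t) h
    · exact w.le_congr rfl (w.eq.1 h) (w.le_refl hT t)

theorem World.lt_irrefl (hT : Extends T PAK) (w : World T) (t : Term) : ¬ w (.le (.succ t) t) := by
  have := inst_rule (x := 0) (t := t) (ind_rule hT 0 (.neg (.le (.succ (.var 0)) (.var 0)))
    (fun w => by simpa [w.neg] using w.not_lt_zero hT _)
    (fun w h => by simpa [w.neg, w.succ_le_succ hT] using h)) (by simp [Formula.freeFor]) w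
  simpa [w.neg] using this

theorem World.le_total (hT : Extends T PAK) (w : World T) (t u : Term) :
    w (.le t u) ∨ w (.le (.succ u) t) := by
  obtain ⟨x, hx, _⟩ := fresh2 t t
  have := inst_rule (x := x) (t := u)
    (ind_rule hT x (.or (.le t (.var x)) (.le (.succ (.var x)) t))
    (fun w => by
      simp only [subst_or, subst_le, w.or, Term.subst_fresh _ hx, tsubst_var, tsubst_succ]
      rcases w.le_cases hT (w.zero_le hT t) with h | h
      · exact .inl (w.le_congr (w.eq.1 h) rfl (w.le_refl hT _))
      · exact .inr h)
    (fun w h => by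
      simp only [subst_or, subst_le, w.or, Term.subst_fresh _ hx, tsubst_var, tsubst_succ] at h ⊢
      rcases h with h | h
      · exact .inl (w.le_trans hT h (w.le_succ hT _))
      rcases w.le_cases hT h with h | h
      · exact .inl (w.le_congr (w.eq.1 h) rfl (w.le_refl hT _))
      · exact .inr h)) (by simp [Formula.freeFor]) w
  simpa [w.or, Term.subst_fresh, hx] using this

theorem World.not_le (hT : Extends T PAK) (w : World T) {t u : Term} :
    ¬ w (.le t u) ↔ w (.le (.succ u) t) :=
  ⟨fun h => (w.le_total hT t u).resolve_left h,
    fun h h' => w.lt_irrefl hT u (w.le_trans hT h h')⟩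

theorem World.ne_iff (hT : Extends T PAK) (w : World T) {t u : Term} :
    ¬ w (.eq t u) ↔ w (.le (.succ t) u) ∨ w (.le (.succ u) t) := by
  constructor
  · intro h
    rcases w.le_total hT t u with h1 | h1
    · exact .inl ((w.le_cases hT h1).resolve_left h)
    · exact .inr h1
  · rintro (h | h) he
    · exact w.lt_irrefl hT t (w.le_congr rfl (w.eq.1 he).symm h)
    · exact w.lt_irrefl hT t (w.le_congr (congrArg w.S (w.eq.1 he).symm) rfl h)

/-! ## Boxed formulas -/

/-- `T ⊢ φ → □φ`. -/
def Boxed (T : Set Formula) (φ : Formula) : Prop := ∀ w : World T, w φ → w (.box φ)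

theorem nec_worlds {φ} (h : ∀ w : World T, w φ) (w : World T) : w (.box φ) :=
  w.thm (.nec (prov_of_worlds h))

theorem box_mono (hT : Extends T PAK) {φ ψ} (h : ∀ w : World T, w φ → w ψ) (w : World T)
    (hb : w (.box φ)) : w (.box ψ) :=
  (w.box hT).2 fun w' ha => h w' ((w.box hT).1 hb w' ha)

theorem box_mono2 (hT : Extends T PAK) {φ χ ψ} (h : ∀ w : World T, w φ → w χ → w ψ) (w : World T)
    (hb : w (.box φ)) (hc : w (.box χ)) : w (.box ψ) :=
  (w.box hT).2 fun w' ha => h w' ((w.box hT).1 hb w' ha) ((w.box hT).1 hc w' ha)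

theorem Boxed.congr (hT : Extends T PAK) {φ ψ} (h : ∀ w : World T, w φ ↔ w ψ) (hb : Boxed T φ) :
    Boxed T ψ := fun w hw => box_mono hT (fun w => (h w).1) w (hb w ((h w).2 hw))

theorem Boxed.and (hT : Extends T PAK) {φ ψ} (h : Boxed T φ) (h' : Boxed T ψ) :
    Boxed T (.and φ ψ) := fun w hw =>
  box_mono2 hT (fun w a b => w.and.2 ⟨a, b⟩) w (h w (w.and.1 hw).1) (h' w (w.and.1 hw).2)

theorem Boxed.or (hT : Extends T PAK) {φ ψ} (h : Boxed T φ) (h' : Boxed T ψ) :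
    Boxed T (.or φ ψ) := fun w hw => by
  rcases w.or.1 hw with hw | hw
  · exact box_mono hT (fun w a => w.or.2 (.inl a)) w (h w hw)
  · exact box_mono hT (fun w a => w.or.2 (.inr a)) w (h' w hw)

theorem Boxed.ex (hT : Extends T PAK) {φ} (x) (h : Boxed T φ) : Boxed T (.ex x φ) := fun w hw => by
  obtain ⟨w', hv, hw'⟩ := w.ex.1 hw
  refine (hv _ (by simp [Formula.fv])).1 ?_
  exact box_mono hT (fun w a => w.ex_self a) w' (h w' hw')

theorem Boxed.eq01 (hT : Extends T PAK) : Boxed T (.eq (.var 0) (.var 1)) := by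
  have key : ∀ w : World T, w (.all 1 (.imp (.eq (.var 0) (.var 1)) (.box (.eq (.var 0) (.var 1))))) := by
    refine ind_rule hT 0 _ (fun w => ?_) (fun w h => ?_)
    · rw [subst_all_ne (by decide)]
      refine w.all.2 fun w _ => ?_
      refine ind_rule hT 1 _ (fun w => ?_) (fun w h => ?_) w
      · simp only [subst_imp, subst_eq, subst_box, tsubst_var, tsubst_zero, w.imp]
        exact fun _ => nec_worlds (fun w => w.eq_refl _) w
      · simp only [subst_imp, subst_eq, subst_box, tsubst_var, tsubst_zero, w.imp, w.eq,
          tsubst_var_ne (show (0:ℕ) ≠ 1 by decide), w.q_succ]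
        exact fun h => absurd h.symm (w.S_ne hT _)
    · rw [subst_all_ne (by decide)]
      refine w.all.2 fun w' hv => ?_
      have h' := (hv _ (by simp [Formula.fv])).2 h
      simp only [subst_imp, subst_eq, subst_box, tsubst_var,
          tsubst_var_ne (show (0:ℕ) ≠ 1 by decide)]
      refine w'.imp.1 (ind_rule hT 1 (.imp (.all 1 (.imp (.eq (.var 0) (.var 1)) (.box (.eq (.var 0) (.var 1)))))
        (.imp (.eq (.succ (.var 0)) (.var 1)) (.box (.eq (.succ (.var 0)) (.var 1)))))
        (fun w => ?_) (fun w h => ?_) w') h'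
      · simp only [subst_imp, subst_eq, subst_box, tsubst_var, tsubst_succ, w.imp, w.eq,
          tsubst_var_ne (show (1:ℕ) ≠ 0 by decide), w.q_succ]
        exact fun _ h => absurd h (w.S_ne hT _)
      · simp only [subst_imp, subst_eq, subst_box, tsubst_var, tsubst_succ, w.imp, w.eq,
          tsubst_var_ne (show (1:ℕ) ≠ 0 by decide), w.q_succ, subst_all_same]
        intro h1 h2
        have h3 := w.imp.1 (w.all_self h1) (w.eq.2 (w.S_inj hT h2))
        refine box_mono hT (fun w h => ?_) w h3
        rw [w.eq] at h ⊢
        rw [w.q_succ, w.q_succ, h]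
  exact fun w h => w.imp.1 (w.all_self (key w)) h

theorem Boxed.eq (hT : Extends T PAK) (t u : Term) : Boxed T (.eq t u) := by
  obtain ⟨a, h1, h2, h3, h4⟩ := prov_inst2 (T := T)
    (φ := .imp (.eq (.var 0) (.var 1)) (.box (.eq (.var 0) (.var 1)))) t u (by simp [Formula.qf])
    (prov_of_worlds fun w => w.imp.2 (Boxed.eq01 hT w))
  simp [tsubst_var_ne, h3.symm, h1, Term.subst_fresh] at h4
  exact fun w h => w.imp.1 (w.thm h4) h

theorem Boxed.le (hT : Extends T PAK) (t u : Term) : Boxed T (.le t u) := by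
  obtain ⟨z, hz, hz'⟩ := fresh2 t u
  refine Boxed.congr hT (φ := .ex z (.eq (.add t (.var z)) u)) (fun w => ?_)
    (Boxed.ex hT z (Boxed.eq hT _ _))
  rw [w.ex]
  constructor
  · rintro ⟨w', hv, h⟩
    exact (hv.le hz hz').1 (w'.le_intro hT (w'.eq.1 h))
  · intro h
    obtain ⟨w', hv, h'⟩ := w.le_elim hT h hz hz'
    exact ⟨w', hv, w'.eq.2 h'⟩

/-- All variables occurring in a formula. -/
def Formula.vars : Formula → Finset ℕ
  | falsum => ∅
  | eq t u => t.fv ∪ u.fv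
  | le t u => t.fv ∪ u.fv
  | and φ ψ => vars φ ∪ vars ψ
  | or φ ψ => vars φ ∪ vars ψ
  | imp φ ψ => vars φ ∪ vars ψ
  | neg φ => vars φ
  | all x φ => insert x (vars φ)
  | ex x φ => insert x (vars φ)
  | box φ => vars φ

theorem Formula.fv_sub_vars (φ : Formula) : φ.fv ⊆ φ.vars := by
  induction φ with
  | all x φ ih => exact (Finset.erase_subset _ _).trans (ih.trans (Finset.subset_insert _ _))
  | ex x φ ih => exact (Finset.erase_subset _ _).trans (ih.trans (Finset.subset_insert _ _))
  | and _ _ ih1 ih2 => exact Finset.union_subset_union ih1 ih2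
  | or _ _ ih1 ih2 => exact Finset.union_subset_union ih1 ih2
  | imp _ _ ih1 ih2 => exact Finset.union_subset_union ih1 ih2
  | _ => simp_all [Formula.fv, Formula.vars]

theorem Formula.freeFor_fresh {φ : Formula} {s : Term} (x : ℕ) (h : ∀ y ∈ s.fv, y ∉ φ.vars) :
    φ.freeFor s x := by
  induction φ <;> simp_all [Formula.freeFor, Formula.vars] <;> grind

theorem World.tleib (w : World T) {x a : ℕ} (h : w (.eq (.var x) (.var a))) (t : Term) :
    w.q (Term.subst x (.var a) t) = w.q t := by
  induction t with
  | var y =>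
    by_cases hy : x = y
    · subst hy; rw [tsubst_var]; exact (w.eq.1 h).symm
    · rw [tsubst_var_ne hy]
  | zero => rfl
  | succ t ih => rw [tsubst_succ, w.q_succ, ih, w.q_succ]
  | add t u ih1 ih2 => rw [tsubst_add, w.q_add, ih1, ih2, w.q_add]
  | mul t u ih1 ih2 => rw [tsubst_mul, w.q_mul, ih1, ih2, w.q_mul]

/-- Leibniz law for `L_A`-formulas. -/
theorem leib {φ : Formula} (hb : φ.noBox) {x a : ℕ} (ha : a ∉ φ.vars) (hax : a ≠ x) :
    ∀ w : World T, w (.eq (.var x) (.var a)) → (w (φ.subst x (.var a)) ↔ w φ) := by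
  induction φ with
  | falsum => intro w _; simp
  | eq t u => intro w h; simp [w.eq, w.tleib h]
  | le t u =>
    intro w h
    exact ⟨w.le_congr (w.tleib h t) (w.tleib h u), w.le_congr (w.tleib h t).symm (w.tleib h u).symm⟩
  | and _ _ ih1 ih2 =>
    simp only [Formula.vars, Finset.mem_union, not_or] at ha
    intro w h; simp [w.and, ih1 hb.1 ha.1 w h, ih2 hb.2 ha.2 w h]
  | or _ _ ih1 ih2 =>
    simp only [Formula.vars, Finset.mem_union, not_or] at ha
    intro w h; simp [w.or, ih1 hb.1 ha.1 w h, ih2 hb.2 ha.2 w h]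
  | imp _ _ ih1 ih2 =>
    simp only [Formula.vars, Finset.mem_union, not_or] at ha
    intro w h; simp [w.imp, ih1 hb.1 ha.1 w h, ih2 hb.2 ha.2 w h]
  | neg _ ih => intro w h; simp [w.neg, ih hb ha w h]
  | all y φ ih =>
    simp only [Formula.vars, Finset.mem_insert, not_or] at ha
    intro w h
    by_cases hy : x = y
    · subst hy; simp
    · rw [subst_all_ne hy, w.all, w.all]
      refine forall₂_congr fun w' hv => ih hb ha.2 w' ?_
      exact (hv.eq (by simpa [Term.fv] using Ne.symm hy) (by simpa [Term.fv] using Ne.symm ha.1)).2 h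
  | ex y φ ih =>
    simp only [Formula.vars, Finset.mem_insert, not_or] at ha
    intro w h
    by_cases hy : x = y
    · subst hy; simp
    · rw [subst_ex_ne hy, w.ex, w.ex]
      refine exists_congr fun w' => and_congr_right fun hv => ih hb ha.2 w' ?_
      exact (hv.eq (by simpa [Term.fv] using Ne.symm hy) (by simpa [Term.fv] using Ne.symm ha.1)).2 h
  | box => exact hb.elim

theorem Term.fv_subst {t : Term} {x a y : ℕ} (hy : y ∈ (Term.subst x (.var a) t).fv) :
    y = a ∨ (y ≠ x ∧ y ∈ t.fv) := by
  induction t with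
  | var z =>
    by_cases hz : x = z
    · subst hz; rw [tsubst_var] at hy; left; simpa [Term.fv] using hy
    · rw [tsubst_var_ne hz] at hy; right; simp [Term.fv] at hy ⊢; exact ⟨by omega, hy⟩
  | zero => simp [Term.fv] at hy
  | succ t ih => exact ih hy
  | add t u ih1 ih2 => simp [Term.fv] at hy ⊢; grind
  | mul t u ih1 ih2 => simp [Term.fv] at hy ⊢; grind

theorem Formula.fv_subst {φ : Formula} {x a y : ℕ} (hy : y ∈ (φ.subst x (.var a)).fv) :
    y = a ∨ (y ≠ x ∧ y ∈ φ.fv) := by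
  induction φ with
  | all z φ ih =>
    by_cases hz : x = z
    · subst hz; right; simpa [Formula.fv] using hy
    · rw [subst_all_ne hz] at hy; simp [Formula.fv] at hy ⊢; grind
  | ex z φ ih =>
    by_cases hz : x = z
    · subst hz; right; simpa [Formula.fv] using hy
    · rw [subst_ex_ne hz] at hy; simp [Formula.fv] at hy ⊢; grind
  | falsum => simp [Formula.fv] at hy
  | eq t u => simp [Formula.fv] at hy ⊢; have := @Term.fv_subst t x a y; have := @Term.fv_subst u x a y; grind
  | le t u => simp [Formula.fv] at hy ⊢; have := @Term.fv_subst t x a y; have := @Term.fv_subst u x a y; grind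
  | neg _ ih => exact ih hy
  | box _ ih => exact ih hy
  | _ _ _ ih1 ih2 => simp [Formula.fv] at hy ⊢; grind

/-- If `x = a` and `φ`, then `φ` in every `x`-variant with `x = a`. -/
theorem leib_var {φ : Formula} (hb : φ.noBox) {x a : ℕ} (ha : a ∉ φ.vars) (hax : a ≠ x)
    {w w' : World T} (hv : Var x w w') (h : w (.eq (.var x) (.var a)))
    (h' : w' (.eq (.var x) (.var a))) : w' φ ↔ w φ := by
  rw [← leib hb ha hax w h, ← leib hb ha hax w' h']
  refine hv _ fun hx => ?_
  rcases Formula.fv_subst hx with h | h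
  · exact hax h.symm
  · exact h.1 rfl

end ModalArith

namespace ModalArith
variable {T : Set Formula}

theorem IsDelta0.noBox {φ} (h : IsDelta0 φ) : φ.noBox := by
  induction h <;> simp_all [Formula.noBox, Formula.ball, Formula.bex, Formula.lt]

theorem IsSigma1.noBox {φ} (h : IsSigma1 φ) : φ.noBox := by
  induction h with
  | delta0 h => exact h.noBox
  | _ => simp_all [Formula.noBox, Formula.ball, Formula.bex, Formula.lt]

theorem Boxed.ball_var (hT : Extends T PAK) {φ} (hb : φ.noBox) {x a : ℕ} (ha : a ∉ φ.vars)
    (hax : a ≠ x) (h : Boxed T φ) : Boxed T (Formula.ball x (.var a) φ) := by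
  have haf : a ∉ φ.fv := fun h => ha (φ.fv_sub_vars h)
  suffices key : ∀ w : World T, w (.imp (Formula.ball x (.var a) φ) (.box (Formula.ball x (.var a) φ))) from
    fun w hw => w.imp.1 (key w) hw
  have hsub : ∀ s, (Formula.ball x (.var a) φ).subst a s = Formula.ball x s φ := by
    intro s
    simp [Formula.ball, Formula.lt, subst_all_ne hax, tsubst_var_ne hax, Formula.subst_fresh _ haf]
  refine ind_rule hT a _ (fun w => ?_) (fun w hw => ?_)
  · rw [subst_imp, subst_box, hsub, w.imp]
    refine fun _ => nec_worlds (fun w => w.all.2 fun w' _ => w'.imp.2 fun h => ?_) w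
    exact absurd h (w'.not_lt_zero hT _)
  · rw [subst_imp, subst_box, hsub, w.imp]
    intro hB'
    have hB : w (Formula.ball x (.var a) φ) := by
      refine w.all.2 fun w' hv => w'.imp.2 fun h => ?_
      exact w'.imp.1 (w.all.1 hB' w' hv) ((w'.lt_succ hT).2 (.inl h))
    have h1 := w.imp.1 hw hB
    obtain ⟨w2, hv, h2⟩ := w.set_var x (t := .var a) (by simpa [Term.fv] using hax.symm)
    have h3 : w2 φ := w2.imp.1 (w.all.1 hB' w2 hv) ((w2.lt_succ hT).2 (.inr h2))
    have h4 : w2 (.box (.all x (.imp (.eq (.var x) (.var a)) φ))) := by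
      refine box_mono2 hT (fun w hw1 hw2 => ?_) w2 (h w2 h3) (Boxed.eq hT _ _ w2 h2)
      exact w.all.2 fun w' hv' => w'.imp.2 fun he => (leib_var hb ha hax hv' hw2 he).2 hw1
    have h5 := (hv _ (by simp [Formula.fv])).1 h4
    refine box_mono2 hT (fun w hw1 hw2 => ?_) w h1 h5
    refine w.all.2 fun w' hv' => w'.imp.2 fun he => ?_
    rcases (w'.lt_succ hT).1 he with he | he
    · exact w'.imp.1 (w.all.1 hw1 w' hv') he
    · exact w'.imp.1 (w.all.1 hw2 w' hv') he

theorem Boxed.ball (hT : Extends T PAK) {φ} (hb : φ.noBox) {x : ℕ} {t : Term} (hx : x ∉ t.fv)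
    (h : Boxed T φ) : Boxed T (Formula.ball x t φ) := by
  obtain ⟨a, ha⟩ := fresh (φ.vars ∪ {x})
  simp only [Finset.mem_union, not_or, Finset.mem_singleton] at ha
  have haf : a ∉ φ.fv := fun h => ha.1 (φ.fv_sub_vars h)
  have := prov_inst (x := a) (t := t) (prov_of_worlds fun w => w.imp.2 (Boxed.ball_var hT hb ha.1 ha.2 h w))
    (by simp [Formula.ball, Formula.lt, Formula.freeFor, hx, Formula.freeFor_of_notMem, haf])
  simp [Formula.ball, Formula.lt, subst_all_ne ha.2, tsubst_var_ne ha.2, Formula.subst_fresh _ haf] at this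
  exact fun w hw => w.imp.1 (w.thm this) hw

theorem IsDelta0.boxed (hT : Extends T PAK) {φ} (h : IsDelta0 φ) : Boxed T φ ∧ Boxed T φ.neg := by
  induction h with
  | falsum =>
    exact ⟨fun w hw => (w.falsum hw).elim, fun w _ => nec_worlds (fun w => w.neg.2 w.falsum) w⟩
  | eq t u =>
    refine ⟨Boxed.eq hT t u, Boxed.congr hT (fun w => ?_)
      (Boxed.or hT (Boxed.le hT (.succ t) u) (Boxed.le hT (.succ u) t))⟩
    rw [w.or, w.neg, w.ne_iff hT]
  | le t u =>
    refine ⟨Boxed.le hT t u, Boxed.congr hT (fun w => ?_) (Boxed.le hT (.succ u) t)⟩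
    rw [w.neg, w.not_le hT]
  | and _ _ ih1 ih2 =>
    refine ⟨Boxed.and hT ih1.1 ih2.1, Boxed.congr hT (fun w => ?_) (Boxed.or hT ih1.2 ih2.2)⟩
    simp only [w.or, w.neg, w.and]; tauto
  | or _ _ ih1 ih2 =>
    refine ⟨Boxed.or hT ih1.1 ih2.1, Boxed.congr hT (fun w => ?_) (Boxed.and hT ih1.2 ih2.2)⟩
    simp only [w.or, w.neg, w.and]; tauto
  | imp _ _ ih1 ih2 =>
    refine ⟨Boxed.congr hT (fun w => ?_) (Boxed.or hT ih1.2 ih2.1),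
      Boxed.congr hT (fun w => ?_) (Boxed.and hT ih1.1 ih2.2)⟩
    · simp only [w.or, w.neg, w.imp]; tauto
    · simp only [w.and, w.neg, w.imp]; tauto
  | neg _ ih =>
    refine ⟨ih.2, Boxed.congr hT (fun w => ?_) ih.1⟩
    simp only [w.neg]; tauto
  | @ball x t φ hx h ih =>
    refine ⟨Boxed.ball hT h.noBox hx ih.1, Boxed.congr hT (fun w => ?_)
      (Boxed.ex hT x (Boxed.and hT (Boxed.le hT (.succ (.var x)) t) ih.2))⟩
    simp only [Formula.ball, Formula.lt, w.neg, w.ex, w.all, World.and, World.neg, World.imp]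
    push Not; rfl
  | @bex x t φ hx h ih =>
    refine ⟨Boxed.ex hT x (Boxed.and hT (Boxed.le hT (.succ (.var x)) t) ih.1),
      Boxed.congr hT (fun w => ?_) (Boxed.ball hT (φ := φ.neg) h.noBox hx ih.2)⟩
    simp only [Formula.ball, Formula.bex, Formula.lt, w.neg, w.ex, w.all, World.and, World.neg, World.imp]
    push Not; rfl

/-! ## Numerals and completeness -/

open Term (numeral)

@[simp] theorem numeral_fv (n : ℕ) : (numeral n).fv = ∅ := by
  induction n with
  | zero => rfl
  | succ n ih => exact ih

theorem World.q_num_add (hT : Extends T PAK) (w : World T) (m n : ℕ) :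
    w.A (w.q (numeral m)) (w.q (numeral n)) = w.q (numeral (m + n)) := by
  induction n with
  | zero => exact w.A_zero hT _
  | succ n ih => rw [numeral, w.q_succ, w.A_succ hT, ih]; rfl

theorem World.q_num_mul (hT : Extends T PAK) (w : World T) (m n : ℕ) :
    w.M (w.q (numeral m)) (w.q (numeral n)) = w.q (numeral (m * n)) := by
  induction n with
  | zero => exact w.M_zero hT _
  | succ n ih => rw [numeral, w.q_succ, w.M_succ hT, ih, w.q_num_add hT, Nat.mul_succ]

theorem World.q_num (hT : Extends T PAK) (w : World T) (t : Term) (v : ℕ → ℕ)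
    (h : ∀ x ∈ t.fv, w (.eq (.var x) (numeral (v x)))) : w.q t = w.q (numeral (t.val v)) := by
  induction t with
  | var x => exact w.eq.1 (h x (by simp [Term.fv]))
  | zero => rfl
  | succ t ih => rw [w.q_succ, ih h]; rfl
  | add t u ih1 ih2 =>
    simp only [Term.fv, Finset.mem_union] at h
    rw [w.q_add, ih1 fun x hx => h x (.inl hx), ih2 fun x hx => h x (.inr hx), w.q_num_add hT]; rfl
  | mul t u ih1 ih2 =>
    simp only [Term.fv, Finset.mem_union] at h
    rw [w.q_mul, ih1 fun x hx => h x (.inl hx), ih2 fun x hx => h x (.inr hx), w.q_num_mul hT]; rfl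

theorem World.num_le (hT : Extends T PAK) (w : World T) {m n : ℕ} (h : m ≤ n) :
    w (.le (numeral m) (numeral n)) := by
  obtain ⟨k, rfl⟩ := Nat.exists_eq_add_of_le h
  exact w.le_intro hT (s := numeral k) (w.q_num_add hT _ _)

theorem World.num_le_iff (hT : Extends T PAK) (w : World T) {m n : ℕ} :
    w (.le (numeral m) (numeral n)) ↔ m ≤ n := by
  refine ⟨fun h => ?_, w.num_le hT⟩
  by_contra h'
  exact (w.not_le hT).2 (w.num_le hT (m := n + 1) (by omega)) h

theorem World.num_eq_iff (hT : Extends T PAK) (w : World T) {m n : ℕ} :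
    w.q (numeral m) = w.q (numeral n) ↔ m = n := by
  refine ⟨fun h => ?_, fun h => by rw [h]⟩
  have h1 := (w.num_le_iff hT).1 (w.le_congr rfl h (w.le_refl hT (numeral m)))
  have h2 := (w.num_le_iff hT).1 (w.le_congr rfl h.symm (w.le_refl hT (numeral n)))
  omega

theorem World.lt_num (hT : Extends T PAK) (w : World T) {t : Term} {n : ℕ}
    (h : w (.le (.succ t) (numeral n))) : ∃ k < n, w (.eq t (numeral k)) := by
  induction n with
  | zero => exact absurd h (w.not_lt_zero hT _)
  | succ n ih =>
    rcases (w.lt_succ hT).1 h with h | h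
    · obtain ⟨k, hk, h⟩ := ih h; exact ⟨k, by omega, h⟩
    · exact ⟨n, by omega, h⟩

/-- `w` assigns the values `v` to the free variables of `φ`. -/
def World.Agrees (w : World T) (v : ℕ → ℕ) (φ : Formula) : Prop :=
  ∀ x ∈ φ.fv, w (.eq (.var x) (numeral (v x)))

theorem World.Agrees.upd {w w' : World T} {v : ℕ → ℕ} {x k : ℕ} {φ ψ : Formula}
    (h : w.Agrees v ψ) (hs : ∀ y ∈ φ.fv, y ≠ x → y ∈ ψ.fv) (hv : Var x w w')
    (hk : w' (.eq (.var x) (numeral k))) : w'.Agrees (Function.update v x k) φ := by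
  intro y hy
  by_cases hyx : y = x
  · subst hyx; simpa using hk
  · rw [Function.update_of_ne hyx]
    exact (hv.eq (by simpa [Term.fv] using Ne.symm hyx) (by simp)).2 (h y (hs y hy hyx))

theorem Term.val_congr {t : Term} {v v' : ℕ → ℕ} (h : ∀ x ∈ t.fv, v x = v' x) : t.val v = t.val v' := by
  induction t <;> simp_all [Term.fv, Term.val]

theorem Formula.val_congr {φ : Formula} {v v' : ℕ → ℕ} (h : ∀ x ∈ φ.fv, v x = v' x) :
    φ.val v ↔ φ.val v' := by
  induction φ generalizing v v' with
  | all x φ ih =>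
    refine forall_congr' fun n => ih fun y hy => ?_
    by_cases hyx : y = x
    · subst hyx; simp
    · simp [hyx, h y (by simp [Formula.fv, hyx, hy])]
  | ex x φ ih =>
    refine exists_congr fun n => ih fun y hy => ?_
    by_cases hyx : y = x
    · subst hyx; simp
    · simp [hyx, h y (by simp [Formula.fv, hyx, hy])]
  | falsum => rfl
  | eq t u =>
    simp only [Formula.fv, Finset.mem_union] at h
    simp only [Formula.val]
    rw [Term.val_congr fun x hx => h x (.inl hx), Term.val_congr fun x hx => h x (.inr hx)]
  | le t u =>
    simp only [Formula.fv, Finset.mem_union] at h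
    simp only [Formula.val]
    rw [Term.val_congr fun x hx => h x (.inl hx), Term.val_congr fun x hx => h x (.inr hx)]
  | and _ _ ih1 ih2 =>
    simp only [Formula.fv, Finset.mem_union] at h
    exact and_congr (ih1 fun x hx => h x (.inl hx)) (ih2 fun x hx => h x (.inr hx))
  | or _ _ ih1 ih2 =>
    simp only [Formula.fv, Finset.mem_union] at h
    exact or_congr (ih1 fun x hx => h x (.inl hx)) (ih2 fun x hx => h x (.inr hx))
  | imp _ _ ih1 ih2 =>
    simp only [Formula.fv, Finset.mem_union] at h
    exact imp_congr (ih1 fun x hx => h x (.inl hx)) (ih2 fun x hx => h x (.inr hx))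
  | neg _ ih => exact not_congr (ih h)
  | box => rfl

theorem val_ball {x : ℕ} {t : Term} {φ : Formula} (hx : x ∉ t.fv) {v : ℕ → ℕ} :
    (Formula.ball x t φ).val v ↔ ∀ n < t.val v, φ.val (Function.update v x n) := by
  refine forall_congr' fun n => ?_
  simp only [Formula.lt, Formula.val, Term.val, Function.update_self]
  rw [Term.val_congr (v := Function.update v x n) (v' := v)
    fun y hy => Function.update_of_ne (by rintro rfl; exact hx hy) _ _]
  rfl

theorem val_bex {x : ℕ} {t : Term} {φ : Formula} (hx : x ∉ t.fv) {v : ℕ → ℕ} :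
    (Formula.bex x t φ).val v ↔ ∃ n < t.val v, φ.val (Function.update v x n) := by
  refine exists_congr fun n => ?_
  simp only [Formula.lt, Formula.val, Term.val, Function.update_self]
  rw [Term.val_congr (v := Function.update v x n) (v' := v)
    fun y hy => Function.update_of_ne (by rintro rfl; exact hx hy) _ _]
  rfl

theorem World.Agrees.left {w : World T} {v : ℕ → ℕ} {φ ψ χ : Formula} (h : w.Agrees v χ)
    (hs : χ.fv = φ.fv ∪ ψ.fv) : w.Agrees v φ ∧ w.Agrees v ψ := by
  constructor <;> intro x hx <;> exact h x (by simp [hs, hx])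

theorem fv_ball (x t φ) : (Formula.ball x t φ).fv = (({x} ∪ t.fv) ∪ φ.fv).erase x := rfl
theorem fv_bex (x t φ) : (Formula.bex x t φ).fv = (({x} ∪ t.fv) ∪ φ.fv).erase x := rfl

theorem World.ball_num (hT : Extends T PAK) {w : World T} {v : ℕ → ℕ} {x : ℕ} {t : Term} {φ : Formula}
    (hx : x ∉ t.fv) (ha : ∀ y ∈ (Formula.ball x t φ).fv, w (.eq (.var y) (numeral (v y)))) (w' : World T)
    (hv : Var x w w') (hl : w' (.le (.succ (.var x)) t)) :
    ∃ k < t.val v, w'.Agrees (Function.update v x k) φ := by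
  have hne : ∀ y ∈ t.fv, y ≠ x := by rintro y hy rfl; exact hx hy
  have ht : w.q t = w.q (numeral (t.val v)) := w.q_num hT t v fun y hy =>
    ha y (by simp [fv_ball, hy, hne y hy])
  have ht' := w'.eq.1 ((hv.eq hx (by simp)).2 (w.eq.2 ht))
  obtain ⟨k, hk, h⟩ := w'.lt_num hT (w'.le_congr rfl ht' hl)
  exact ⟨k, hk, World.Agrees.upd (ψ := Formula.ball x t φ) ha
    (fun y hy hyx => by simp [fv_ball, hy, hyx]) hv h⟩

theorem World.bex_num (hT : Extends T PAK) {w : World T} {v : ℕ → ℕ} {x : ℕ} {t : Term} {φ : Formula}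
    (hx : x ∉ t.fv) (ha : ∀ y ∈ (Formula.ball x t φ).fv, w (.eq (.var y) (numeral (v y))))
    {k : ℕ} (hk : k < t.val v) :
    ∃ w', Var x w w' ∧ w' (.le (.succ (.var x)) t) ∧ w'.Agrees (Function.update v x k) φ := by
  have hne : ∀ y ∈ t.fv, y ≠ x := by rintro y hy rfl; exact hx hy
  have ht : w.q t = w.q (numeral (t.val v)) := w.q_num hT t v fun y hy =>
    ha y (by simp [fv_ball, hy, hne y hy])
  obtain ⟨w', hv, h⟩ := w.set_var x (t := numeral k) (by simp)
  have ht' := w'.eq.1 ((hv.eq hx (by simp)).2 (w.eq.2 ht))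
  refine ⟨w', hv, ?_, World.Agrees.upd (ψ := Formula.ball x t φ) ha
    (fun y hy hyx => by simp [fv_ball, hy, hyx]) hv h⟩
  refine w'.le_congr ?_ ht'.symm (w'.num_le hT (m := k + 1) hk)
  rw [w'.q_succ, w'.eq.1 h]; rfl

theorem IsDelta0.decide (hT : Extends T PAK) {φ} (h : IsDelta0 φ) :
    ∀ (w : World T) (v : ℕ → ℕ), w.Agrees v φ → (w φ ↔ φ.val v) := by
  induction h with
  | falsum => exact fun w v _ => iff_of_false w.falsum id
  | eq t u =>
    intro w v h
    rw [w.eq, w.q_num hT t v fun x hx => h x (by simp [Formula.fv, hx]),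
      w.q_num hT u v fun x hx => h x (by simp [Formula.fv, hx]), w.num_eq_iff hT]; rfl
  | le t u =>
    intro w v h
    have h1 := w.q_num hT t v fun x hx => h x (by simp [Formula.fv, hx])
    have h2 := w.q_num hT u v fun x hx => h x (by simp [Formula.fv, hx])
    have : w (.le t u) ↔ w (.le (numeral (t.val v)) (numeral (u.val v))) :=
      ⟨w.le_congr h1 h2, w.le_congr h1.symm h2.symm⟩
    rw [this, w.num_le_iff hT]; rfl
  | and _ _ ih1 ih2 => 
    intro w v h
    rw [w.and, ih1 w v (h.left rfl).1, ih2 w v (h.left rfl).2]; rfl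
  | or _ _ ih1 ih2 => 
    intro w v h
    rw [w.or, ih1 w v (h.left rfl).1, ih2 w v (h.left rfl).2]; rfl
  | imp _ _ ih1 ih2 => 
    intro w v h
    rw [w.imp, ih1 w v (h.left rfl).1, ih2 w v (h.left rfl).2]; rfl
  | neg _ ih => intro w v h; rw [w.neg, ih w v h]; rfl
  | @ball x t φ hx h ih =>
    intro w v ha
    rw [val_ball hx]
    constructor
    · intro hw k hk
      obtain ⟨w', hv, hl, ha'⟩ := World.bex_num hT hx ha hk
      exact (ih _ _ ha').1 (w'.imp.1 (w.all.1 hw w' hv) hl)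
    · intro hw
      refine w.all.2 fun w' hv => w'.imp.2 fun hl => ?_
      obtain ⟨k, hk, ha'⟩ := World.ball_num hT hx ha w' hv hl
      exact (ih _ _ ha').2 (hw k hk)
  | @bex x t φ hx h ih =>
    intro w v ha
    rw [val_bex hx]
    constructor
    · intro hw
      obtain ⟨w', hv, hl⟩ := w.ex.1 hw
      obtain ⟨k, hk, ha'⟩ := World.ball_num hT hx ha w' hv (w'.and.1 hl).1
      exact ⟨k, hk, (ih _ _ ha').1 (w'.and.1 hl).2⟩
    · rintro ⟨k, hk, hw⟩
      obtain ⟨w', hv, hl, ha'⟩ := World.bex_num hT hx ha hk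
      exact w.ex.2 ⟨w', hv, w'.and.2 ⟨hl, (ih _ _ ha').2 hw⟩⟩

theorem IsSigma1.complete (hT : Extends T PAK) {φ} (h : IsSigma1 φ) :
    ∀ (w : World T) (v : ℕ → ℕ), w.Agrees v φ → φ.val v → w φ := by
  induction h with
  | delta0 h => exact fun w v ha hv => (h.decide hT w v ha).2 hv
  | and _ _ ih1 ih2 => 
    intro w v h hv
    exact w.and.2 ⟨ih1 w v (h.left rfl).1 hv.1, ih2 w v (h.left rfl).2 hv.2⟩
  | or _ _ ih1 ih2 => 
    intro w v h hv
    exact w.or.2 (hv.imp (ih1 w v (h.left rfl).1) (ih2 w v (h.left rfl).2))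
  | @ex x φ h ih =>
    rintro w v ha ⟨k, hk⟩
    obtain ⟨w', hv, h⟩ := w.set_var x (t := numeral k) (by simp)
    exact w.ex.2 ⟨w', hv, ih w' _ (ha.upd (fun y hy hyx => by simp [Formula.fv, hy, hyx]) hv h) hk⟩
  | @ball x t φ hx h ih =>
    intro w v ha hw
    rw [val_ball hx] at hw
    refine w.all.2 fun w' hv => w'.imp.2 fun hl => ?_
    obtain ⟨k, hk, ha'⟩ := World.ball_num hT hx ha w' hv hl
    exact ih _ _ ha' (hw k hk)

theorem sigma1_complete (hT : Extends T PAK) {σ} (h : IsSigma1 σ) (hs : Sentence σ)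
    (ht : σ.val fun _ => 0) : Provable T σ :=
  prov_of_worlds fun w => h.complete hT w _ (fun x hx => by rw [hs] at hx; simp at hx) ht

end ModalArith

namespace ModalArith
variable {T : Set Formula}

/-! ## Normal form of Σ₁ formulas -/

theorem mem_fv_bex {x y s : ℕ} {φ : Formula} :
    y ∈ (Formula.bex x (.var s) φ).fv ↔ y ≠ x ∧ (y = s ∨ y ∈ φ.fv) := by
  simp [fv_bex, Term.fv]

theorem mem_fv_ball {x y : ℕ} {t : Term} {φ : Formula} :
    y ∈ (Formula.ball x t φ).fv ↔ y ≠ x ∧ (y ∈ t.fv ∨ y ∈ φ.fv) := by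
  simp [fv_ball]

theorem mem_fv_ex {x y : ℕ} {φ : Formula} :
    y ∈ (Formula.ex x φ).fv ↔ y ≠ x ∧ y ∈ φ.fv := by
  simp [Formula.fv]

theorem World.bex_mono (hT : Extends T PAK) (w : World T) {r s s' : ℕ} {θ : Formula} (hs : r ≠ s) (hs' : r ≠ s')
    (hl : w (.le (.var s) (.var s'))) (h : w (Formula.bex r (.var s) θ)) :
    w (Formula.bex r (.var s') θ) := by
  obtain ⟨w', hv, h'⟩ := w.ex.1 h
  refine w.ex.2 ⟨w', hv, w'.and.2 ⟨?_, (w'.and.1 h').2⟩⟩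
  exact w'.le_trans hT (w'.and.1 h').1 ((hv.le (by simpa [Term.fv]) (by simpa [Term.fv])).2 hl)

theorem World.bound (hT : Extends T PAK) (w : World T) {r s : ℕ} {θ : Formula} (hs : s ≠ r) (hs' : s ∉ θ.fv)
    (h : w (.ex r θ)) : w (.ex s (Formula.bex r (.var s) θ)) := by
  obtain ⟨w1, hv, h1⟩ := w.ex.1 h
  obtain ⟨w2, hv2, h2⟩ := w1.set_var s (t := .succ (.var r)) (by simpa [Term.fv])
  refine (hv _ (by simp [mem_fv_ex, mem_fv_bex])).1 (w1.ex.2 ⟨w2, hv2, w2.ex_self (w2.and.2 ⟨?_, ?_⟩)⟩)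
  · exact w2.le_congr (w2.eq.1 h2) rfl (w2.le_refl hT _)
  · exact (hv2 _ hs').2 h1

theorem upd_fresh {θ : Formula} {s : ℕ} (hs : s ∉ θ.fv) (v : ℕ → ℕ) (n r k : ℕ) :
    θ.val (Function.update (Function.update v s n) r k) ↔ θ.val (Function.update v r k) := by
  refine Formula.val_congr fun y hy => ?_
  have : y ≠ s := by rintro rfl; exact hs hy
  by_cases h : y = r <;> simp [h, Function.update_apply, this]

/-- `θ` is a Δ₀ matrix (with witness variable `r`) for `φ`. -/
structure NF (T : Set Formula) (F : Finset ℕ) (φ : Formula) (r : ℕ) (θ : Formula) : Prop where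
  fr : r ∉ F
  d0 : IsDelta0 θ
  fv : ∀ y ∈ θ.fv, y = r ∨ y ∈ φ.fv
  imp : ∀ w : World T, w φ → w (.ex r θ)
  val : ∀ v, φ.val v ↔ ∃ n, θ.val (Function.update v r n)

theorem collect (hT : Extends T PAK) {x r s a : ℕ} {θ : Formula} (hθ : IsDelta0 θ) (hxr : x ≠ r) (hxs : x ≠ s)
    (hrs : r ≠ s) (hs : s ∉ θ.fv) (hax : a ≠ x) (har : a ≠ r) (has : a ≠ s) (ha : a ∉ θ.vars) (w : World T)
    (h : w (Formula.ball x (.var a) (.ex r θ))) :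
    w (.ex s (Formula.ball x (.var a) (Formula.bex r (.var s) θ))) := by
  have haf : a ∉ θ.fv := fun h => ha (θ.fv_sub_vars h)
  refine w.imp.1 (ind_rule hT a (.imp (Formula.ball x (.var a) (.ex r θ))
    (.ex s (Formula.ball x (.var a) (Formula.bex r (.var s) θ)))) (fun w => ?_) (fun w hw => ?_) w) h
  · simp only [Formula.ball, Formula.bex, Formula.lt, subst_imp, subst_ex_ne has, subst_all_ne hax,
      subst_ex_ne har, subst_le, subst_and, tsubst_succ, tsubst_var_ne hax, tsubst_var,
      tsubst_var_ne har, tsubst_var_ne has, Formula.subst_fresh _ haf]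
    refine w.imp.2 fun _ => w.ex_self (w.all.2 fun w' _ => w'.imp.2 fun h => ?_)
    exact absurd h (w'.not_lt_zero hT _)
  · simp only [Formula.ball, Formula.bex, Formula.lt, subst_imp, subst_ex_ne has, subst_all_ne hax,
      subst_ex_ne har, subst_le, subst_and, tsubst_succ, tsubst_var_ne hax, tsubst_var,
      tsubst_var_ne har, tsubst_var_ne has, Formula.subst_fresh _ haf]
    refine w.imp.2 fun hB => ?_
    change w (.ex s (Formula.ball x (.succ (.var a)) (Formula.bex r (.var s) θ)))
    obtain ⟨s1, hs1⟩ := fresh (θ.fv ∪ {x, r, s, a})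
    obtain ⟨s2, hs2⟩ := fresh (θ.fv ∪ {x, r, s, a, s1})
    simp only [Finset.mem_union, not_or, Finset.mem_singleton, Finset.mem_insert] at hs1 hs2
    obtain ⟨hs1t, hs1x, hs1r, hs1s, hs1a⟩ := hs1
    obtain ⟨hs2t, hs2x, hs2r, hs2s, hs2a, hs21⟩ := hs2
    -- induction hypothesis
    have h1 : w (.ex s (Formula.ball x (.var a) (Formula.bex r (.var s) θ))) := by
      refine w.imp.1 hw (w.all.2 fun w' hv => w'.imp.2 fun h => ?_)
      exact w'.imp.1 (w.all.1 hB w' hv) ((w'.lt_succ hT).2 (.inl h))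
    -- the new element
    have h2 : w (.ex s1 (.all x (.imp (.eq (.var x) (.var a)) (Formula.bex r (.var s1) θ)))) := by
      obtain ⟨w2, hv2, h2⟩ := w.set_var x (t := .var a) (by simpa [Term.fv] using hax.symm)
      have h3 := w2.imp.1 (w.all.1 hB w2 hv2) ((w2.lt_succ hT).2 (.inr h2))
      obtain ⟨w3, hv3, h4⟩ := w2.ex.1 (w2.bound hT hs1r hs1t h3)
      refine (hv2 _ (by simp [Formula.fv])).1 (w2.ex.2 ⟨w3, hv3, ?_⟩)
      have h5 := (hv3.eq (by simpa [Term.fv]) (by simpa [Term.fv])).2 h2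
      refine w3.all.2 fun w4 hv4 => w4.imp.2 fun he => (leib_var ?_ ?_ hax hv4 h5 he).2 h4
      · simp [Formula.bex, Formula.noBox, Formula.lt, hθ.noBox]
      · simp [Formula.bex, Formula.vars, Formula.lt, Term.fv, ha, har, Ne.symm hs1a]
    obtain ⟨w1, hv1, h3⟩ := w.ex.1 h1
    have h4 := (hv1 _ (by
      simp only [Formula.fv, Finset.mem_erase, Finset.mem_union, mem_fv_bex, Term.fv, Finset.mem_singleton]
      grind)).2 h2
    obtain ⟨w4, hv4, h5⟩ := w1.ex.1 h4
    obtain ⟨w5, hv5, h6⟩ := w4.set_var s2 (t := .add (.var s) (.var s1)) (by simp [Term.fv, hs2s, hs21])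
    have h3' := (hv5 _ (by simp [mem_fv_ball, mem_fv_bex, Term.fv]; grind)).2
      ((hv4 _ (by simp [mem_fv_ball, mem_fv_bex, Term.fv]; grind)).2 h3)
    have h5' := (hv5 _ (by 
      simp only [Formula.fv, Finset.mem_erase, Finset.mem_union, mem_fv_bex, Term.fv, Finset.mem_singleton]
      grind)).2 h5
    have h7 : w5 (Formula.ball x (.succ (.var a)) (Formula.bex r (.var s2) θ)) := by
      refine w5.all.2 fun w' hv => w'.imp.2 fun hl => ?_
      have h6' := w'.eq.1 ((hv.eq (by simpa [Term.fv] using (Ne.symm hs2x))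
        (by simp [Term.fv, hxs, (Ne.symm hs1x)])).2 h6)
      rcases (w'.lt_succ hT).1 hl with hl | hl
      · exact w'.bex_mono hT hrs (Ne.symm hs2r) (w'.le_congr rfl h6'.symm (w'.le_add_right hT _ _))
          (w'.imp.1 (w5.all.1 h3' w' hv) hl)
      · exact w'.bex_mono hT (Ne.symm hs1r) (Ne.symm hs2r) (w'.le_congr rfl h6'.symm (w'.le_add_left hT _ _))
          (w'.imp.1 (w5.all.1 h5' w' hv) hl)
    have h8 : w5 (.ex s (Formula.ball x (.succ (.var a)) (Formula.bex r (.var s) θ))) := by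
      obtain ⟨w6, hv6, h9⟩ := w5.set_var s (t := .var s2) (by simpa [Term.fv] using (Ne.symm hs2s))
      refine w5.ex.2 ⟨w6, hv6, ?_⟩
      have h7' := (hv6 _ (by simp [mem_fv_ball, mem_fv_bex, Term.fv]; grind)).2 h7
      refine w6.all.2 fun w' hv => w'.imp.2 fun hl => ?_
      have h9' := w'.eq.1 ((hv.eq (by simpa [Term.fv]) (by simpa [Term.fv] using (Ne.symm hs2x))).2 h9)
      exact w'.bex_mono hT (Ne.symm hs2r) hrs (w'.le_congr rfl h9'.symm (w'.le_refl hT _))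
        (w'.imp.1 (w6.all.1 h7' w' hv) hl)
    refine (hv1 _ ?_).1 ((hv4 _ ?_).1 ((hv5 _ ?_).1 h8)) <;>
    · simp only [mem_fv_ex, mem_fv_ball, mem_fv_bex, Term.fv, Finset.mem_singleton]
      grind

theorem exists_NF (hT : Extends T PAK) {φ : Formula} (h : IsSigma1 φ) :
    ∀ F : Finset ℕ, ∃ r θ, NF T F φ r θ := by
  induction h with
  | @delta0 φ h =>
    intro F
    obtain ⟨r, hr⟩ := fresh (F ∪ φ.fv)
    simp only [Finset.mem_union, not_or] at hr
    refine ⟨r, φ, hr.1, h, fun y hy => .inr hy, fun w hw => w.ex_self hw, fun v => ?_⟩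
    have : ∀ n, φ.val (Function.update v r n) ↔ φ.val v := fun n =>
      Formula.val_congr fun y hy => Function.update_of_ne (by rintro rfl; exact hr.2 hy) _ _
    simp [this]
  | @and φ ψ _ _ ih1 ih2 =>
    intro F
    obtain ⟨r1, θ1, n1⟩ := ih1 (F ∪ φ.fv ∪ ψ.fv)
    obtain ⟨r2, θ2, n2⟩ := ih2 (F ∪ φ.fv ∪ ψ.fv ∪ {r1})
    obtain ⟨s, hs⟩ := fresh (F ∪ φ.fv ∪ ψ.fv ∪ {r1, r2})
    obtain ⟨s1, hs1⟩ := fresh (F ∪ φ.fv ∪ ψ.fv ∪ {r1, r2, s})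
    obtain ⟨s2, hs2⟩ := fresh (F ∪ φ.fv ∪ ψ.fv ∪ {r1, r2, s, s1})
    have hr1 := n1.fr
    have hr2 := n2.fr
    have hf1 := n1.fv
    have hf2 := n2.fv
    simp only [Finset.mem_union, not_or, Finset.mem_singleton, Finset.mem_insert] at hs hs1 hs2 hr1 hr2
    have e1 : s ∉ θ1.fv := by grind
    have e2 : s ∉ θ2.fv := by grind
    refine ⟨s, .and (Formula.bex r1 (.var s) θ1) (Formula.bex r2 (.var s) θ2), hs.1.1.1,
      .and (.bex (by simp [Term.fv]; grind) n1.d0) (.bex (by simp [Term.fv]; grind) n2.d0), ?_, ?_, ?_⟩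
    · simp only [Formula.fv, Finset.mem_union, mem_fv_bex]; grind
    · intro w hw
      have h1 := w.bound (s := s1) hT (by grind) (by grind) (n1.imp w (w.and.1 hw).1)
      have h2 := w.bound (s := s2) hT (by grind) (by grind) (n2.imp w (w.and.1 hw).2)
      obtain ⟨w1, hv1, h1⟩ := w.ex.1 h1
      obtain ⟨w2, hv2, h2⟩ := w1.ex.1 ((hv1 _ (by simp only [mem_fv_ex, mem_fv_bex]; grind)).2 h2)
      obtain ⟨w3, hv3, h3⟩ := w2.set_var s (t := .add (.var s1) (.var s2)) (by simp [Term.fv]; grind)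
      have h3 := w3.eq.1 h3
      have h1 := (hv3 _ (by simp only [mem_fv_bex]; grind)).2 ((hv2 _ (by simp only [mem_fv_bex]; grind)).2 h1)
      have h2 := (hv3 _ (by simp only [mem_fv_bex]; grind)).2 h2
      refine (hv1 _ ?_).1 ((hv2 _ ?_).1 (w2.ex.2 ⟨w3, hv3, w3.and.2 ⟨?_, ?_⟩⟩))
      · simp only [Formula.fv, Finset.mem_erase, Finset.mem_union, mem_fv_bex]; grind
      · simp only [Formula.fv, Finset.mem_erase, Finset.mem_union, mem_fv_bex]; grind
      · exact w3.bex_mono hT (by grind) (by grind) (w3.le_congr rfl h3.symm (w3.le_add_right hT _ _)) h1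
      · exact w3.bex_mono hT (by grind) (by grind) (w3.le_congr rfl h3.symm (w3.le_add_left hT _ _)) h2
    · intro v
      simp only [Formula.val, n1.val, n2.val]
      simp only [val_bex (show r1 ∉ (Term.var s).fv by simp [Term.fv]; grind),
        val_bex (show r2 ∉ (Term.var s).fv by simp [Term.fv]; grind), upd_fresh e1, upd_fresh e2,
        Term.val, Function.update_self]
      constructor
      · rintro ⟨⟨a, ha⟩, b, hb⟩
        exact ⟨a + b + 1, ⟨a, by omega, ha⟩, b, by omega, hb⟩
      · rintro ⟨n, ⟨a, _, ha⟩, b, _, hb⟩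
        exact ⟨⟨a, ha⟩, b, hb⟩
  | @or φ ψ _ _ ih1 ih2 =>
    intro F
    obtain ⟨r1, θ1, n1⟩ := ih1 (F ∪ φ.fv ∪ ψ.fv)
    obtain ⟨r2, θ2, n2⟩ := ih2 (F ∪ φ.fv ∪ ψ.fv ∪ {r1})
    obtain ⟨s, hs⟩ := fresh (F ∪ φ.fv ∪ ψ.fv ∪ {r1, r2})
    have hr1 := n1.fr
    have hr2 := n2.fr
    have hf1 := n1.fv
    have hf2 := n2.fv
    simp only [Finset.mem_union, not_or, Finset.mem_singleton, Finset.mem_insert] at hs hr1 hr2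
    have e1 : s ∉ θ1.fv := by grind
    have e2 : s ∉ θ2.fv := by grind
    refine ⟨s, .or (Formula.bex r1 (.var s) θ1) (Formula.bex r2 (.var s) θ2), hs.1.1.1,
      .or (.bex (by simp [Term.fv]; grind) n1.d0) (.bex (by simp [Term.fv]; grind) n2.d0), ?_, ?_, ?_⟩
    · simp only [Formula.fv, Finset.mem_union, mem_fv_bex]; grind
    · intro w hw
      rcases w.or.1 hw with hw | hw
      · obtain ⟨w', hv, h⟩ := w.ex.1 (w.bound (s := s) hT (by grind) (by grind) (n1.imp w hw))
        exact w.ex.2 ⟨w', hv, w'.or.2 (.inl h)⟩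
      · obtain ⟨w', hv, h⟩ := w.ex.1 (w.bound (s := s) hT (by grind) (by grind) (n2.imp w hw))
        exact w.ex.2 ⟨w', hv, w'.or.2 (.inr h)⟩
    · intro v
      simp only [Formula.val, n1.val, n2.val]
      simp only [val_bex (show r1 ∉ (Term.var s).fv by simp [Term.fv]; grind),
        val_bex (show r2 ∉ (Term.var s).fv by simp [Term.fv]; grind), upd_fresh e1, upd_fresh e2,
        Term.val, Function.update_self]
      constructor
      · rintro (⟨a, ha⟩ | ⟨b, hb⟩)
        · exact ⟨a + 1, .inl ⟨a, by omega, ha⟩⟩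
        · exact ⟨b + 1, .inr ⟨b, by omega, hb⟩⟩
      · rintro ⟨n, ⟨a, _, ha⟩ | ⟨b, _, hb⟩⟩
        · exact .inl ⟨a, ha⟩
        · exact .inr ⟨b, hb⟩
  | @ex x φ _ ih =>
    intro F
    obtain ⟨r, θ, n⟩ := ih (F ∪ φ.fv ∪ {x})
    obtain ⟨s, hs⟩ := fresh (F ∪ φ.fv ∪ {x, r})
    obtain ⟨s1, hs1⟩ := fresh (F ∪ φ.fv ∪ {x, r, s})
    have hr := n.fr
    have hf := n.fv
    simp only [Finset.mem_union, not_or, Finset.mem_singleton, Finset.mem_insert] at hs hs1 hr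
    have e1 : s ∉ θ.fv := by grind
    refine ⟨s, Formula.bex x (.var s) (Formula.bex r (.var s) θ), hs.1.1,
      .bex (by simp [Term.fv]; grind) (.bex (by simp [Term.fv]; grind) n.d0), ?_, ?_, ?_⟩
    · simp only [mem_fv_ex, mem_fv_bex]; grind
    · intro w hw
      obtain ⟨w1, hv1, h1⟩ := w.ex.1 hw
      obtain ⟨w2, hv2, h2⟩ := w1.ex.1 (w1.bound (s := s1) hT (by grind) (by grind) (n.imp w1 h1))
      obtain ⟨w3, hv3, h3⟩ := w2.set_var s (t := .add (.succ (.var x)) (.var s1)) (by simp [Term.fv]; grind)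
      have h3 := w3.eq.1 h3
      have h2 := (hv3 _ (by simp only [mem_fv_bex]; grind)).2 h2
      refine (hv1 _ ?_).1 ((hv2 _ ?_).1 (w2.ex.2 ⟨w3, hv3, w3.ex_self (w3.and.2 ⟨?_, ?_⟩)⟩))
      · simp only [mem_fv_ex, mem_fv_bex]; grind
      · simp only [mem_fv_ex, mem_fv_bex]; grind
      · exact w3.le_congr rfl h3.symm (w3.le_add_right hT _ _)
      · exact w3.bex_mono hT (by grind) (by grind) (w3.le_congr rfl h3.symm (w3.le_add_left hT _ _)) h2
    · intro v
      simp only [Formula.val, n.val]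
      have hc : ∀ m k j, θ.val (Function.update (Function.update (Function.update v s m) x k) r j) ↔
          θ.val (Function.update (Function.update v x k) r j) := by
        intro m k j
        refine Formula.val_congr fun y hy => ?_
        simp only [Function.update_apply]; grind
      simp only [val_bex (show x ∉ (Term.var s).fv by simp [Term.fv]; grind),
        val_bex (show r ∉ (Term.var s).fv by simp [Term.fv]; grind), hc,
        Term.val, Function.update_self, Function.update_of_ne (show s ≠ x by grind)]
      constructor
      · rintro ⟨a, b, h⟩
        exact ⟨a + b + 1, a, by omega, b, by omega, h⟩
      · rintro ⟨_, a, _, b, _, h⟩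
        exact ⟨a, b, h⟩
  | @ball x t φ hx _ ih =>
    intro F
    obtain ⟨r, θ, n⟩ := ih (F ∪ φ.fv ∪ t.fv ∪ {x})
    obtain ⟨s, hs⟩ := fresh (F ∪ φ.fv ∪ t.fv ∪ {x, r})
    obtain ⟨a, ha⟩ := fresh (F ∪ φ.fv ∪ t.fv ∪ θ.vars ∪ {x, r, s})
    have hr := n.fr
    have hf := n.fv
    simp only [Finset.mem_union, not_or, Finset.mem_singleton, Finset.mem_insert] at hs ha hr
    have e1 : s ∉ θ.fv := by grind
    refine ⟨s, Formula.ball x t (Formula.bex r (.var s) θ), hs.1.1.1,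
      .ball hx (.bex (by simp [Term.fv]; grind) n.d0), ?_, ?_, ?_⟩
    · simp only [mem_fv_ball, mem_fv_bex]; grind
    · intro w hw
      obtain ⟨w1, hv1, h1⟩ := w.set_var a (t := t) (by grind)
      have hw := (hv1 _ (by simp only [mem_fv_ball]; grind)).2 hw
      have h2 : w1 (Formula.ball x (.var a) (.ex r θ)) := by
        refine w1.all.2 fun w' hv => w'.imp.2 fun hl => ?_
        have h1' := w'.eq.1 ((hv.eq (by simp [Term.fv]; grind) hx).2 h1)
        exact n.imp w' (w'.imp.1 (w1.all.1 hw w' hv) (w'.le_congr rfl h1' hl))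
      have h3 := collect hT n.d0 (s := s) (by grind) (by grind) (by grind) e1 (by grind) (by grind)
        (by grind) (by grind) w1 h2
      obtain ⟨w2, hv2, h4⟩ := w1.ex.1 h3
      have h1 := (hv2.eq (by simp [Term.fv]; grind) (by grind)).2 h1
      have haf : a ∉ θ.fv := fun h => ha.1.2 (θ.fv_sub_vars h)
      refine (hv1 _ ?_).1 (w1.ex.2 ⟨w2, hv2, w2.all.2 fun w' hv => w'.imp.2 fun hl => ?_⟩)
      · simp only [mem_fv_ex, mem_fv_ball, mem_fv_bex]; grind
      · have h1' := w'.eq.1 ((hv.eq (by simp [Term.fv]; grind) hx).2 h1)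
        exact w'.imp.1 (w2.all.1 h4 w' hv) (w'.le_congr rfl h1'.symm hl)
    · intro v
      have hc : ∀ m k j, θ.val (Function.update (Function.update (Function.update v s m) x k) r j) ↔
          θ.val (Function.update (Function.update v x k) r j) := by
        intro m k j
        refine Formula.val_congr fun y hy => ?_
        simp only [Function.update_apply]; grind
      have ht : ∀ m, t.val (Function.update v s m) = t.val v := fun m =>
        Term.val_congr fun y hy => Function.update_of_ne (by grind) _ _
      simp only [val_ball hx, n.val, ht, 
        val_bex (show r ∉ (Term.var s).fv by simp [Term.fv]; grind), hc,
        Term.val, Function.update_self, Function.update_of_ne (show s ≠ x by grind)]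
      constructor
      · intro h
        choose f hf using h
        refine ⟨∑ k ∈ (Finset.range (t.val v)).attach, (f k.1 (Finset.mem_range.1 k.2) + 1), fun k hk => ⟨f k hk, ?_, hf k hk⟩⟩
        exact Finset.single_le_sum (f := fun k : {x // x ∈ Finset.range (t.val v)} =>
          f k.1 (Finset.mem_range.1 k.2) + 1) (fun _ _ => Nat.zero_le _)
          (Finset.mem_attach _ ⟨k, Finset.mem_range.2 hk⟩)
      · rintro ⟨m, h⟩ k hk
        obtain ⟨j, _, hj⟩ := h k hk
        exact ⟨j, hj⟩

end ModalArith

namespace ModalArith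

/-! ## Partial recursive functions are Σ₁-definable -/

/-- Σ₁-definable predicates of valuations. -/
def Sg (R : (ℕ → ℕ) → Prop) : Prop := ∃ φ, IsSigma1 φ ∧ ∀ v, φ.val v ↔ R v

/-- Σ₁-definable predicates on environments. -/
def DD (R : (ℕ → ℕ) → Prop) : Prop :=
  ∀ e : ℕ → ℕ, (∃ B, ∀ k, e k ≤ B) → Sg fun v => R (v ∘ e)

/-- Environment extension. -/
def cns (n : ℕ) (a : ℕ → ℕ) : ℕ → ℕ
  | 0 => n
  | k + 1 => a k

theorem Sg.congr {R R' : (ℕ → ℕ) → Prop} (h : ∀ v, R v ↔ R' v) (hR : Sg R) : Sg R' := by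
  obtain ⟨φ, h1, h2⟩ := hR
  exact ⟨φ, h1, fun v => (h2 v).trans (h v)⟩

theorem DD.congr {R R' : (ℕ → ℕ) → Prop} (hR : DD R) (h : ∀ v, R v ↔ R' v) : DD R' :=
  fun e he => (hR e he).congr fun v => h _

theorem DD.and {R R' : (ℕ → ℕ) → Prop} (h : DD R) (h' : DD R') : DD fun a => R a ∧ R' a := by
  intro e he
  obtain ⟨φ, h1, h2⟩ := h e he
  obtain ⟨ψ, h3, h4⟩ := h' e he
  exact ⟨φ.and ψ, h1.and h3, fun v => and_congr (h2 v) (h4 v)⟩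

theorem DD.or {R R' : (ℕ → ℕ) → Prop} (h : DD R) (h' : DD R') : DD fun a => R a ∨ R' a := by
  intro e he
  obtain ⟨φ, h1, h2⟩ := h e he
  obtain ⟨ψ, h3, h4⟩ := h' e he
  exact ⟨φ.or ψ, h1.or h3, fun v => or_congr (h2 v) (h4 v)⟩

theorem DD.sub {R : (ℕ → ℕ) → Prop} (h : DD R) (l : List ℕ) :
    DD fun a => R fun k => a (l.getD k 0) := by
  rintro e ⟨B, hB⟩
  exact h (fun k => e (l.getD k 0)) ⟨B, fun k => hB _⟩

theorem upd_cns (v e : ℕ → ℕ) (B : ℕ) (hB : ∀ k, e k ≤ B) (n : ℕ) :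
    Function.update v (B + 1) n ∘ cns (B + 1) e = cns n (v ∘ e) := by
  funext k
  cases k with
  | zero => simp [cns]
  | succ k =>
    have := hB k
    simp only [cns, Function.comp]
    rw [Function.update_of_ne (by omega)]

theorem cns_bdd {e : ℕ → ℕ} {B : ℕ} (hB : ∀ k, e k ≤ B) : ∃ B', ∀ k, cns (B + 1) e k ≤ B' := by
  refine ⟨B + 1, fun k => ?_⟩
  cases k with
  | zero => simp [cns]
  | succ k => have := hB k; simp only [cns]; omega

theorem DD.ex {R : (ℕ → ℕ) → Prop} (h : DD R) : DD fun a => ∃ n, R (cns n a) := by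
  rintro e ⟨B, hB⟩
  obtain ⟨φ, h1, h2⟩ := h _ (cns_bdd hB)
  refine ⟨.ex (B + 1) φ, h1.ex, fun v => exists_congr fun n => ?_⟩
  exact (h2 _).trans (by simp only [upd_cns v e B hB])

theorem DD.ball {R : (ℕ → ℕ) → Prop} (i : ℕ) (h : DD R) : DD fun a => ∀ n < a i, R (cns n a) := by
  rintro e ⟨B, hB⟩
  obtain ⟨φ, h1, h2⟩ := h _ (cns_bdd hB)
  have hx : B + 1 ∉ (Term.var (e i)).fv := by have := hB i; simp [Term.fv]; omega
  refine ⟨Formula.ball (B + 1) (.var (e i)) φ, h1.ball hx, fun v => ?_⟩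
  rw [val_ball hx]
  refine forall₂_congr fun n _ => ?_
  exact (h2 _).trans (by simp only [upd_cns v e B hB])

theorem Term.val_ren (t : Term) (e v : ℕ → ℕ) :
    (t.substAll fun x => .var (e x)).val v = t.val (v ∘ e) := by
  induction t <;> simp_all [Term.substAll, Term.val]

theorem DD.eq (t u : Term) : DD fun a => t.val a = u.val a := fun e _ =>
  ⟨.eq (t.substAll fun x => .var (e x)) (u.substAll fun x => .var (e x)), .delta0 (.eq _ _), fun v => by
    simp only [Formula.val, Term.val_ren]⟩

theorem DD.le (t u : Term) : DD fun a => t.val a ≤ u.val a := fun e _ =>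
  ⟨.le (t.substAll fun x => .var (e x)) (u.substAll fun x => .var (e x)), .delta0 (.le _ _), fun v => by
    simp only [Formula.val, Term.val_ren]⟩

local notation "v0" => Term.var 0
local notation "v1" => Term.var 1
local notation "v2" => Term.var 2
local notation "v3" => Term.var 3
local notation "v4" => Term.var 4
local notation "v5" => Term.var 5

theorem DD.pair : DD fun a => Nat.pair (a 0) (a 1) = a 2 := by
  refine (((DD.le (.succ v0) v1).and (DD.eq (.add (.mul v1 v1) v0) v2)).or
    ((DD.le v1 v0).and (DD.eq (.add (.add (.mul v0 v0) v0) v1) v2))).congr fun a => ?_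
  simp only [Term.val, Nat.pair]
  split_ifs with h <;> constructor <;> intro h' <;> omega

theorem DD.beta : DD fun a => Nat.beta (a 0) (a 1) = a 2 := by
  -- environment: d, q, p, s, i, y
  have h := ((DD.pair.sub [2, 1, 3]).and
    ((DD.eq (.add (.mul v0 (.succ (.mul (.succ v4) v1))) v5) v2).and
     (DD.le (.succ v5) (.succ (.mul (.succ v4) v1))))).ex.ex.ex
  refine h.congr fun a => ?_
  simp only [List.getD_cons_zero, List.getD_cons_succ, cns, Term.val]
  constructor
  · rintro ⟨p, q, d, h1, h2, h3⟩
    change Nat.pair p q = a 0 at h1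
    change d * ((a 1 + 1) * q + 1) + a 2 = p at h2
    change a 2 + 1 ≤ (a 1 + 1) * q + 1 at h3
    rw [← h1, Nat.beta, Nat.unpair_pair]
    rw [← h2, Nat.add_comm, Nat.add_mul_mod_self_right, Nat.mod_eq_of_lt (by omega)]
  · intro h
    refine ⟨(a 0).unpair.1, (a 0).unpair.2, (a 0).unpair.1 / ((a 1 + 1) * (a 0).unpair.2 + 1),
      Nat.pair_unpair _, ?_, ?_⟩
    · change _ * ((a 1 + 1) * _ + 1) + a 2 = _
      rw [← h, Nat.beta]
      exact Nat.div_add_mod' _ _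
    · change a 2 + 1 ≤ (a 1 + 1) * _ + 1
      rw [← h, Nat.beta]
      exact Nat.mod_lt _ (Nat.succ_pos _)

theorem DD.partrec {f : ℕ →. ℕ} (hf : Nat.Partrec f) : DD fun a => a 1 ∈ f (a 0) := by
  induction hf with
  | zero => 
    refine (DD.eq v1 .zero).congr fun a => ?_
    simp only [Term.val]
    exact Part.mem_some_iff.symm
  | succ =>
    refine (DD.eq v1 (.succ v0)).congr fun a => ?_
    simp only [Term.val]
    exact Part.mem_some_iff.symm
  | left =>
    refine (DD.pair.sub [2, 0, 1]).ex.congr fun a => ?_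
    change (∃ n, Nat.pair (a 1) n = a 0) ↔ a 1 ∈ Part.some _
    rw [Part.mem_some_iff]
    constructor
    · rintro ⟨n, h⟩; rw [← h]; simp
    · intro h; exact ⟨(a 0).unpair.2, by rw [h]; simp⟩
  | right =>
    refine (DD.pair.sub [0, 2, 1]).ex.congr fun a => ?_
    change (∃ n, Nat.pair n (a 1) = a 0) ↔ a 1 ∈ Part.some _
    rw [Part.mem_some_iff]
    constructor
    · rintro ⟨n, h⟩; rw [← h]; simp
    · intro h; exact ⟨(a 0).unpair.1, by rw [h]; simp⟩
  | @pair f g _ _ ihf ihg =>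
    -- env: y x a c
    refine ((ihf.sub [2, 1]).and ((ihg.sub [2, 0]).and (DD.pair.sub [1, 0, 3]))).ex.ex.congr fun a => ?_
    change (∃ x y, x ∈ f (a 0) ∧ y ∈ g (a 0) ∧ Nat.pair x y = a 1) ↔ a 1 ∈ _
    simp [Seq.seq]
  | @comp f g _ _ ihf ihg =>
    refine ((ihg.sub [1, 0]).and (ihf.sub [0, 2])).ex.congr fun a => ?_
    change (∃ x, x ∈ g (a 0) ∧ a 1 ∈ f x) ↔ a 1 ∈ _
    exact Part.mem_bind_iff.symm
  | @prec f g _ _ ihf ihg =>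
    -- env for the step: r q b' b i | s n x a y
    have step : DD fun a => ∀ i < a 1, ∃ b b' q r, Nat.beta (a 0) i = b ∧ Nat.beta (a 0) (i + 1) = b' ∧
        Nat.pair i b = q ∧ Nat.pair (a 2) q = r ∧ b' ∈ g r := by
      -- k = i + 1 : extra variable at 0
      have h := ((DD.beta.sub [6, 5, 4]).and ((DD.eq v0 (.succ v5)).and ((DD.beta.sub [6, 0, 3]).and
        ((DD.pair.sub [5, 4, 2]).and ((DD.pair.sub [8, 2, 1]).and (ihg.sub [1, 3])))))).ex.ex.ex.ex.ex
      refine (h.ball 1).congr fun a => ?_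
      refine forall₂_congr fun i _ => ?_
      change (∃ b b' q r k, Nat.beta (a 0) i = b ∧ k = i + 1 ∧ Nat.beta (a 0) k = b' ∧
        Nat.pair i b = q ∧ Nat.pair (a 2) q = r ∧ b' ∈ g r) ↔ _
      simp
    -- env: b0 z s n x a y
    have h := ((DD.pair.sub [4, 3, 5]).and ((DD.eq v1 .zero).and ((DD.beta.sub [2, 1, 0]).and
      ((ihf.sub [4, 0]).and ((step.sub [2, 3, 4]).and (DD.beta.sub [2, 3, 6])))))).ex.ex.ex.ex.ex
    refine h.congr fun a => ?_
    change (∃ x n s z b0, Nat.pair x n = a 0 ∧ z = 0 ∧ Nat.beta s z = b0 ∧ b0 ∈ f x ∧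
      (∀ i < n, ∃ b b' q r, Nat.beta s i = b ∧ Nat.beta s (i + 1) = b' ∧
        Nat.pair i b = q ∧ Nat.pair x q = r ∧ b' ∈ g r) ∧ Nat.beta s n = a 1) ↔ _
    simp only [exists_eq_left, exists_eq_left', exists_and_left, Nat.unpaired]
    have key : ∀ x n y, y ∈ Nat.rec (motive := fun _ => Part ℕ) (f x) (fun y IH => IH.bind fun i => g (Nat.pair x (Nat.pair y i))) n ↔
        ∃ c : ℕ → ℕ, c 0 ∈ f x ∧ (∀ i < n, c (i + 1) ∈ g (Nat.pair x (Nat.pair i (c i)))) ∧ c n = y := by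
      intro x n
      induction n with
      | zero =>
        intro y
        constructor
        · intro h; exact ⟨fun _ => y, h, by simp, rfl⟩
        · rintro ⟨c, h, _, rfl⟩; exact h
      | succ n ih =>
        intro y
        change y ∈ (Nat.rec (motive := fun _ => Part ℕ) (f x) (fun y IH => IH.bind fun i => g (Nat.pair x (Nat.pair y i))) n : Part ℕ).bind _ ↔ _
        rw [Part.mem_bind_iff]
        constructor
        · rintro ⟨z, hz, hy⟩
          obtain ⟨c, h0, hs, rfl⟩ := (ih z).1 hz
          refine ⟨fun k => if k ≤ n then c k else y, by simpa using h0, fun i hi => ?_, by simp⟩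
          by_cases hin : i < n
          · simpa [show i + 1 ≤ n by omega, show i ≤ n by omega] using hs i hin
          · obtain rfl : i = n := by omega
            simpa using hy
        · rintro ⟨c, h0, hs, rfl⟩
          exact ⟨c n, (ih _).2 ⟨c, h0, fun i hi => hs i (by omega), rfl⟩, hs n (by omega)⟩
    constructor
    · rintro ⟨x, n, hxn, s, h0, hs, hy⟩
      rw [← hxn, Nat.unpair_pair]
      refine (key x n (a 1)).2 ⟨Nat.beta s, h0, fun i hi => ?_, hy⟩
      exact hs i hi
    · intro h
      obtain ⟨c, h0, hs, hy⟩ := (key (a 0).unpair.1 (a 0).unpair.2 (a 1)).1 h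
      have hbeta := Nat.beta_unbeta_coe (List.ofFn fun k : Fin ((a 0).unpair.2 + 1) => c k)
      have hb : ∀ k ≤ (a 0).unpair.2, Nat.beta (Nat.unbeta (List.ofFn fun k : Fin ((a 0).unpair.2 + 1) => c k)) k = c k := by
        intro k hk
        have := hbeta ⟨k, by simp; omega⟩
        exact this.trans (by rw [Fin.getElem_fin, List.getElem_ofFn])
      refine ⟨_, _, Nat.pair_unpair _, Nat.unbeta (List.ofFn fun k : Fin ((a 0).unpair.2 + 1) => c k), ?_, ?_, ?_⟩
      · rwa [hb 0 (Nat.zero_le _)]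
      · intro i hi
        rw [hb i (by omega), hb (i+1) (by omega)]; exact hs i hi
      · rw [hb _ le_rfl, hy]
  | @rfind f _ ihf =>
    -- env: y r m | a n 
    have h1 := ((DD.pair.sub [3, 2, 1]).and ((ihf.sub [1, 0]).and (DD.le (.succ .zero) v0))).ex.ex.ball 1
    -- env: z r a n
    have h2 := ((DD.pair.sub [2, 3, 1]).and ((DD.eq v0 .zero).and (ihf.sub [1, 0]))).ex.ex
    refine (h2.and h1).congr fun a => ?_
    change ((∃ r z, Nat.pair (a 0) (a 1) = r ∧ z = 0 ∧ z ∈ f r) ∧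
      (∀ m < a 1, ∃ r y, Nat.pair (a 0) m = r ∧ y ∈ f r ∧ 0 + 1 ≤ y)) ↔ _
    refine Iff.trans ?_ Nat.mem_rfind.symm
    simp only [exists_eq_left, exists_eq_left', exists_and_left]
    refine and_congr ?_ ?_
    · simp
    · refine forall_congr' fun m => forall_congr' fun hm => ?_
      simp [Nat.pos_iff_ne_zero, Nat.one_le_iff_ne_zero]

/-- Definability with one free variable. -/
theorem DD.close {R : ℕ → Prop} (h0 : DD fun a => R (a 0)) :
    ∃ φ, IsSigma1 φ ∧ φ.fv ⊆ {0} ∧ ∀ v, φ.val v ↔ R (v 0) := by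
  obtain ⟨φ, h1, h2⟩ := h0 (fun _ => 0) ⟨0, fun _ => le_rfl⟩
  have : ∀ F : Finset ℕ, ∃ ψ, IsSigma1 ψ ∧ (∀ y ∈ ψ.fv, y ∈ φ.fv ∧ (y ∉ F ∨ y = 0)) ∧
      ∀ v, ψ.val v ↔ R (v 0) := by
    intro F
    induction F using Finset.induction_on with
    | empty => exact ⟨φ, h1, by simp, h2⟩
    | @insert z F hz ih =>
      obtain ⟨ψ, h3, h4, h5⟩ := ih
      by_cases hz0 : z = 0
      · refine ⟨ψ, h3, fun y hy => ?_, h5⟩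
        have := h4 y hy
        simp only [Finset.mem_insert, not_or]; grind
      · refine ⟨.ex z ψ, h3.ex, fun y hy => ?_, fun v => ?_⟩
        · rw [mem_fv_ex] at hy
          have := h4 y (by tauto)
          simp only [Finset.mem_insert, not_or]; grind
        · simp [Formula.val, h5, Function.update_of_ne (Ne.symm hz0)]
  obtain ⟨ψ, h3, h4, h5⟩ := this φ.fv
  refine ⟨ψ, h3, fun y hy => ?_, h5⟩
  have := h4 y hy
  simp only [Finset.mem_singleton]; tauto

end ModalArith

namespace ModalArith

/-! ## Inductively generated sets are Σ₁-definable -/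

theorem val_numeral (c : ℕ) (v : ℕ → ℕ) : (Term.numeral c).val v = c := by
  induction c with
  | zero => rfl
  | succ c ih => simp [Term.numeral, Term.val, ih]

/-- Patterns with six metavariables. -/
inductive Pat : Type
  | mv : Fin 6 → Pat
  | const : ℕ → Pat
  | pair : Pat → Pat → Pat

/-- Evaluation of a pattern. -/
def Pat.eval (m : Fin 6 → ℕ) : Pat → ℕ
  | .mv i => m i
  | .const c => c
  | .pair p q => Nat.pair (p.eval m) (q.eval m)

/-- Rules with two premises and an inequality side condition. -/
structure Rule where
  ne1 : Pat
  ne2 : Pat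
  p : Pat
  q : Pat
  c : Pat

/-- `z` follows from `p` and `q` by the rule. -/
def Rule.holds (r : Rule) (z p q : ℕ) : Prop :=
  ∃ m, r.ne1.eval m ≠ r.ne2.eval m ∧ r.p.eval m = p ∧ r.q.eval m = q ∧ r.c.eval m = z

/-- The set generated by a set of rules. -/
inductive Der (Ax : ℕ → Prop) (L : List Rule) : ℕ → Prop
  | ax {z : ℕ} : Ax z → Der Ax L z
  | rule {z p q : ℕ} : (∃ r ∈ L, r.holds z p q) → Der Ax L p → Der Ax L q → Der Ax L z

theorem DD.pat (p : Pat) : ∀ (l : Fin 6 → ℕ) (j : ℕ),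
    DD fun a => p.eval (fun i => a (l i)) = a j := by
  induction p with
  | mv i => intro l j; exact DD.eq (.var (l i)) (.var j)
  | const c =>
    intro l j
    exact (DD.eq (Term.numeral c) (.var j)).congr fun a => by simp [val_numeral, Pat.eval, Term.val]
  | pair p q ihp ihq =>
    intro l j
    have h := ((ihp (fun i => l i + 2) 1).and ((ihq (fun i => l i + 2) 0).and
      (DD.pair.sub [1, 0, j + 2]))).ex.ex
    refine h.congr fun a => ?_
    change (∃ x y, p.eval (fun i => a (l i)) = x ∧ q.eval (fun i => a (l i)) = y ∧
      Nat.pair x y = a j) ↔ _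
    simp [Pat.eval]

theorem DD.false : DD fun _ => False :=
  (DD.eq .zero (.succ .zero)).congr fun a => by simp [Term.val]

theorem DD.ne (i j : ℕ) : DD fun a => a i ≠ a j :=
  ((DD.le (.succ (.var i)) (.var j)).or (DD.le (.succ (.var j)) (.var i))).congr fun a => by
    simp only [Term.val]; omega

theorem DD.holds (r : Rule) : DD fun a => r.holds (a 0) (a 1) (a 2) := by
  have h := ((((DD.pat r.ne1 (fun i => i + 2) 1).and ((DD.pat r.ne2 (fun i => i + 2) 0).and
    (DD.ne 1 0))).ex.ex).and ((DD.pat r.p (fun i => i) 7).and ((DD.pat r.q (fun i => i) 8).and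
      (DD.pat r.c (fun i => i) 6)))).ex.ex.ex.ex.ex.ex
  refine h.congr fun a => ?_
  have key : ∀ m : Fin 6 → ℕ, (fun i : Fin 6 =>
      cns (m 0) (cns (m 1) (cns (m 2) (cns (m 3) (cns (m 4) (cns (m 5) a))))) i) = m := by
    intro m; funext i; fin_cases i <;> rfl
  change (∃ m5 m4 m3 m2 m1 m0, (∃ x y,
    r.ne1.eval (fun i : Fin 6 => cns m0 (cns m1 (cns m2 (cns m3 (cns m4 (cns m5 a))))) i) = x ∧
    r.ne2.eval (fun i : Fin 6 => cns m0 (cns m1 (cns m2 (cns m3 (cns m4 (cns m5 a))))) i) = y ∧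
    x ≠ y) ∧
    r.p.eval (fun i : Fin 6 => cns m0 (cns m1 (cns m2 (cns m3 (cns m4 (cns m5 a))))) i) = a 1 ∧
    r.q.eval (fun i : Fin 6 => cns m0 (cns m1 (cns m2 (cns m3 (cns m4 (cns m5 a))))) i) = a 2 ∧
    r.c.eval (fun i : Fin 6 => cns m0 (cns m1 (cns m2 (cns m3 (cns m4 (cns m5 a))))) i) = a 0) ↔ _
  constructor
  · rintro ⟨m5, m4, m3, m2, m1, m0, ⟨x, y, h1, h2, h3⟩, h⟩
    exact ⟨_, by rw [h1, h2]; exact h3, h⟩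
  · rintro ⟨m, h1, h⟩
    refine ⟨m 5, m 4, m 3, m 2, m 1, m 0, ?_⟩
    rw [key]
    exact ⟨⟨_, _, rfl, rfl, h1⟩, h⟩

theorem DD.list (L : List Rule) : DD fun a => ∃ r ∈ L, r.holds (a 0) (a 1) (a 2) := by
  induction L with
  | nil => exact DD.false.congr fun a => by simp
  | cons r L ih => exact ((DD.holds r).or ih).congr fun a => by simp

/-- Correct step in a derivation sequence. -/
def StepF (Ax : ℕ → Prop) (L : List Rule) (c : ℕ → ℕ) (i : ℕ) : Prop :=
  Ax (c i) ∨ ∃ j k, j < i ∧ k < i ∧ ∃ r ∈ L, r.holds (c i) (c j) (c k)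

theorem der_iff_seq (Ax : ℕ → Prop) (L : List Rule) (y : ℕ) :
    Der Ax L y ↔ ∃ (c : ℕ → ℕ) (n : ℕ), (∀ i < n, StepF Ax L c i) ∧ ∃ j < n, c j = y := by
  constructor
  · intro h
    induction h with
    | @ax z h => exact ⟨fun _ => z, 1, fun i _ => Or.inl h, 0, by omega, rfl⟩
    | @rule z p q hr _ _ ih1 ih2 =>
      obtain ⟨c, n, h1, j, hj, rfl⟩ := ih1
      obtain ⟨d, m, h2, k, hk, rfl⟩ := ih2
      refine ⟨fun i => if i < n then c i else if i < n + m then d (i - n) else z, n + m + 1,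
        fun i hi => ?_, n + m, by omega, by simp⟩
      unfold StepF
      by_cases hin : i < n
      · rcases h1 i hin with h | ⟨j', k', hj', hk', h⟩
        · left; simpa [hin] using h
        · right
          refine ⟨j', k', hj', hk', ?_⟩
          simpa [hin, show j' < n by omega, show k' < n by omega] using h
      · by_cases him : i < n + m
        · rcases h2 (i - n) (by omega) with h | ⟨j', k', hj', hk', h⟩
          · left; simpa [hin, him] using h
          · right
            refine ⟨j' + n, k' + n, by omega, by omega, ?_⟩
            simpa [hin, him, show j' + n < n + m by omega, show k' + n < n + m by omega] using h
        · right
          refine ⟨j, k + n, by omega, by omega, ?_⟩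
          simpa [hin, him, hj, show k + n < n + m by omega] using hr
  · rintro ⟨c, n, h, j, hj, rfl⟩
    induction j using Nat.strong_induction_on with
    | _ j ih =>
      rcases h j hj with h' | ⟨j', k', hj', hk', h'⟩
      · exact .ax h'
      · exact .rule h' (ih j' hj' (by omega)) (ih k' hk' (by omega))

theorem DD.der {Ax : ℕ → Prop} (hA : DD fun a => Ax (a 0)) (L : List Rule) :
    DD fun a => Der Ax L (a 0) := by
  -- environment for the rule part: k j q p z i s
  have h1 := ((DD.le (.succ (.var 1)) (.var 5)).and ((DD.le (.succ (.var 0)) (.var 5)).and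
    ((DD.beta.sub [6, 1, 3]).and ((DD.beta.sub [6, 0, 2]).and ((DD.list L).sub [4, 3, 2]))))).ex.ex.ex.ex
  have h2 : DD fun a => StepF Ax L (Nat.beta (a 1)) (a 0) := by
    refine ((DD.beta.sub [2, 1, 0]).and ((hA.sub [0]).or (h1.sub [0, 1, 2]))).ex.congr fun a => ?_
    change (∃ z, Nat.beta (a 1) (a 0) = z ∧ (Ax z ∨ ∃ p q j k, j + 1 ≤ a 0 ∧ k + 1 ≤ a 0 ∧
      Nat.beta (a 1) j = p ∧ Nat.beta (a 1) k = q ∧ ∃ r ∈ L, r.holds z p q)) ↔ _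
    constructor
    · rintro ⟨_, rfl, h | ⟨_, _, j, k, hj, hk, rfl, rfl, h⟩⟩
      · exact Or.inl h
      · exact Or.inr ⟨j, k, hj, hk, h⟩
    · rintro (h | ⟨j, k, hj, hk, h⟩)
      · exact ⟨_, rfl, Or.inl h⟩
      · exact ⟨_, rfl, Or.inr ⟨_, _, j, k, hj, hk, rfl, rfl, h⟩⟩
  -- environment: s n j y
  have h3 := (((h2.sub [0, 1]).ball 1).and ((DD.le (.succ (.var 2)) (.var 1)).and
    (DD.beta.sub [0, 2, 3]))).ex.ex.ex
  refine h3.congr fun a => ?_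
  change (∃ j n s, (∀ i < n, StepF Ax L (Nat.beta s) i) ∧ j + 1 ≤ n ∧ Nat.beta s j = a 0) ↔ _
  rw [der_iff_seq]
  constructor
  · rintro ⟨j, n, s, h, hj, h'⟩
    exact ⟨_, n, h, j, hj, h'⟩
  · rintro ⟨c, n, h, j, hj, h'⟩
    have hb : ∀ k < n, Nat.beta (Nat.unbeta (List.ofFn fun k : Fin n => c k)) k = c k := by
      intro k hk
      have := Nat.beta_unbeta_coe (List.ofFn fun k : Fin n => c k) ⟨k, by simpa using hk⟩
      exact this.trans (by rw [Fin.getElem_fin, List.getElem_ofFn])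
    refine ⟨j, n, Nat.unbeta (List.ofFn fun k : Fin n => c k), fun i hi => ?_, hj, (hb j hj).trans h'⟩
    rcases h i hi with h | ⟨j', k', hj', hk', h⟩
    · left; rwa [hb i hi]
    · right
      refine ⟨j', k', hj', hk', ?_⟩
      rwa [hb i hi, hb j' (by omega), hb k' (by omega)]

end ModalArith

namespace ModalArith

/-! ## Theorems of an r.e. theory -/

theorem unpair_snd_lt {n k : ℕ} (h : n.unpair.1 = k + 1) : n.unpair.2 < n := by
  have := Nat.add_le_pair n.unpair.1 n.unpair.2
  rw [Nat.pair_unpair] at this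
  omega

theorem unpair_fst_le (n : ℕ) : n.unpair.1 ≤ n := Nat.unpair_left_le n

theorem unpair_snd_le (n : ℕ) : n.unpair.2 ≤ n := Nat.unpair_right_le n

/-- Total decoding of terms. -/
def dT (n : ℕ) : Term :=
  match h : n.unpair.1 with
  | 0 => .var n.unpair.2
  | 1 => .zero
  | 2 => .succ (dT n.unpair.2)
  | 3 => .add (dT n.unpair.2.unpair.1) (dT n.unpair.2.unpair.2)
  | 4 => .mul (dT n.unpair.2.unpair.1) (dT n.unpair.2.unpair.2)
  | _ + 5 => .zero
termination_by n
decreasing_by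
  all_goals
    have h1 := unpair_snd_lt h
    have h2 := unpair_fst_le n.unpair.2
    have h3 := unpair_snd_le n.unpair.2
    omega

/-- Total decoding of formulas. -/
def dF (n : ℕ) : Formula :=
  match h : n.unpair.1 with
  | 0 => .falsum
  | 1 => .eq (dT n.unpair.2.unpair.1) (dT n.unpair.2.unpair.2)
  | 2 => .le (dT n.unpair.2.unpair.1) (dT n.unpair.2.unpair.2)
  | 3 => .and (dF n.unpair.2.unpair.1) (dF n.unpair.2.unpair.2)
  | 4 => .or (dF n.unpair.2.unpair.1) (dF n.unpair.2.unpair.2)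
  | 5 => .imp (dF n.unpair.2.unpair.1) (dF n.unpair.2.unpair.2)
  | 6 => .neg (dF n.unpair.2)
  | 7 => .all n.unpair.2.unpair.1 (dF n.unpair.2.unpair.2)
  | 8 => .ex n.unpair.2.unpair.1 (dF n.unpair.2.unpair.2)
  | 9 => .box (dF n.unpair.2)
  | _ + 10 => .falsum
termination_by n
decreasing_by
  all_goals
    have h1 := unpair_snd_lt h
    have h2 := unpair_fst_le n.unpair.2
    have h3 := unpair_snd_le n.unpair.2
    omega

section decode
variable (a b : ℕ)

@[simp] theorem dT_var : dT (Nat.pair 0 a) = .var a := by rw [dT]; split <;> simp_all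
@[simp] theorem dT_zero : dT (Nat.pair 1 a) = .zero := by rw [dT]; split <;> simp_all
@[simp] theorem dT_succ : dT (Nat.pair 2 a) = .succ (dT a) := by
  rw [dT]; split <;> simp_all
@[simp] theorem dT_add : dT (Nat.pair 3 (Nat.pair a b)) = .add (dT a) (dT b) := by
  rw [dT]; split <;> simp_all
@[simp] theorem dT_mul : dT (Nat.pair 4 (Nat.pair a b)) = .mul (dT a) (dT b) := by
  rw [dT]; split <;> simp_all
@[simp] theorem dF_falsum : dF (Nat.pair 0 a) = .falsum := by rw [dF]; split <;> simp_all
@[simp] theorem dF_eq : dF (Nat.pair 1 (Nat.pair a b)) = .eq (dT a) (dT b) := by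
  rw [dF]; split <;> simp_all
@[simp] theorem dF_le : dF (Nat.pair 2 (Nat.pair a b)) = .le (dT a) (dT b) := by
  rw [dF]; split <;> simp_all
@[simp] theorem dF_and : dF (Nat.pair 3 (Nat.pair a b)) = .and (dF a) (dF b) := by
  rw [dF]; split <;> simp_all
@[simp] theorem dF_or : dF (Nat.pair 4 (Nat.pair a b)) = .or (dF a) (dF b) := by
  rw [dF]; split <;> simp_all
@[simp] theorem dF_imp : dF (Nat.pair 5 (Nat.pair a b)) = .imp (dF a) (dF b) := by
  rw [dF]; split <;> simp_all
@[simp] theorem dF_neg : dF (Nat.pair 6 a) = .neg (dF a) := by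
  rw [dF]; split <;> simp_all
@[simp] theorem dF_all : dF (Nat.pair 7 (Nat.pair a b)) = .all a (dF b) := by
  rw [dF]; split <;> simp_all
@[simp] theorem dF_ex : dF (Nat.pair 8 (Nat.pair a b)) = .ex a (dF b) := by
  rw [dF]; split <;> simp_all
@[simp] theorem dF_box : dF (Nat.pair 9 a) = .box (dF a) := by
  rw [dF]; split <;> simp_all

end decode

@[simp] theorem dT_code (t : Term) : dT t.code = t := by
  induction t <;> simp_all [Term.code]

@[simp] theorem dF_code (φ : Formula) : dF φ.code = φ := by
  induction φ <;> simp_all [Formula.code]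

/-- Meaning of a judgement. -/
def Mean (T : Set Formula) (n : ℕ) : Prop :=
  match n.unpair.1 with
  | 0 => True
  | 1 => n.unpair.2.unpair.1 ∉ (dT n.unpair.2.unpair.2).fv
  | 2 => n.unpair.2.unpair.1 ∉ (dF n.unpair.2.unpair.2).fv
  | 3 => dT n.unpair.2.unpair.2.unpair.2.unpair.2 = Term.subst n.unpair.2.unpair.1
      (dT n.unpair.2.unpair.2.unpair.1) (dT n.unpair.2.unpair.2.unpair.2.unpair.1)
  | 4 => (dF n.unpair.2.unpair.2.unpair.2.unpair.1).freeFor (dT n.unpair.2.unpair.2.unpair.1)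
      n.unpair.2.unpair.1 ∧ dF n.unpair.2.unpair.2.unpair.2.unpair.2 =
      Formula.subst n.unpair.2.unpair.1
      (dT n.unpair.2.unpair.2.unpair.1) (dF n.unpair.2.unpair.2.unpair.2.unpair.1)
  | 5 => Provable T (dF n.unpair.2)
  | _ => True

section mean
variable (T : Set Formula) (a b c d : ℕ)

theorem mean0 : Mean T 0 := by simp [Mean]
@[simp] theorem mean1 : Mean T (Nat.pair 1 (Nat.pair a b)) ↔ a ∉ (dT b).fv := by simp [Mean]
@[simp] theorem mean2 : Mean T (Nat.pair 2 (Nat.pair a b)) ↔ a ∉ (dF b).fv := by simp [Mean]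
@[simp] theorem mean3 : Mean T (Nat.pair 3 (Nat.pair a (Nat.pair b (Nat.pair c d)))) ↔
    dT d = Term.subst a (dT b) (dT c) := by simp [Mean]
@[simp] theorem mean4 : Mean T (Nat.pair 4 (Nat.pair a (Nat.pair b (Nat.pair c d)))) ↔
    (dF c).freeFor (dT b) a ∧ dF d = (dF c).subst a (dT b) := by simp [Mean]
@[simp] theorem mean5 : Mean T (Nat.pair 5 a) ↔ Provable T (dF a) := by simp [Mean]

end mean

/-- Pattern abbreviations. -/
def pc (k : ℕ) (p : Pat) : Pat := .pair (.const k) p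
def pc2 (k : ℕ) (p q : Pat) : Pat := pc k (.pair p q)
def pImp (p q : Pat) : Pat := pc2 5 p q
def pEq (p q : Pat) : Pat := pc2 1 p q
def jNT (x t : Pat) : Pat := pc2 1 x t
def jNF (x t : Pat) : Pat := pc2 2 x t
def jST (x s t u : Pat) : Pat := pc2 3 x (.pair s (.pair t u))
def jSF (x s t u : Pat) : Pat := pc2 4 x (.pair s (.pair t u))
def jP (p : Pat) : Pat := pc 5 p
/-- Rules without premises, with one premise, with two premises, with a side condition. -/
def R0 (c : Pat) : Rule := ⟨.const 0, .const 1, .const 0, .const 0, c⟩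
def R1 (p c : Pat) : Rule := ⟨.const 0, .const 1, p, .const 0, c⟩
def R2 (p q c : Pat) : Rule := ⟨.const 0, .const 1, p, q, c⟩
def RN (x y p q c : Pat) : Rule := ⟨x, y, p, q, c⟩

local notation "A" => Pat.mv 0
local notation "B" => Pat.mv 1
local notation "C" => Pat.mv 2
local notation "D" => Pat.mv 3
local notation "E" => Pat.mv 4
local notation "G" => Pat.mv 5

/-- Rules for freshness in terms. -/
def tNT : List Rule := [
  RN A B (.const 0) (.const 0) (jNT A (pc 0 B)),
  R0 (jNT A (pc 1 (.const 0))),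
  R1 (jNT A B) (jNT A (pc 2 B)),
  R2 (jNT A B) (jNT A C) (jNT A (pc2 3 B C)),
  R2 (jNT A B) (jNT A C) (jNT A (pc2 4 B C))]

/-- Rules for freshness in formulas. -/
def tNF : List Rule := [
  R0 (jNF A (pc 0 (.const 0))),
  R2 (jNT A B) (jNT A C) (jNF A (pc2 1 B C)),
  R2 (jNT A B) (jNT A C) (jNF A (pc2 2 B C)),
  R2 (jNF A B) (jNF A C) (jNF A (pc2 3 B C)),
  R2 (jNF A B) (jNF A C) (jNF A (pc2 4 B C)),
  R2 (jNF A B) (jNF A C) (jNF A (pc2 5 B C)),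
  R1 (jNF A B) (jNF A (pc 6 B)),
  R0 (jNF A (pc2 7 A B)),
  R1 (jNF A B) (jNF A (pc2 7 C B)),
  R0 (jNF A (pc2 8 A B)),
  R1 (jNF A B) (jNF A (pc2 8 C B)),
  R1 (jNF A B) (jNF A (pc 9 B))]

/-- Rules for substitution in terms. -/
def tST : List Rule := [
  R1 (jNT A C) (jST A B C C),
  R0 (jST A B (pc 0 A) B),
  R1 (jST A B C D) (jST A B (pc 2 C) (pc 2 D)),
  R2 (jST A B C D) (jST A B E G) (jST A B (pc2 3 C E) (pc2 3 D G)),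
  R2 (jST A B C D) (jST A B E G) (jST A B (pc2 4 C E) (pc2 4 D G))]

/-- Rules for substitution in formulas. -/
def tSF : List Rule := [
  R1 (jNF A C) (jSF A B C C),
  R2 (jST A B C D) (jST A B E G) (jSF A B (pc2 1 C E) (pc2 1 D G)),
  R2 (jST A B C D) (jST A B E G) (jSF A B (pc2 2 C E) (pc2 2 D G)),
  R2 (jSF A B C D) (jSF A B E G) (jSF A B (pc2 3 C E) (pc2 3 D G)),
  R2 (jSF A B C D) (jSF A B E G) (jSF A B (pc2 4 C E) (pc2 4 D G)),
  R2 (jSF A B C D) (jSF A B E G) (jSF A B (pc2 5 C E) (pc2 5 D G)),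
  R1 (jSF A B C D) (jSF A B (pc 6 C) (pc 6 D)),
  R1 (jSF A B C D) (jSF A B (pc 9 C) (pc 9 D)),
  RN A E (jNT E B) (jSF A B C D) (jSF A B (pc2 7 E C) (pc2 7 E D)),
  RN A E (jNT E B) (jSF A B C D) (jSF A B (pc2 8 E C) (pc2 8 E D))]

/-- Rules for provability. -/
def tPR : List Rule := [
  R2 (jP (pImp A B)) (jP A) (jP B),
  R1 (jP A) (jP (pc2 7 B A)),
  R1 (jP A) (jP (pc 9 A)),
  R0 (jP (pImp A (pImp B A))),
  R0 (jP (pImp (pImp A (pImp B C)) (pImp (pImp A B) (pImp A C)))),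
  R0 (jP (pImp (pc 6 (pc 6 A)) A)),
  R0 (jP (pImp (pImp A B) (pImp (pImp A (pc 6 B)) (pc 6 A)))),
  R0 (jP (pImp (pc 6 A) (pImp A B))),
  R0 (jP (pImp (pc 0 (.const 0)) A)),
  R0 (jP (pImp (pImp A (pc 0 (.const 0))) (pc 6 A))),
  R0 (jP (pImp (pc 6 A) (pImp A (pc 0 (.const 0))))),
  R0 (jP (pImp A (pImp B (pc2 3 A B)))),
  R0 (jP (pImp (pc2 3 A B) A)),
  R0 (jP (pImp (pc2 3 A B) B)),
  R0 (jP (pImp A (pc2 4 A B))),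
  R0 (jP (pImp B (pc2 4 A B))),
  R0 (jP (pImp (pImp A C) (pImp (pImp B C) (pImp (pc2 4 A B) C)))),
  R1 (jSF A B C D) (jP (pImp (pc2 7 A C) D)),
  R1 (jNF A B) (jP (pImp (pc2 7 A (pImp B C)) (pImp B (pc2 7 A C)))),
  R1 (jSF A B C D) (jP (pImp D (pc2 8 A C))),
  R1 (jNF A C) (jP (pImp (pc2 7 A (pImp B C)) (pImp (pc2 8 A B) C))),
  R0 (jP (pEq A A)),
  R0 (jP (pImp (pEq A B) (pEq B A))),
  R0 (jP (pImp (pEq A B) (pImp (pEq B C) (pEq A C)))),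
  R0 (jP (pImp (pEq A B) (pEq (pc 2 A) (pc 2 B)))),
  R0 (jP (pImp (pEq A B) (pImp (pEq C D) (pEq (pc2 3 A C) (pc2 3 B D))))),
  R0 (jP (pImp (pEq A B) (pImp (pEq C D) (pEq (pc2 4 A C) (pc2 4 B D))))),
  R0 (jP (pImp (pEq A B) (pImp (pEq C D) (pImp (pc2 2 A C) (pc2 2 B D)))))]

/-- Soundness of a rule. -/
def Rule.Sound (T : Set Formula) (r : Rule) : Prop :=
  ∀ m, r.ne1.eval m ≠ r.ne2.eval m → Mean T (r.p.eval m) → Mean T (r.q.eval m) →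
    Mean T (r.c.eval m)

theorem tNT_sound (T : Set Formula) : ∀ r ∈ tNT, r.Sound T := by
  simp only [tNT, List.forall_mem_cons, Rule.Sound, R0, R1, R2, RN, jNT, pc2, pc, Pat.eval, mean1,
    dT_var, dT_zero, dT_succ, dT_add, dT_mul, Term.fv]
  simp +contextual

theorem tNF_sound (T : Set Formula) : ∀ r ∈ tNF, r.Sound T := by
  simp only [tNF, List.forall_mem_cons, Rule.Sound, R0, R1, R2, RN, jNT, jNF, pc2, pc, Pat.eval, mean1,
    mean2, dF_falsum, dF_eq, dF_le, dF_and, dF_or, dF_imp, dF_neg, dF_all, dF_ex, dF_box, Formula.fv]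
  simp +contextual

theorem tST_sound (T : Set Formula) : ∀ r ∈ tST, r.Sound T := by
  simp only [tST, List.forall_mem_cons, Rule.Sound, R0, R1, R2, RN, jNT, jST, pc2, pc, Pat.eval, mean1,
    mean3, dT_var, dT_succ, dT_add, dT_mul]
  refine ⟨fun m _ h _ => (Term.subst_fresh _ h).symm, ?_, ?_, ?_, ?_, by simp⟩
  all_goals simp +contextual [Term.subst, Term.substAll]

theorem tSF_sound (T : Set Formula) : ∀ r ∈ tSF, r.Sound T := by
  simp only [tSF, List.forall_mem_cons, Rule.Sound, R0, R1, R2, RN, jNT, jNF, jSF, jST, pc2, pc,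
    Pat.eval, mean1, mean2,
    mean3, mean4, dF_falsum, dF_eq, dF_le, dF_and, dF_or, dF_imp, dF_neg, dF_all, dF_ex, dF_box]
  refine ⟨fun m _ h _ => ⟨Formula.freeFor_of_notMem _ h, (Formula.subst_fresh _ h).symm⟩,
    ?_, ?_, ?_, ?_, ?_, ?_, ?_, ?_, ?_, by simp⟩
  · simp +contextual [Formula.subst, Formula.substAll, Formula.freeFor, Term.subst]
  · simp +contextual [Formula.subst, Formula.substAll, Formula.freeFor, Term.subst]
  · simp +contextual [Formula.subst, Formula.substAll, Formula.freeFor, Term.subst]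
  · simp +contextual [Formula.subst, Formula.substAll, Formula.freeFor, Term.subst]
  · simp +contextual [Formula.subst, Formula.substAll, Formula.freeFor, Term.subst]
  · simp +contextual [Formula.subst, Formula.substAll, Formula.freeFor, Term.subst]
  · simp +contextual [Formula.subst, Formula.substAll, Formula.freeFor, Term.subst]
  · intro m h1 h2 h3
    rw [subst_all_ne h1, h3.2]
    exact ⟨Or.inr (Or.inr ⟨h2, h3.1⟩), rfl⟩
  · intro m h1 h2 h3
    rw [subst_ex_ne h1, h3.2]
    exact ⟨Or.inr (Or.inr ⟨h2, h3.1⟩), rfl⟩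

theorem tPR_sound (T : Set Formula) : ∀ r ∈ tPR, r.Sound T := by
  simp only [tPR, List.forall_mem_cons, Rule.Sound, R0, R1, R2, RN, jNT, jNF, jSF, jST, jP, pc2, pc,
    pImp, pEq, Pat.eval, mean1, mean2,
    mean3, mean4, mean5, dF_falsum, dF_eq, dF_le, dF_and, dF_or, dF_imp, dF_neg, dF_all, dF_ex,
    dF_box, dT_succ, dT_add, dT_mul]
  refine ⟨fun m _ h1 h2 => .mp h1 h2, fun m _ h _ => .gen _ h, fun m _ h _ => .nec h,
    fun m _ _ _ => .logic (.imp1 _ _), fun m _ _ _ => .logic (.imp2 _ _ _),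
    fun m _ _ _ => .logic (.dne _), fun m _ _ _ => .logic (.negI _ _),
    fun m _ _ _ => .logic (.negE _ _), fun m _ _ _ => .logic (.falsumE _),
    fun m _ _ _ => .logic (.negIntro _), fun m _ _ _ => .logic (.negElimFalsum _),
    fun m _ _ _ => .logic (.andI _ _), fun m _ _ _ => .logic (.andE1 _ _),
    fun m _ _ _ => .logic (.andE2 _ _), fun m _ _ _ => .logic (.orI1 _ _),
    fun m _ _ _ => .logic (.orI2 _ _), fun m _ _ _ => .logic (.orE _ _ _),
    fun m _ h _ => by rw [h.2]; exact .logic (.allE _ _ _ h.1),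
    fun m _ h _ => .logic (.allImp _ _ _ h),
    fun m _ h _ => by rw [h.2]; exact .logic (.exI _ _ _ h.1),
    fun m _ h _ => .logic (.exE _ _ _ h),
    fun m _ _ _ => .logic (.eqRefl _), fun m _ _ _ => .logic (.eqSymm _ _),
    fun m _ _ _ => .logic (.eqTrans _ _ _), fun m _ _ _ => .logic (.eqSucc _ _),
    fun m _ _ _ => .logic (.eqAdd _ _ _ _), fun m _ _ _ => .logic (.eqMul _ _ _ _),
    fun m _ _ _ => .logic (.eqLe _ _ _ _), by simp⟩

/-- All rules. -/
def tAll : List Rule := tNT ++ tNF ++ tST ++ tSF ++ tPR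

/-- Axioms: the trivial judgement and the axioms of the theory. -/
def axJ (T : Set Formula) (n : ℕ) : Prop := n = 0 ∨ ∃ φ ∈ T, Nat.pair 5 φ.code = n

theorem der_sound {T : Set Formula} {n : ℕ} (h : Der (axJ T) tAll n) : Mean T n := by
  induction h with
  | ax h =>
    rcases h with rfl | ⟨φ, h, rfl⟩
    · exact mean0 T
    · simpa using Provable.ax h
  | rule hr _ _ ih1 ih2 =>
    obtain ⟨r, hr, m, h1, rfl, rfl, rfl⟩ := hr
    have : r.Sound T := by
      simp only [tAll, List.mem_append] at hr
      rcases hr with (((hr | hr) | hr) | hr) | hr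
      exacts [tNT_sound T r hr, tNF_sound T r hr, tST_sound T r hr, tSF_sound T r hr,
        tPR_sound T r hr]
    exact this m h1 ih1 ih2

theorem der_use {T : Set Formula} {r : Rule} (hr : r ∈ tAll) (m : Fin 6 → ℕ)
    (h0 : r.ne1.eval m ≠ r.ne2.eval m) (h1 : Der (axJ T) tAll (r.p.eval m))
    (h2 : Der (axJ T) tAll (r.q.eval m)) : Der (axJ T) tAll (r.c.eval m) :=
  .rule ⟨r, hr, m, h0, rfl, rfl, rfl⟩ h1 h2

theorem der0 {T : Set Formula} : Der (axJ T) tAll 0 := .ax (Or.inl rfl)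

theorem der_R0 {T : Set Formula} {c : Pat} (hr : R0 c ∈ tAll) (m : Fin 6 → ℕ) :
    Der (axJ T) tAll (c.eval m) :=
  der_use hr m (by simp [R0, Pat.eval]) der0 der0

theorem der_R1 {T : Set Formula} {p c : Pat} (hr : R1 p c ∈ tAll) (m : Fin 6 → ℕ)
    (h : Der (axJ T) tAll (p.eval m)) : Der (axJ T) tAll (c.eval m) :=
  der_use hr m (by simp [R1, Pat.eval]) h der0

theorem der_R2 {T : Set Formula} {p q c : Pat} (hr : R2 p q c ∈ tAll) (m : Fin 6 → ℕ)
    (h : Der (axJ T) tAll (p.eval m)) (h' : Der (axJ T) tAll (q.eval m)) :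
    Der (axJ T) tAll (c.eval m) :=
  der_use hr m (by simp [R2, Pat.eval]) h h'

theorem mem_NT {r : Rule} (h : r ∈ tNT) : r ∈ tAll := by simp [tAll, h]
theorem mem_NF {r : Rule} (h : r ∈ tNF) : r ∈ tAll := by simp [tAll, h]
theorem mem_ST {r : Rule} (h : r ∈ tST) : r ∈ tAll := by simp [tAll, h]
theorem mem_SF {r : Rule} (h : r ∈ tSF) : r ∈ tAll := by simp [tAll, h]
theorem mem_PR {r : Rule} (h : r ∈ tPR) : r ∈ tAll := by simp [tAll, h]

end ModalArith

namespace ModalArith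

theorem der_nth {T : Set Formula} {L : List Rule} (hL : ∀ {r}, r ∈ L → r ∈ tAll) (k : ℕ) (hk : k < L.length)
    (m : Fin 6 → ℕ) (h0 : L[k].ne1.eval m ≠ L[k].ne2.eval m)
    (h1 : Der (axJ T) tAll (L[k].p.eval m)) (h2 : Der (axJ T) tAll (L[k].q.eval m)) :
    Der (axJ T) tAll (L[k].c.eval m) :=
  der_use (hL (List.getElem_mem hk)) m h0 h1 h2

theorem der_NT {T : Set Formula} {x : ℕ} {t : Term} (h : x ∉ t.fv) :
    Der (axJ T) tAll (Nat.pair 1 (Nat.pair x t.code)) := by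
  induction t with
  | var y =>
    have h : x ≠ y := by simpa [Term.fv] using h
    exact der_nth mem_NT 0 (by decide) ![x, y, 0, 0, 0, 0] h der0 der0
  | zero => exact der_nth mem_NT 1 (by decide) ![x, 0, 0, 0, 0, 0] zero_ne_one der0 der0
  | succ t ih => exact der_nth mem_NT 2 (by decide) ![x, t.code, 0, 0, 0, 0] zero_ne_one (ih h) der0
  | add t u iht ihu =>
    simp only [Term.fv, Finset.mem_union, not_or] at h
    exact der_nth mem_NT 3 (by decide) ![x, t.code, u.code, 0, 0, 0] zero_ne_one (iht h.1) (ihu h.2)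
  | mul t u iht ihu =>
    simp only [Term.fv, Finset.mem_union, not_or] at h
    exact der_nth mem_NT 4 (by decide) ![x, t.code, u.code, 0, 0, 0] zero_ne_one (iht h.1) (ihu h.2)

theorem der_NF {T : Set Formula} {x : ℕ} {φ : Formula} (h : x ∉ φ.fv) :
    Der (axJ T) tAll (Nat.pair 2 (Nat.pair x φ.code)) := by
  induction φ with
  | falsum => exact der_nth mem_NF 0 (by decide) ![x, 0, 0, 0, 0, 0] zero_ne_one der0 der0
  | eq t u =>
    simp only [Formula.fv, Finset.mem_union, not_or] at h
    exact der_nth mem_NF 1 (by decide) ![x, t.code, u.code, 0, 0, 0] zero_ne_one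
      (der_NT h.1) (der_NT h.2)
  | le t u =>
    simp only [Formula.fv, Finset.mem_union, not_or] at h
    exact der_nth mem_NF 2 (by decide) ![x, t.code, u.code, 0, 0, 0] zero_ne_one
      (der_NT h.1) (der_NT h.2)
  | and t u iht ihu =>
    simp only [Formula.fv, Finset.mem_union, not_or] at h
    exact der_nth mem_NF 3 (by decide) ![x, t.code, u.code, 0, 0, 0] zero_ne_one (iht h.1) (ihu h.2)
  | or t u iht ihu =>
    simp only [Formula.fv, Finset.mem_union, not_or] at h
    exact der_nth mem_NF 4 (by decide) ![x, t.code, u.code, 0, 0, 0] zero_ne_one (iht h.1) (ihu h.2)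
  | imp t u iht ihu =>
    simp only [Formula.fv, Finset.mem_union, not_or] at h
    exact der_nth mem_NF 5 (by decide) ![x, t.code, u.code, 0, 0, 0] zero_ne_one (iht h.1) (ihu h.2)
  | neg t ih => exact der_nth mem_NF 6 (by decide) ![x, t.code, 0, 0, 0, 0] zero_ne_one (ih h) der0
  | all y t ih =>
    by_cases hxy : x = y
    · subst hxy
      exact der_nth mem_NF 7 (by decide) ![x, t.code, 0, 0, 0, 0] zero_ne_one der0 der0
    · simp only [Formula.fv, Finset.mem_erase, not_and] at h
      exact der_nth mem_NF 8 (by decide) ![x, t.code, y, 0, 0, 0] zero_ne_one (ih (h hxy)) der0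
  | ex y t ih =>
    by_cases hxy : x = y
    · subst hxy
      exact der_nth mem_NF 9 (by decide) ![x, t.code, 0, 0, 0, 0] zero_ne_one der0 der0
    · simp only [Formula.fv, Finset.mem_erase, not_and] at h
      exact der_nth mem_NF 10 (by decide) ![x, t.code, y, 0, 0, 0] zero_ne_one (ih (h hxy)) der0
  | box t ih => exact der_nth mem_NF 11 (by decide) ![x, t.code, 0, 0, 0, 0] zero_ne_one (ih h) der0

theorem der_ST {T : Set Formula} {x : ℕ} {s t : Term} :
    Der (axJ T) tAll (Nat.pair 3 (Nat.pair x (Nat.pair s.code (Nat.pair t.code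
      (Term.subst x s t).code)))) := by
  induction t with
  | var y =>
    by_cases hxy : x = y
    · subst hxy
      rw [show Term.subst x s (.var x) = s by simp [Term.subst, Term.substAll]]
      exact der_nth mem_ST 1 (by decide) ![x, s.code, 0, 0, 0, 0] zero_ne_one der0 der0
    · rw [tsubst_var_ne hxy]
      have hn : x ∉ (Term.var y).fv := by simpa [Term.fv] using hxy
      exact der_nth mem_ST 0 (by decide) ![x, s.code, (Term.var y).code, 0, 0, 0] zero_ne_one
        (der_NT hn) der0
  | zero =>
    exact der_nth mem_ST 0 (by decide) ![x, s.code, Term.zero.code, 0, 0, 0] zero_ne_one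
        (der_NT (by simp [Term.fv])) der0
  | succ t ih =>
    exact der_nth mem_ST 2 (by decide) ![x, s.code, t.code, (Term.subst x s t).code, 0, 0] zero_ne_one
      ih der0
  | add t u iht ihu =>
    exact der_nth mem_ST 3 (by decide) ![x, s.code, t.code, (Term.subst x s t).code, u.code,
      (Term.subst x s u).code] zero_ne_one iht ihu
  | mul t u iht ihu =>
    exact der_nth mem_ST 4 (by decide) ![x, s.code, t.code, (Term.subst x s t).code, u.code,
      (Term.subst x s u).code] zero_ne_one iht ihu

theorem der_SF {T : Set Formula} {x : ℕ} {s : Term} {φ : Formula} (h : φ.freeFor s x) :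
    Der (axJ T) tAll (Nat.pair 4 (Nat.pair x (Nat.pair s.code (Nat.pair φ.code
      (φ.subst x s).code)))) := by
  have key : ∀ ψ : Formula, x ∉ ψ.fv → Der (axJ T) tAll (Nat.pair 4 (Nat.pair x (Nat.pair s.code
      (Nat.pair ψ.code (ψ.subst x s).code)))) := by
    intro ψ hψ
    rw [Formula.subst_fresh _ hψ]
    exact der_nth mem_SF 0 (by decide) ![x, s.code, ψ.code, 0, 0, 0] zero_ne_one (der_NF hψ) der0
  induction φ with
  | falsum => exact key _ (by simp [Formula.fv])
  | eq t u =>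
    exact der_nth mem_SF 1 (by decide) ![x, s.code, t.code, (Term.subst x s t).code, u.code,
      (Term.subst x s u).code] zero_ne_one der_ST der_ST
  | le t u =>
    exact der_nth mem_SF 2 (by decide) ![x, s.code, t.code, (Term.subst x s t).code, u.code,
      (Term.subst x s u).code] zero_ne_one der_ST der_ST
  | and t u iht ihu =>
    exact der_nth mem_SF 3 (by decide) ![x, s.code, t.code, (t.subst x s).code, u.code,
      (u.subst x s).code] zero_ne_one (iht h.1) (ihu h.2)
  | or t u iht ihu =>
    exact der_nth mem_SF 4 (by decide) ![x, s.code, t.code, (t.subst x s).code, u.code,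
      (u.subst x s).code] zero_ne_one (iht h.1) (ihu h.2)
  | imp t u iht ihu =>
    exact der_nth mem_SF 5 (by decide) ![x, s.code, t.code, (t.subst x s).code, u.code,
      (u.subst x s).code] zero_ne_one (iht h.1) (ihu h.2)
  | neg t ih =>
    exact der_nth mem_SF 6 (by decide) ![x, s.code, t.code, (t.subst x s).code, 0, 0] zero_ne_one
      (ih h) der0
  | box t ih =>
    exact der_nth mem_SF 7 (by decide) ![x, s.code, t.code, (t.subst x s).code, 0, 0] zero_ne_one
      (ih h) der0
  | all y t ih =>
    by_cases hx : x ∈ (Formula.all y t).fv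
    · simp only [Formula.fv, Finset.mem_erase] at hx
      rcases h with h | h | h
      · exact absurd h hx.1
      · exact absurd hx.2 h
      · rw [subst_all_ne hx.1]
        exact der_nth mem_SF 8 (by decide) ![x, s.code, t.code, (t.subst x s).code, y, 0] hx.1
          (der_NT h.1) (ih h.2)
    · exact key _ hx
  | ex y t ih =>
    by_cases hx : x ∈ (Formula.ex y t).fv
    · simp only [Formula.fv, Finset.mem_erase] at hx
      rcases h with h | h | h
      · exact absurd h hx.1
      · exact absurd hx.2 h
      · rw [subst_ex_ne hx.1]
        exact der_nth mem_SF 9 (by decide) ![x, s.code, t.code, (t.subst x s).code, y, 0] hx.1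
          (der_NT h.1) (ih h.2)
    · exact key _ hx

theorem der_logic {T : Set Formula} {φ : Formula} (h : LogicalAxiom φ) :
    Der (axJ T) tAll (Nat.pair 5 φ.code) := by
  have go : ∀ (k : ℕ) (hk : k < tPR.length) (m : Fin 6 → ℕ)
    (_ : tPR[k].ne1.eval m ≠ tPR[k].ne2.eval m)
    (_ : Der (axJ T) tAll (tPR[k].p.eval m)) (_ : Der (axJ T) tAll (tPR[k].q.eval m)),
    Der (axJ T) tAll (tPR[k].c.eval m) := der_nth mem_PR
  cases h with
  | imp1 a b => exact go 3 (by decide) ![a.code, b.code, 0, 0, 0, 0] zero_ne_one der0 der0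
  | imp2 a b c => exact go 4 (by decide) ![a.code, b.code, c.code, 0, 0, 0] zero_ne_one der0 der0
  | dne a => exact go 5 (by decide) ![a.code, 0, 0, 0, 0, 0] zero_ne_one der0 der0
  | negI a b => exact go 6 (by decide) ![a.code, b.code, 0, 0, 0, 0] zero_ne_one der0 der0
  | negE a b => exact go 7 (by decide) ![a.code, b.code, 0, 0, 0, 0] zero_ne_one der0 der0
  | falsumE a => exact go 8 (by decide) ![a.code, 0, 0, 0, 0, 0] zero_ne_one der0 der0
  | negIntro a => exact go 9 (by decide) ![a.code, 0, 0, 0, 0, 0] zero_ne_one der0 der0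
  | negElimFalsum a => exact go 10 (by decide) ![a.code, 0, 0, 0, 0, 0] zero_ne_one der0 der0
  | andI a b => exact go 11 (by decide) ![a.code, b.code, 0, 0, 0, 0] zero_ne_one der0 der0
  | andE1 a b => exact go 12 (by decide) ![a.code, b.code, 0, 0, 0, 0] zero_ne_one der0 der0
  | andE2 a b => exact go 13 (by decide) ![a.code, b.code, 0, 0, 0, 0] zero_ne_one der0 der0
  | orI1 a b => exact go 14 (by decide) ![a.code, b.code, 0, 0, 0, 0] zero_ne_one der0 der0
  | orI2 a b => exact go 15 (by decide) ![a.code, b.code, 0, 0, 0, 0] zero_ne_one der0 der0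
  | orE a b c => exact go 16 (by decide) ![a.code, b.code, c.code, 0, 0, 0] zero_ne_one der0 der0
  | allE x t a h =>
    exact go 17 (by decide) ![x, t.code, a.code, (a.subst x t).code, 0, 0] zero_ne_one
        (der_SF h) der0
  | allImp x a b h => exact go 18 (by decide) ![x, a.code, b.code, 0, 0, 0] zero_ne_one (der_NF h) der0
  | exI x t a h =>
    exact go 19 (by decide) ![x, t.code, a.code, (a.subst x t).code, 0, 0] zero_ne_one
        (der_SF h) der0
  | exE x a b h => exact go 20 (by decide) ![x, a.code, b.code, 0, 0, 0] zero_ne_one (der_NF h) der0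
  | eqRefl a => exact go 21 (by decide) ![a.code, 0, 0, 0, 0, 0] zero_ne_one der0 der0
  | eqSymm a b => exact go 22 (by decide) ![a.code, b.code, 0, 0, 0, 0] zero_ne_one der0 der0
  | eqTrans a b c => exact go 23 (by decide) ![a.code, b.code, c.code, 0, 0, 0] zero_ne_one der0 der0
  | eqSucc a b => exact go 24 (by decide) ![a.code, b.code, 0, 0, 0, 0] zero_ne_one der0 der0
  | eqAdd a b c d => exact go 25 (by decide) ![a.code, b.code, c.code, d.code, 0, 0] zero_ne_one der0 der0
  | eqMul a b c d => exact go 26 (by decide) ![a.code, b.code, c.code, d.code, 0, 0] zero_ne_one der0 der0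
  | eqLe a b c d => exact go 27 (by decide) ![a.code, b.code, c.code, d.code, 0, 0] zero_ne_one der0 der0

theorem der_complete {T : Set Formula} {φ : Formula} (h : Provable T φ) :
    Der (axJ T) tAll (Nat.pair 5 φ.code) := by
  induction h with
  | @ax φ h => exact .ax (Or.inr ⟨φ, h, rfl⟩)
  | logic h => exact der_logic h
  | @mp a b _ _ ih1 ih2 =>
    exact der_nth mem_PR 0 (by decide) ![a.code, b.code, 0, 0, 0, 0] zero_ne_one ih1 ih2
  | @gen a x _ ih => exact der_nth mem_PR 1 (by decide) ![a.code, x, 0, 0, 0, 0] zero_ne_one ih der0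
  | @nec a _ ih => exact der_nth mem_PR 2 (by decide) ![a.code, 0, 0, 0, 0, 0] zero_ne_one ih der0

theorem der_iff {T : Set Formula} {φ : Formula} :
    Der (axJ T) tAll (Nat.pair 5 φ.code) ↔ Provable T φ :=
  ⟨fun h => by simpa using der_sound h, der_complete⟩

theorem DD.axJ {T : Set Formula} (hre : RE T) : DD fun a => axJ T (a 0) := by
  have h := (((DD.partrec hre).sub [0, 1]).and ((DD.eq (.var 1) .zero).and
    ((DD.eq (.var 2) (Term.numeral 5)).and (DD.pair.sub [2, 0, 3])))).ex.ex.ex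
  refine ((DD.eq (.var 0) .zero).or h).congr fun a => ?_
  change (a 0 = 0 ∨ ∃ c y x, y ∈ Part.assert (∃ φ ∈ T, Formula.code φ = x) (fun _ => Part.some 0) ∧
    y = 0 ∧ c = (Term.numeral 5).val _ ∧ Nat.pair c x = a 0) ↔ _
  simp only [val_numeral, ModalArith.axJ]
  refine or_congr Iff.rfl ?_
  constructor
  · rintro ⟨_, _, x, h, rfl, rfl, h'⟩
    obtain ⟨⟨φ, h1, h2⟩, _⟩ := Part.mem_assert_iff.1 h
    exact ⟨φ, h1, by rw [h2]; exact h'⟩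
  · rintro ⟨φ, h1, h2⟩
    exact ⟨5, 0, φ.code, Part.mem_assert_iff.2 ⟨⟨φ, h1, rfl⟩, Part.mem_some _⟩, rfl, rfl, h2⟩

theorem DD.numeral : DD fun a => (Term.numeral (a 0)).code = a 1 := by
  have h : Nat.Partrec (fun n => Part.some (Term.numeral n).code) := by
    have h1 : Primrec fun n : ℕ => (Term.numeral n).code := by
      have h2 : Primrec fun n : ℕ => Nat.rec (motive := fun _ => ℕ) (Nat.pair 1 0)
          (fun _ ih => Nat.pair 2 ih) n :=
        Primrec.nat_rec₁ _ (Primrec₂.natPair.comp (Primrec.const 2) Primrec.snd).to₂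
      refine h2.of_eq fun n => ?_
      induction n with
      | zero => rfl
      | succ n ih => simp only [ih]; rfl
    exact Nat.Partrec.of_primrec (Primrec.nat_iff.1 h1)
  exact (DD.partrec h).congr fun a => by simp [eq_comm]

/-- Provability of the instances of a pattern (`mv 0` is the parameter `k`, `mv 1` is the code of
the numeral of `k`) is Σ₁. -/
theorem DD.prov {T : Set Formula} (hre : RE T) (p : Pat) :
    DD fun a => Der (ModalArith.axJ T) tAll
      (p.eval ![a 0, (Term.numeral (a 0)).code, 0, 0, 0, 0]) := by
  -- environment: y n z k
  have h := ((DD.numeral.sub [3, 1]).and ((DD.eq (.var 2) .zero).and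
    ((DD.pat p ![3, 1, 2, 2, 2, 2] 0).and ((DD.der (DD.axJ hre) tAll).sub [0])))).ex.ex.ex
  refine h.congr fun a => ?_
  have key : ∀ y n z, (fun i => cns y (cns n (cns z a)) (![3, 1, 2, 2, 2, 2] i)) =
      ![a 0, n, z, z, z, z] := by
    intro y n z; funext i; fin_cases i <;> rfl
  simp only [key]
  change (∃ z n y, (Term.numeral (a 0)).code = n ∧ z = 0 ∧ p.eval ![a 0, n, z, z, z, z] = y ∧
    Der (ModalArith.axJ T) tAll y) ↔ _
  simp

/-- Form used in the diagonal argument. -/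
theorem exists_prov {T : Set Formula} (hre : RE T) (p : Pat) (Φ : Formula → Formula)
    (hp : ∀ θ : Formula, p.eval ![θ.code, (Term.numeral θ.code).code, 0, 0, 0, 0] =
      Nat.pair 5 (Φ θ).code) :
    ∃ φ, IsSigma1 φ ∧ φ.fv ⊆ {0} ∧ ∀ θ : Formula, ∀ v : ℕ → ℕ, v 0 = θ.code →
      (φ.val v ↔ Provable T (Φ θ)) := by
  obtain ⟨φ, h1, h2, h3⟩ := DD.close (R := fun k => Der (axJ T) tAll
    (p.eval ![k, (Term.numeral k).code, 0, 0, 0, 0])) (DD.prov hre p)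
  refine ⟨φ, h1, h2, fun θ v hv => ?_⟩
  rw [h3, hv, hp, der_iff]

end ModalArith

namespace ModalArith

/-! ## The Rosser-style argument -/

/-- `∃ v₀ (v₀ = k̄ ∧ ∃ s (δ ∧ θ))`. -/
def Wrap (k s : ℕ) (δ θ : Formula) : Formula :=
  .ex 0 (.and (.eq (.var 0) (Term.numeral k)) (.ex s (.and δ θ)))

/-- The pattern of the code of `Wrap`. -/
def pWrap (s : ℕ) (δ : Formula) (p : Pat) : Pat :=
  pc2 8 (.const 0) (pc2 3 (pc2 1 (pc 0 (.const 0)) (.mv 1))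
    (pc2 8 (.const s) (pc2 3 (.const δ.code) p)))

theorem wrap_sentence {k s : ℕ} {δ θ : Formula} (hδ : ∀ y ∈ δ.fv, y = s)
    (hθ : ∀ y ∈ θ.fv, y = 0 ∨ y = s) : Sentence (Wrap k s δ θ) := by
  apply Finset.eq_empty_of_forall_notMem
  intro y hy
  simp only [Wrap, Formula.fv, Finset.mem_erase, Finset.mem_union, Term.fv, numeral_fv,
    Finset.mem_singleton, Finset.notMem_empty] at hy
  grind

theorem wrap_boxed {T : Set Formula} (hT : Extends T PAK) {k s : ℕ} {δ θ : Formula}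
    (hδ : IsDelta0 δ) (hθ : IsDelta0 θ) : Boxed T (Wrap k s δ θ) :=
  Boxed.ex hT 0 (Boxed.and hT (Boxed.eq hT _ _) (Boxed.ex hT s ((hδ.and hθ).boxed hT).1))

theorem wrap_elim {T : Set Formula} {k s : ℕ} {δ θ : Formula} (hs : s ≠ 0) {w : World T}
    (h : w (Wrap k s δ θ)) : ∃ w' : World T, w' (.eq (.var 0) (Term.numeral k)) ∧ w' δ ∧ w' θ := by
  obtain ⟨w1, _, h1⟩ := w.ex.1 h
  obtain ⟨h1, h2⟩ := w1.and.1 h1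
  obtain ⟨w2, hv, h2⟩ := w1.ex.1 h2
  exact ⟨w2, (hv.eq (by simpa [Term.fv] using hs) (by simp)).2 h1, w2.and.1 h2⟩

theorem wrap_cases {T : Set Formula} {k s : ℕ} {δ : Formula} (θ : Formula) (hs : s ≠ 0)
    (hδ : ∀ y ∈ δ.fv, y = s) {w : World T} (h : w (.ex s δ)) :
    w (Wrap k s δ θ.neg) ∨ w (Wrap k s δ θ) := by
  obtain ⟨w1, hv, h1⟩ := w.set_var 0 (t := Term.numeral k) (by simp)
  have h2 : w1 (.ex s δ) := (hv _ (by
    rw [mem_fv_ex]; rintro ⟨h3, h4⟩; exact h3 (hδ _ h4))).2 h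
  obtain ⟨w2, hv2, h2⟩ := w1.ex.1 h2
  by_cases hθ : w2 θ
  · right
    refine w.ex.2 ⟨w1, hv, w1.and.2 ⟨h1, w1.ex.2 ⟨w2, hv2, w2.and.2 ⟨h2, hθ⟩⟩⟩⟩
  · left
    refine w.ex.2 ⟨w1, hv, w1.and.2 ⟨h1, w1.ex.2 ⟨w2, hv2, w2.and.2 ⟨h2, w2.neg.2 hθ⟩⟩⟩⟩

/-- If `δ` is false at all standard numbers, then a witness of `δ` is above every numeral. -/
theorem above {T : Set Formula} (hT : Extends T PAK) {s : ℕ} {δ : Formula} (hδ : IsDelta0 δ)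
    (hfv : ∀ y ∈ δ.fv, y = s) (hfalse : ∀ v, ¬ δ.val v) {w : World T} (h : w δ) (n : ℕ) :
    w (.le (.succ (Term.numeral n)) (.var s)) := by
  rw [← w.not_le hT]
  intro hle
  obtain ⟨k, _, hk⟩ := w.lt_num hT (n := n + 1) ((w.succ_le_succ hT).2 hle)
  refine hfalse (fun _ => k) ((hδ.decide hT w _ ?_).1 h)
  intro y hy
  rw [hfv y hy]; exact hk

theorem rosser {T : Set Formula} (hT : Extends T PAK) (hre : RE T) {s : ℕ} {δ : Formula} (hs : s ≠ 0)
    (hδ : IsDelta0 δ) (hfv : ∀ y ∈ δ.fv, y = s) (hfalse : ∀ v, ¬ δ.val v) (χ : Formula) :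
    ∃ a b : Formula, Sentence a ∧ Sentence b ∧ Boxed T a ∧ Boxed T b ∧
      (∀ w : World T, w (.ex s δ) → w a ∨ w b) ∧
      (Provable T (.box a) ∨ Provable T (.box (χ.or b)) → Provable T (.box χ)) := by
  obtain ⟨φP, hP1, hP2, hP3⟩ := exists_prov hre (jP (pc 9 (pWrap s δ (pc 6 (.mv 0)))))
    (fun θ => .box (Wrap θ.code s δ θ.neg)) (fun θ => rfl)
  obtain ⟨φQ, hQ1, hQ2, hQ3⟩ := exists_prov hre
    (jP (pc 9 (pc2 4 (.const χ.code) (pWrap s δ (.mv 0)))))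
    (fun θ => .box (χ.or (Wrap θ.code s δ θ))) (fun θ => rfl)
  obtain ⟨r, α, hα⟩ := exists_NF hT hQ1 {0, s}
  obtain ⟨r', β, hβ⟩ := exists_NF hT hP1 {0, s, r}
  have hr := hα.fr
  have hr' := hβ.fr
  simp only [Finset.mem_insert, Finset.mem_singleton, not_or] at hr hr'
  obtain ⟨hr0, hrs⟩ := hr
  obtain ⟨hr'0, hr's, hr'r⟩ := hr'
  have hαfv : ∀ y ∈ α.fv, y = r ∨ y = 0 := fun y hy =>
    (hα.fv y hy).imp_right fun h => by simpa using hQ2 h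
  have hβfv : ∀ y ∈ β.fv, y = r' ∨ y = 0 := fun y hy =>
    (hβ.fv y hy).imp_right fun h => by simpa using hP2 h
  have hxr : r ∉ (Term.succ (.var r')).fv := by simpa [Term.fv] using Ne.symm hr'r
  have hxr' : r' ∉ (Term.var s).fv := by simpa [Term.fv] using hr's
  obtain ⟨Ξ, hΞ⟩ : ∃ Ξ, Ξ = Formula.and β (Formula.ball r (.succ (.var r')) α.neg) := ⟨_, rfl⟩
  have hΞ0 : IsDelta0 Ξ := by rw [hΞ]; exact hβ.d0.and (.ball hxr hα.d0.neg)
  have hΞfv : ∀ y ∈ Ξ.fv, y = r' ∨ y = 0 := by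
    intro y hy
    rw [hΞ, Formula.fv, Finset.mem_union, mem_fv_ball] at hy
    rcases hy with hy | ⟨h1, hy | hy⟩
    · exact hβfv y hy
    · left; simpa [Term.fv] using hy
    · right; exact (hαfv y hy).resolve_left h1
  obtain ⟨Θ, hΘ⟩ : ∃ Θ, Θ = Formula.bex r' (.var s) Ξ := ⟨_, rfl⟩
  have hΘ0 : IsDelta0 Θ := by rw [hΘ]; exact .bex hxr' hΞ0
  have hΘfv : ∀ y ∈ Θ.fv, y = 0 ∨ y = s := by
    intro y hy
    rw [hΘ, mem_fv_bex] at hy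
    have := hΞfv y
    tauto
  refine ⟨Wrap Θ.code s δ Θ.neg, Wrap Θ.code s δ Θ, wrap_sentence hfv hΘfv, wrap_sentence hfv hΘfv,
    wrap_boxed hT hδ hΘ0.neg, wrap_boxed hT hδ hΘ0, fun w h => wrap_cases Θ hs hfv h, ?_⟩
  have hP := hP3 Θ
  have hQ := hQ3 Θ
  obtain ⟨k, hk⟩ : ∃ k, k = Θ.code := ⟨_, rfl⟩
  rw [← hk] at hP hQ ⊢
  -- agreement
  have agr : ∀ (w : World T) (x j : ℕ), x ≠ 0 → w (.eq (.var 0) (Term.numeral k)) →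
      w (.eq (.var x) (Term.numeral j)) → ∀ y, y = x ∨ y = 0 →
      w (.eq (.var y) (Term.numeral (Function.update (fun _ => k) x j y))) := by
    rintro w x j hx h0 h1 y (rfl | rfl)
    · simpa using h1
    · rwa [Function.update_of_ne (Ne.symm hx)]
  by_cases hc : ∃ n', Ξ.val (Function.update (fun _ => k) r' n')
  · obtain ⟨n', hn'⟩ := hc
    have hna : ∀ w : World T, ¬ w (Wrap k s δ Θ.neg) := by
      intro w hw
      obtain ⟨w2, h0, hd, hθ⟩ := wrap_elim hs hw
      refine w2.neg.1 hθ ?_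
      rw [hΘ]
      obtain ⟨w3, hv, h3⟩ := w2.set_var r' (t := Term.numeral n') (by simp)
      refine w2.ex.2 ⟨w3, hv, w3.and.2 ⟨?_, ?_⟩⟩
      · have hd3 : w3 δ := (hv _ fun h => hr's (hfv _ h)).2 hd
        refine w3.le_congr ?_ rfl (above hT hδ hfv hfalse hd3 n')
        rw [w3.q_succ, w3.q_succ, w3.eq.1 h3]
      · refine (hΞ0.decide hT w3 _ ?_).2 hn'
        intro y hy
        exact agr w3 r' n' hr'0 ((hv.eq (by simpa [Term.fv] using hr'0) (by simp)).2 h0) h3 y (hΞfv y hy)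
    have hb : Provable T (.box (Wrap k s δ Θ.neg)) := by
      rw [hΞ] at hn'
      exact (hP (fun _ => k) rfl).1 ((hβ.val _).2 ⟨n', hn'.1⟩)
    intro _
    exact prov_of_worlds fun w => box_mono hT (fun w h => (hna w h).elim) w (w.thm hb)
  · intro h
    have hb : Provable T (.box (χ.or (Wrap k s δ Θ))) := by
      rcases h with h | h
      · obtain ⟨n', hn'⟩ := (hβ.val _).1 ((hP (fun _ => k) rfl).2 h)
        by_contra hcon
        refine hc ⟨n', ?_⟩
        rw [hΞ]
        refine ⟨hn', (val_ball hxr).2 fun n _ hα' => hcon ?_⟩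
        refine (hQ _ ?_).1 ((hα.val _).2 ⟨n, hα'⟩)
        rw [Function.update_of_ne (Ne.symm hr'0)]
      · exact h
    obtain ⟨n, hn⟩ := (hα.val _).1 ((hQ (fun _ => k) rfl).2 hb)
    have hnb : ∀ w : World T, ¬ w (Wrap k s δ Θ) := by
      intro w hw
      obtain ⟨w2, h0, hd, hθ⟩ := wrap_elim hs hw
      rw [hΘ] at hθ
      obtain ⟨w3, hv, h3⟩ := w2.ex.1 hθ
      have h3 := (w3.and.1 h3).2
      have h03 := (hv.eq (by simpa [Term.fv] using hr'0) (by simp)).2 h0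
      rcases w3.le_total hT (Term.numeral n) (.var r') with hle | hlt
      · rw [hΞ] at h3
        have h4 := (w3.and.1 h3).2
        obtain ⟨w4, hv4, h5⟩ := w3.set_var r (t := Term.numeral n) (by simp)
        have h6 := w3.all.1 h4 w4 hv4
        have hle4 := (hv4.le (by simp) (by simpa [Term.fv] using Ne.symm hr'r)).2 hle
        refine w4.neg.1 (w4.imp.1 h6 ((w4.succ_le_succ hT).2
          (w4.le_congr (w4.eq.1 h5).symm rfl hle4))) ?_
        refine (hα.d0.decide hT w4 _ ?_).2 hn
        intro y hy
        exact agr w4 r n hr0 ((hv4.eq (by simpa [Term.fv] using hr0) (by simp)).2 h03) h5 y (hαfv y hy)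
      · obtain ⟨j, _, hj⟩ := w3.lt_num hT hlt
        refine hc ⟨j, (hΞ0.decide hT w3 _ ?_).1 h3⟩
        intro y hy
        exact agr w3 r' j hr'0 h03 hj y (hΞfv y hy)
    refine prov_of_worlds fun w => box_mono hT (fun w h => ?_) w (w.thm hb)
    exact (w.or.1 h).resolve_right (hnb w)

theorem World.disj {T : Set Formula} (w : World T) : ∀ l : List Formula,
    w (ModalArith.disj l) ↔ ∃ φ ∈ l, w φ
  | [] => by simp only [ModalArith.disj, List.not_mem_nil, false_and, exists_false, iff_false]; exact w.falsum
  | [φ] => by simp [ModalArith.disj]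
  | φ :: ψ :: l => by
    rw [ModalArith.disj, w.or, World.disj w (ψ :: l)]
    simp

theorem statement10 (T : Set Formula) (hre : RE T) (hT : Extends T PAK)
    (n : ℕ) (hn : 1 ≤ n) (hdp : HasBnDP T (n + 1))
    (φ : Fin n → Formula) (σ : Formula)
    (hφ : ∀ i, Sentence (φ i)) (hσ1 : IsSigma1 σ) (hσs : Sentence σ)
    (h : Provable T (disj ((List.ofFn fun i => Formula.box (φ i)) ++ [σ]))) :
    (∃ i, Provable T (Formula.box (φ i))) ∨ Provable T σ := by
  by_contra hcon
  rw [not_or] at hcon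
  obtain ⟨hno, hσ⟩ := hcon
  have hfal : ∀ v, ¬ σ.val v := fun v hv => hσ (sigma1_complete hT hσ1 hσs
    ((Formula.val_congr fun x hx => by rw [hσs] at hx; simp at hx).1 hv))
  obtain ⟨s, δ, hδ⟩ := exists_NF hT hσ1 {0}
  have hs : s ≠ 0 := by simpa using hδ.fr
  obtain ⟨m, rfl⟩ : ∃ m, n = m + 1 := ⟨n - 1, by omega⟩
  obtain ⟨a, b, ha, hb, hab, hbb, hcase, hend⟩ := rosser hT hre hs hδ.d0
    (fun y hy => (hδ.fv y hy).resolve_right fun h => by rw [hσs] at h; simp at h)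
    (fun v hv => hfal v ((hδ.val v).2 ⟨v s, by rwa [Function.update_eq_self]⟩)) (φ 0)
  obtain ⟨ψ, hψl, hψc⟩ : ∃ ψ : Fin (m + 1 + 1) → Formula, ψ (Fin.last _) = a ∧
      ∀ i : Fin (m + 1), ψ i.castSucc = if i = 0 then (φ i).or b else φ i :=
    ⟨Fin.snoc (α := fun _ => Formula) (fun i => if i = 0 then (φ i).or b else φ i) a,
      by simp, fun i => by simp⟩
  have hψs : ∀ i, Sentence (ψ i) := by
    intro i
    refine Fin.lastCases ?_ (fun i => ?_) i
    · rwa [hψl]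
    · rw [hψc]
      split_ifs
      · have h1 := hφ i
        simp only [Sentence] at h1 hb ⊢
        simp [Formula.fv, h1, hb]
      · exact hφ i
  obtain ⟨i, hi⟩ := hdp ψ hψs (prov_of_worlds fun w => by
    rw [w.disj]
    obtain ⟨χ, hχ, hw⟩ := (w.disj _).1 (w.thm h)
    have fin : ∀ j, w (.box (ψ j)) → ∃ χ ∈ List.ofFn (fun i => Formula.box (ψ i)), w χ :=
      fun j hj => ⟨_, List.mem_ofFn.2 ⟨j, rfl⟩, hj⟩
    rw [List.mem_append, List.mem_ofFn, List.mem_singleton] at hχ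
    rcases hχ with ⟨i, rfl⟩ | rfl
    · refine fin i.castSucc ?_
      rw [hψc]
      split_ifs
      · exact box_mono hT (fun w h => w.or.2 (Or.inl h)) w hw
      · exact hw
    · rcases hcase w (hδ.imp w hw) with hw | hw
      · exact fin (Fin.last _) (by rw [hψl]; exact hab w hw)
      · refine fin (Fin.castSucc 0) ?_
        rw [hψc, if_pos rfl]
        exact box_mono hT (fun w h => w.or.2 (Or.inr h)) w (hbb w hw))
  revert hi
  refine Fin.lastCases ?_ (fun i => ?_) i
  · rw [hψl]
    exact fun hi => hno ⟨0, hend (Or.inl hi)⟩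
  · rw [hψc]
    split_ifs with h0
    · subst h0
      exact fun hi => hno ⟨0, hend (Or.inr hi)⟩
    · exact fun hi => hno ⟨i, hi⟩

end ModalArith
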